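/- For every integer r₀≥200 there exists ε₀>0 such that for every irrational α and every v∈C^∞(𝕋,ℝ) for which there is a constant c∈ℝ with ‖v−c‖_{50r₀}<ε₀, the set of energies E∈ℝ such that the Schrödinger cocycle (α,A_{v,E}) is C^∞-rotations-reducible has positive Lebesgue measure. -/

import Mathlib

open Real MeasureTheory Filter Finset

attribute [local instance] Matrix.frobeniusNormedAddCommGroup Matrix.frobeniusNormedSpace

/-- The rotation matrix `R_θ` by angle `2πθ`. -/
noncomputable def Rot (θ : ℝ) : Matrix (Fin 2) (Fin 2) ℝ :=
  !![Real.cos (2*π*θ), -Real.sin (2*π*θ); Real.sin (2*π*θ), Real.cos (2*π*θ)]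

/-- `|f|₀ = sup_x ‖f x‖`. -/
noncomputable def C0norm {E : Type*} [NormedAddCommGroup E] (f : ℝ → E) : ℝ := ⨆ x, ‖f x‖

/-- `‖f‖_k = ∑_{h=0}^{k} sup_x ‖D^h f x‖`. -/
noncomputable def Cnorm {E : Type*} [NormedAddCommGroup E] [NormedSpace ℝ E]
    (k : ℕ) (f : ℝ → E) : ℝ :=
  ∑ h ∈ Finset.range (k+1), ⨆ x, ‖iteratedDeriv h f x‖

/-- `‖x‖ = dist(x, ℤ)`. -/
noncomputable def distToInt (x : ℝ) : ℝ := |x - round x|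

/-- `q` is the sequence of denominators of best rational approximations of `α`. -/
def IsBestApproxDenoms (α : ℝ) (q : ℕ → ℕ) : Prop :=
  q 0 = 1 ∧
  (∀ n : ℕ, ∀ k : ℕ, 1 ≤ k → k < q (n+1) → distToInt ((q n : ℝ) * α) ≤ distToInt ((k : ℝ) * α)) ∧
  (∀ n : ℕ, 1 / ((q (n+1) : ℝ) + (q n : ℝ)) < distToInt ((q n : ℝ) * α) ∧
    distToInt ((q n : ℝ) * α) < 1 / (q (n+1) : ℝ))

/-- The selected subsequence `(n_h)` of Definition 1: `n₀ = 0`; if some `q_k` lies in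
`[q_{n_h+1}², q_{n_h+1}⁴)` then `n_{h+1}` is the smallest such `k`, otherwise
`n_{h+1} = max {k : q_k ≤ q_{n_h+1}²}`. -/
def IsSelectedSubseq (q : ℕ → ℕ) (nseq : ℕ → ℕ) : Prop :=
  nseq 0 = 0 ∧ ∀ h : ℕ,
    ((∃ k, (q (nseq h + 1))^2 ≤ q k ∧ q k < (q (nseq h + 1))^4) →
      ((q (nseq h + 1))^2 ≤ q (nseq (h+1)) ∧ q (nseq (h+1)) < (q (nseq h + 1))^4 ∧
        ∀ k, (q (nseq h + 1))^2 ≤ q k → q k < (q (nseq h + 1))^4 → nseq (h+1) ≤ k)) ∧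
    ((¬ ∃ k, (q (nseq h + 1))^2 ≤ q k ∧ q k < (q (nseq h + 1))^4) →
      (q (nseq (h+1)) ≤ (q (nseq h + 1))^2 ∧
        ∀ k, q k ≤ (q (nseq h + 1))^2 → k ≤ nseq (h+1)))

/-- Birkhoff sums `S_m f (x) = ∑_{j<m} f (x + jα)`. -/
noncomputable def birkhoff (α : ℝ) (f : ℝ → ℝ) (m : ℕ) (x : ℝ) : ℝ :=
  ∑ j ∈ Finset.range m, f (x + j * α)

/-- Iterated cocycle `A^{(m)}(x) = A(x+(m-1)α) ⋯ A(x+α) A(x)`. -/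
noncomputable def cocycleIter (α : ℝ) (A : ℝ → Matrix (Fin 2) (Fin 2) ℝ) :
    ℕ → ℝ → Matrix (Fin 2) (Fin 2) ℝ
  | 0, _ => 1
  | (m+1), x => A (x + m * α) * cocycleIter α A m x

/-- The unit vector `(cos 2πy, sin 2πy)`. -/
noncomputable def unitVec (y : ℝ) : Fin 2 → ℝ := ![Real.cos (2*π*y), Real.sin (2*π*y)]

/-- The orbit of the second coordinate under the lift `G̃(x,y) = (x+α, y + f(x,y))`. -/
noncomputable def liftOrbit (f : ℝ → ℝ → ℝ) (α x y : ℝ) : ℕ → ℝ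
  | 0 => y
  | (i+1) => liftOrbit f α x y i + f (x + i * α) (liftOrbit f α x y i)

/-- `ρ` is a representative of the fibered rotation number of the cocycle `(α, A)`:
there is a continuous lift `G̃(x,y) = (x+α, y + f(x,y))` of the projectivized cocycle
(with `f` 1-periodic in both variables) whose Birkhoff averages converge to `ρ`. -/
def IsRotNumRep (α : ℝ) (A : ℝ → Matrix (Fin 2) (Fin 2) ℝ) (ρ : ℝ) : Prop :=
  ∃ f : ℝ → ℝ → ℝ, Continuous (Function.uncurry f) ∧
    (∀ x y, f (x + 1) y = f x y ∧ f x (y + 1) = f x y) ∧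
    (∀ x y, ∃ r : ℝ, 0 < r ∧ (A x).mulVec (unitVec y) = r • unitVec (y + f x y)) ∧
    (∀ x y : ℝ, Tendsto
      (fun n : ℕ => (∑ i ∈ Finset.range n, f (x + i * α) (liftOrbit f α x y i)) / n)
      atTop (nhds ρ))


/-- The Schrödinger cocycle `A_{v,E}`. -/
noncomputable def schrodingerCocycle (v : ℝ → ℝ) (E : ℝ) (x : ℝ) : Matrix (Fin 2) (Fin 2) ℝ :=
  !![E - v x, -1; 1, 0]

/-- `(α, A)` is `C^∞`-rotations-reducible. -/
def RotationsReducible (α : ℝ) (A : ℝ → Matrix (Fin 2) (Fin 2) ℝ) : Prop :=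
  ∃ B : ℝ → Matrix (Fin 2) (Fin 2) ℝ, ContDiff ℝ (⊤ : ℕ∞) B ∧ Function.Periodic B 2 ∧
    (∀ x, (B x).det = 1) ∧ ∀ x : ℝ, ∃ θ : ℝ, B (x + α) * A x * (B x)⁻¹ = Rot θ

/-- The character `x ↦ e^{2πix}`, on complex arguments. -/
noncomputable def unitExp (x : ℂ) : ℂ := Complex.exp (2 * π * Complex.I * x)

theorem unitExp_add (x y : ℂ) : unitExp (x + y) = unitExp x * unitExp y := by
  rw [unitExp, unitExp, unitExp, ← Complex.exp_add]; ring_nf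

theorem unitExp_int (n : ℤ) : unitExp n = 1 := by
  rw [unitExp, ← Complex.exp_int_mul_two_pi_mul_I n]; ring_nf

theorem norm_unitExp_ofReal (x : ℝ) : ‖unitExp x‖ = 1 := by
  have : 2 * π * Complex.I * x = ((2 * π * x : ℝ) : ℂ) * Complex.I := by push_cast; ring
  rw [unitExp, this, Complex.norm_exp_ofReal_mul_I]

theorem unitExp_nat_mul (n : ℕ) (x : ℂ) : unitExp (n * x) = unitExp x ^ n := by
  rw [unitExp, unitExp, ← Complex.exp_nat_mul]; ring_nf

theorem two_mul_abs_sub_round_le_abs_sin (x : ℝ) : 2 * |x - round x| ≤ |Real.sin (π * x)| := by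
  have h1 : Real.sin (π * x) = (-1) ^ (round x) * Real.sin (π * (x - round x)) := by
    have : π * x = π * (x - round x) + round x * π := by ring
    rw [this, Real.sin_add_int_mul_pi]
  have h2 : |(-1 : ℝ) ^ (round x)| = 1 := by
    rw [abs_zpow]; simp
  rw [h1, abs_mul, h2, one_mul]
  have h3 : |π * (x - round x)| ≤ π / 2 := by
    rw [abs_mul, abs_of_pos Real.pi_pos]
    have := abs_sub_round x
    nlinarith [Real.pi_pos]
  have h4 := Real.mul_abs_le_abs_sin h3
  rw [abs_mul, abs_of_pos Real.pi_pos] at h4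
  have h5 : 2 / π * (π * |x - round x|) = 2 * |x - round x| := by
    field_simp
  linarith

theorem norm_unitExp_sub_one (x : ℝ) : ‖unitExp x - 1‖ = 2 * |Real.sin (π * x)| := by
  have := Complex.norm_exp_I_mul_ofReal_sub_one (2 * π * x)
  have h : unitExp x = Complex.exp (Complex.I * ((2 * π * x : ℝ) : ℂ)) := by
    rw [unitExp]; push_cast; ring_nf
  rw [h, this]
  have : 2 * π * x / 2 = π * x := by ring
  rw [this, norm_mul]; simp

theorem norm_sum_unitExp_le {x M : ℝ} (hM : 0 < M) (h : 1 / (2 * M) ≤ |x - round x|) (j : ℕ) :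
    ‖∑ t ∈ range j, unitExp ((t : ℂ) * x)‖ ≤ M := by
  have h1 := norm_unitExp_sub_one x
  have h2 := two_mul_abs_sub_round_le_abs_sin x
  have h3 : 2 / M ≤ ‖unitExp x - 1‖ := by
    have : 2 / M = 4 * (1 / (2 * M)) := by field_simp; ring
    rw [h1, this]; linarith
  simp_rw [unitExp_nat_mul]
  have h4 := geom_sum_mul (unitExp x) j
  have h5 : ‖unitExp x ^ j - 1‖ ≤ 2 := by
    refine (norm_sub_le _ _).trans ?_
    rw [norm_pow, norm_unitExp_ofReal]; norm_num
  rw [← h4, norm_mul] at h5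
  have h6 : ‖∑ t ∈ range j, unitExp x ^ t‖ * (2 / M) ≤ 2 :=
    (mul_le_mul_of_nonneg_left h3 (norm_nonneg _)).trans h5
  have h7 : ‖∑ t ∈ range j, unitExp x ^ t‖ * (2 / M) = 2 * (‖∑ t ∈ range j, unitExp x ^ t‖ / M) := by
    ring
  rw [h7] at h6
  have h8 : ‖∑ t ∈ range j, unitExp x ^ t‖ / M ≤ 1 := by linarith
  rwa [div_le_one hM] at h8

/-- The rational `r` is a good approximant of `α` at scale `N`: the approximation error beats
the scale, and Weyl sums along the rotation by `r` up to its denominator are at most `N |m|`. -/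
structure GoodScale (α N : ℝ) (r : ℚ) : Prop where
  den_le : (r.den : ℝ) ≤ N ^ (7 / 6 : ℝ)
  dist_le : |α - r| ≤ 1 / (N ^ (7 / 6 : ℝ) * r.den)
  weyl : ∀ m : ℤ, m ≠ 0 → ∀ j ≤ r.den,
    ‖∑ t ∈ range j, unitExp ((t : ℂ) * ((m * r : ℝ) : ℂ))‖ ≤ N * |(m : ℝ)|

theorem exists_rat_close (α : ℝ) {Y : ℝ} (hY : 1 ≤ Y) :
    ∃ r : ℚ, (r.den : ℝ) ≤ Y ∧ |α - r| ≤ 1 / (Y * r.den) := by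
  have hn : 0 < ⌊Y⌋₊ := Nat.floor_pos.mpr hY
  obtain ⟨r, h1, h2⟩ := Real.exists_rat_abs_sub_le_and_den_le α hn
  refine ⟨r, (Nat.cast_le.mpr h2).trans (Nat.floor_le (by linarith)), h1.trans ?_⟩
  have : (0 : ℝ) < r.den := by exact_mod_cast r.den_pos
  have := (Nat.lt_floor_add_one Y).le
  gcongr

theorem norm_sum_unitExp_le_card (x : ℝ) (j : ℕ) :
    ‖∑ t ∈ range j, unitExp ((t : ℂ) * x)‖ ≤ j := by
  refine (norm_sum_le _ _).trans ?_
  have : ∀ t ∈ range j, ‖unitExp ((t : ℂ) * x)‖ ≤ 1 := fun t _ => by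
    have := norm_unitExp_ofReal (t * x)
    push_cast at this; exact this.le
  simpa using Finset.sum_le_card_nsmul _ _ 1 this

/-- Dirichlet's approximant at scale `N` is good as soon as no small multiple of `α` is within
`1/N` of an integer. -/
theorem goodScale_of_no_small {α N : ℝ} (hN : 2 ≤ N) {r : ℚ} (h1 : (r.den : ℝ) ≤ N ^ (7 / 6 : ℝ))
    (h2 : |α - r| ≤ 1 / (N ^ (7 / 6 : ℝ) * r.den))
    (h : (r.den : ℝ) ≤ N ∨ ∀ m : ℤ, m ≠ 0 → |(m : ℝ)| < N ^ (1 / 6 : ℝ) → ∀ l : ℤ,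
      1 / N ≤ |m * α - l|) : GoodScale α N r := by
  refine ⟨h1, h2, fun m hm j hj => ?_⟩
  have hN0 : 0 < N := by linarith
  have hm1 : (1 : ℝ) ≤ |(m : ℝ)| := by
    exact_mod_cast Int.one_le_abs hm
  have hpow : N ^ (7 / 6 : ℝ) = N * N ^ (1 / 6 : ℝ) := by
    rw [mul_comm, ← Real.rpow_add_one hN0.ne']; norm_num
  have hjr : (j : ℝ) ≤ r.den := by exact_mod_cast hj
  have hden : (1 : ℝ) ≤ r.den := by exact_mod_cast r.den_pos
  rcases h with h | h
  · refine (norm_sum_unitExp_le_card _ j).trans (hjr.trans (h.trans ?_))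
    nlinarith
  · by_cases hq : (r.den : ℝ) ≤ N
    · refine (norm_sum_unitExp_le_card _ j).trans (hjr.trans (hq.trans ?_))
      nlinarith
    push Not at hq
    by_cases hmb : |(m : ℝ)| < N ^ (1 / 6 : ℝ)
    · have key : 1 / (2 * N) ≤ |(m * r : ℝ) - round (m * r : ℝ)| := by
        have e1 := h m hm hmb (round (m * r : ℝ))
        have e2 : |m * α - round (m * r : ℝ)| ≤
            |(m * r : ℝ) - round (m * r : ℝ)| + |(m : ℝ)| * |α - r| := by
          rw [← abs_mul]
          have : m * α - round (m * r : ℝ) = ((m * r : ℝ) - round (m * r : ℝ)) + m * (α - r) := by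
            ring
          rw [this]; exact abs_add_le _ _
        have e3 : |(m : ℝ)| * |α - r| ≤ 1 / N ^ 2 := by
          have : 0 < N ^ (1 / 6 : ℝ) := by positivity
          calc |(m : ℝ)| * |α - r| ≤ N ^ (1 / 6 : ℝ) * (1 / (N ^ (7 / 6 : ℝ) * r.den)) := by
                gcongr
            _ = 1 / (N * r.den) := by rw [hpow]; field_simp
            _ ≤ 1 / N ^ 2 := by
                rw [pow_two]; gcongr
        have e4 : 1 / N ^ 2 ≤ 1 / (2 * N) := by
          rw [pow_two]; gcongr
        have e5 : 1 / N = 1 / (2 * N) + 1 / (2 * N) := by field_simp; ring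
        linarith
      refine (norm_sum_unitExp_le hN0 key j).trans ?_
      nlinarith
    · push Not at hmb
      refine (norm_sum_unitExp_le_card _ j).trans (hjr.trans (h1.trans ?_))
      rw [hpow]; gcongr

theorem rat_sub_ge {a b : ℚ} (hab : a ≠ b) : 1 / ((a.den : ℝ) * b.den) ≤ |(a : ℝ) - b| := by
  have ha : (0 : ℝ) < a.den := by exact_mod_cast a.den_pos
  have hb : (0 : ℝ) < b.den := by exact_mod_cast b.den_pos
  have ea : (a : ℝ) = a.num / a.den := by exact_mod_cast (Rat.num_div_den a).symm
  have eb : (b : ℝ) = b.num / b.den := by exact_mod_cast (Rat.num_div_den b).symm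
  have h1 : (a : ℝ) - b = ((a.num * b.den - b.num * a.den : ℤ) : ℝ) / (a.den * b.den) := by
    rw [ea, eb]; push_cast; field_simp
  have h2 : (a.num * b.den - b.num * a.den : ℤ) ≠ 0 := by
    intro h0
    apply hab
    have : (a : ℝ) - b = 0 := by rw [h1, h0]; simp
    exact_mod_cast sub_eq_zero.mp this
  rw [h1, abs_div, abs_of_pos (mul_pos ha hb)]
  gcongr
  exact_mod_cast Int.one_le_abs h2

theorem exists_goodScale {α N : ℝ} (hα : Irrational α) (hN : 4 ≤ N) :
    ∃ N' : ℝ, N ≤ N' ∧ N' ≤ 2 * N ^ (7 / 6 : ℝ) ∧ ∃ r : ℚ, GoodScale α N' r := by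
  have hN0 : 0 < N := by linarith
  have hpow : N ^ (7 / 6 : ℝ) = N * N ^ (1 / 6 : ℝ) := by
    rw [mul_comm, ← Real.rpow_add_one hN0.ne']; norm_num
  have hN6 : 1 ≤ N ^ (1 / 6 : ℝ) := Real.one_le_rpow (by linarith) (by norm_num)
  have hN7 : N ≤ N ^ (7 / 6 : ℝ) := by rw [hpow]; nlinarith
  obtain ⟨r, hr1, hr2⟩ := exists_rat_close α (Y := N ^ (7 / 6 : ℝ)) (by linarith)
  by_cases hg : (r.den : ℝ) ≤ N ∨ ∀ m : ℤ, m ≠ 0 → |(m : ℝ)| < N ^ (1 / 6 : ℝ) → ∀ l : ℤ,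
      1 / N ≤ |m * α - l|
  · exact ⟨N, le_rfl, by linarith, r, goodScale_of_no_small (by linarith) hr1 hr2 hg⟩
  push Not at hg
  obtain ⟨hq, m, hm, hmN, l, hl⟩ := hg
  set s : ℚ := (l : ℚ) / m with hs
  have hsden : ((s.den : ℕ) : ℝ) ≤ |(m : ℝ)| := by
    have h1 : (s.den : ℤ) ∣ m := by
      rw [hs, ← Rat.divInt_eq_div]; exact Rat.den_dvd l m
    have h2 : (s.den : ℤ) ≤ |m| := Int.le_of_dvd (abs_pos.mpr hm) ((dvd_abs _ _).mpr h1)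
    exact_mod_cast h2
  have hmR : (m : ℝ) ≠ 0 := by exact_mod_cast hm
  have hs0 : (1 : ℝ) ≤ s.den := by exact_mod_cast s.den_pos
  have hr0 : (1 : ℝ) ≤ r.den := by exact_mod_cast r.den_pos
  have hsR : (s : ℝ) = l / m := by rw [hs]; push_cast; rfl
  have hαs : α - s ≠ 0 := sub_ne_zero.mpr fun h => hα ⟨s, h.symm⟩
  set y : ℝ := s.den * |α - s| with hy
  have hy0 : 0 < y := by have := abs_pos.mpr hαs; positivity
  have hyN : y < 1 / N := by
    refine lt_of_le_of_lt ?_ hl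
    have : (m : ℝ) * α - l = m * (α - s) := by rw [hsR]; field_simp
    rw [this, abs_mul, hy]; gcongr
  have hden_lt : (s.den : ℝ) < r.den := by
    have : N ^ (1 / 6 : ℝ) ≤ N := by
      nth_rewrite 2 [← Real.rpow_one N]
      exact Real.rpow_le_rpow_of_exponent_le (by linarith) (by norm_num)
    linarith
  have hyr : 1 / (2 * r.den) ≤ y := by
    have hne : s ≠ r := by rintro h; rw [h] at hden_lt; exact lt_irrefl _ hden_lt
    have h1 := rat_sub_ge hne
    have h2 : |(s : ℝ) - r| ≤ |α - s| + |α - r| := by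
      have : (s : ℝ) - r = (α - r) - (α - s) := by ring
      rw [this]; refine (abs_sub _ _).trans (by linarith)
    have h3 : |α - r| ≤ 1 / (2 * (s.den * r.den)) := by
      refine hr2.trans ?_
      rw [← mul_assoc]
      have : 2 * (s.den : ℝ) ≤ N ^ (7 / 6 : ℝ) := by
        rw [hpow]
        nlinarith
      gcongr
    have h4 : 1 / ((s.den : ℝ) * r.den) = 1 / (2 * (s.den * r.den)) + 1 / (2 * (s.den * r.den)) := by
      field_simp; ring
    have h5 : 1 / (2 * ((s.den : ℝ) * r.den)) ≤ |α - s| := by linarith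
    calc 1 / (2 * (r.den : ℝ)) = s.den * (1 / (2 * ((s.den : ℝ) * r.den))) := by field_simp
      _ ≤ y := by rw [hy]; gcongr
  set X : ℝ := 1 / y with hX
  have hyX : y = 1 / X := by rw [hX]; simp
  have hXN : N < X := by
    rw [hX, lt_one_div hN0 hy0]; exact hyN
  have hX2 : X ≤ 2 * r.den := by
    rw [hX, one_div_le hy0 (by positivity)]; exact hyr
  have hX0 : 0 < X := by linarith
  obtain ⟨r', h1, h2⟩ := exists_rat_close α (Y := X ^ (7 / 6 : ℝ))
    (Real.one_le_rpow (by linarith) (by norm_num))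
  refine ⟨X, hXN.le, by linarith, r', goodScale_of_no_small (by linarith) h1 h2 (Or.inr ?_)⟩
  intro m' hm' hmX l'
  by_contra! hlt
  have hm'R : (m' : ℝ) ≠ 0 := by exact_mod_cast hm'
  have hX6 : X ^ (1 / 6 : ℝ) ≤ X / 2 := by
    have e1 : X ^ (1 / 6 : ℝ) ≤ X ^ (1 / 2 : ℝ) :=
      Real.rpow_le_rpow_of_exponent_le (by linarith) (by norm_num)
    have e2 : X ^ (1 / 2 : ℝ) * X ^ (1 / 2 : ℝ) = X := by
      rw [← Real.rpow_add hX0]; norm_num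
    have e3 : 2 ≤ X ^ (1 / 2 : ℝ) := by
      have : (4 : ℝ) ^ (1 / 2 : ℝ) = 2 := by
        rw [show (4 : ℝ) = 2 ^ (2 : ℝ) by norm_num, ← Real.rpow_mul (by norm_num)]; norm_num
      exact this.symm.le.trans (Real.rpow_le_rpow (by norm_num) (by linarith) (by norm_num))
    nlinarith
  have hsX : (s.den : ℝ) ≤ X / 2 := by
    have : N ^ (1 / 6 : ℝ) ≤ X ^ (1 / 6 : ℝ) := Real.rpow_le_rpow hN0.le hXN.le (by norm_num)
    linarith
  set s' : ℚ := (l' : ℚ) / m' with hs'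
  have hs'R : (s' : ℝ) = l' / m' := by rw [hs']; push_cast; rfl
  have hαs' : |(m' : ℝ)| * |α - s'| < 1 / X := by
    have : (m' : ℝ) * α - l' = m' * (α - s') := by rw [hs'R]; field_simp
    rw [this, abs_mul] at hlt; exact hlt
  have hs'den : ((s'.den : ℕ) : ℝ) ≤ |(m' : ℝ)| := by
    have h1 : (s'.den : ℤ) ∣ m' := by
      rw [hs', ← Rat.divInt_eq_div]; exact Rat.den_dvd l' m'
    have h2 : (s'.den : ℤ) ≤ |m'| := Int.le_of_dvd (abs_pos.mpr hm') ((dvd_abs _ _).mpr h1)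
    exact_mod_cast h2
  have hs'0 : (1 : ℝ) ≤ s'.den := by exact_mod_cast s'.den_pos
  have hα' : (s'.den : ℝ) * |α - s'| < 1 / X :=
    lt_of_le_of_lt (mul_le_mul_of_nonneg_right hs'den (abs_nonneg _)) hαs'
  by_cases hss : s' = s
  · rw [hss, ← hyX] at hα'
    exact lt_irrefl _ hα'
  · have h3 := rat_sub_ge hss
    have h4 : |(s' : ℝ) - s| ≤ |α - s'| + |α - s| := by
      have : (s' : ℝ) - s = (α - s) - (α - s') := by ring
      rw [this]; refine (abs_sub _ _).trans (by linarith)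
    have h5 : 1 ≤ s.den * (s'.den * |α - s'|) + s'.den * (s.den * |α - s|) := by
      have e1 : 1 / ((s'.den : ℝ) * s.den) ≤ |α - s'| + |α - s| := h3.trans h4
      rw [div_le_iff₀ (by positivity)] at e1
      linarith
    rw [← hy, hyX] at h5
    have h6 : (s.den : ℝ) * (s'.den * |α - s'|) < s.den * (1 / X) := by gcongr
    have h7 : (s.den : ℝ) * (1 / X) ≤ 1 / 2 := by
      rw [mul_one_div, div_le_iff₀ hX0]; linarith
    have h8 : (s'.den : ℝ) * (1 / X) ≤ 1 / 2 := by
      rw [mul_one_div, div_le_iff₀ hX0]; linarith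
    linarith

/-- A lower bound for the scales at which the construction starts. -/
noncomputable def minScale : ℝ := (20 : ℝ) ^ 360

theorem le_minScale : (4 : ℝ) ^ 240 ≤ minScale := by
  have h : minScale = ((20 : ℝ) ^ 180) ^ 2 := by rw [minScale, ← pow_mul]
  rw [h]; norm_num

/-- The nonresonance threshold attached to a denominator `q`. -/
noncomputable def resThreshold (q : ℝ) : ℝ := 1 / 20 * q ^ (-(1 / 30) : ℝ)

theorem volume_sin_lt_le {q : ℕ} (hq : 0 < q) {d : ℝ} (hd : 0 ≤ d) :
    volume {x ∈ Set.Ioo (1 : ℝ) 2 | |Real.sin (q * x)| < d} ≤ ENNReal.ofReal (2 * π * d) := by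
  have hq0 : (0 : ℝ) < q := by exact_mod_cast hq
  have hsub : {x ∈ Set.Ioo (1 : ℝ) 2 | |Real.sin (q * x)| < d} ⊆
      ⋃ k ∈ Finset.range (q + 1), Metric.ball (π * k / q) (π * d / (2 * q)) := by
    rintro x ⟨⟨hx1, hx2⟩, hx⟩
    have h1 := two_mul_abs_sub_round_le_abs_sin (q * x / π)
    rw [mul_div_cancel₀ _ Real.pi_ne_zero] at h1
    set k := round (q * x / π) with hk
    have hπ := Real.pi_gt_three
    have hle : q * x / π < q := by
      rw [div_lt_iff₀ Real.pi_pos]; nlinarith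
    have hge : 0 < q * x / π := by positivity
    have hab := abs_le.mp (abs_sub_round (q * x / π))
    rw [← hk] at hab
    have hk0 : 0 ≤ k := by
      have : (-1 : ℝ) < k := by linarith
      have : (-1 : ℤ) < k := by exact_mod_cast this
      linarith
    have hkq : k ≤ q := by
      have : (k : ℝ) < q + 1 := by linarith
      have : k < (q : ℤ) + 1 := by exact_mod_cast this
      linarith
    have hkn : ((k.toNat : ℕ) : ℝ) = k := by
      have : ((k.toNat : ℕ) : ℤ) = k := Int.toNat_of_nonneg hk0
      exact_mod_cast this
    refine Set.mem_iUnion₂.mpr ⟨k.toNat, by simp; omega, ?_⟩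
    rw [Metric.mem_ball, Real.dist_eq, hkn]
    have e : x - π * k / q = (q * x / π - k) * (π / q) := by
      field_simp
    rw [e, abs_mul, abs_of_pos (div_pos Real.pi_pos hq0)]
    have : |q * x / π - k| < d / 2 := by linarith
    calc _ < d / 2 * (π / q) := by
          apply mul_lt_mul_of_pos_right this (by positivity)
      _ = _ := by ring
  refine (measure_mono hsub).trans ((measure_biUnion_finset_le _ _).trans ?_)
  simp only [Real.volume_ball, Finset.sum_const, Finset.card_range, nsmul_eq_mul]
  rw [← ENNReal.ofReal_natCast, ← ENNReal.ofReal_mul (by positivity)]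
  apply ENNReal.ofReal_le_ofReal
  have h1 : (1 : ℝ) ≤ q := by exact_mod_cast hq
  have e : ((q + 1 : ℕ) : ℝ) * (2 * (π * d / (2 * q))) = (q + 1) / q * (π * d) := by
    push_cast; field_simp
  rw [e]
  have : ((q : ℝ) + 1) / q ≤ 2 := by rw [div_le_iff₀ hq0]; linarith
  have h0 : 0 ≤ π * d := by positivity
  nlinarith

theorem exists_scale_seq {α L : ℝ} (hα : Irrational α) (hL : minScale ≤ L) :
    ∃ (N : ℕ → ℝ) (r : ℕ → ℚ), L ≤ N 0 ∧ N 0 ≤ 2 * L ^ (7 / 6 : ℝ) ∧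
      (∀ i, GoodScale α (N i) (r i)) ∧ (∀ i, L ≤ N i) ∧
      (∀ i, N i ^ (5 / 4 : ℝ) ≤ N (i + 1)) ∧ (∀ i, N (i + 1) ≤ N i ^ (3 / 2 : ℝ)) := by
  have hL4 : (2 : ℝ) ^ 24 ≤ L := le_trans (by norm_num) (le_minScale.trans hL)
  have hstep : ∀ p : {p : ℝ × ℚ // L ≤ p.1 ∧ GoodScale α p.1 p.2},
      ∃ p' : {p : ℝ × ℚ // L ≤ p.1 ∧ GoodScale α p.1 p.2},
        p.1.1 ^ (5 / 4 : ℝ) ≤ p'.1.1 ∧ p'.1.1 ≤ p.1.1 ^ (3 / 2 : ℝ) := by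
    rintro ⟨⟨N, r⟩, hN, hg⟩
    simp only at hN ⊢
    have hN24 : (2 : ℝ) ^ 24 ≤ N := hL4.trans hN
    have hN1 : 1 ≤ N := le_trans (by norm_num) hN24
    have hN54 : N ≤ N ^ (5 / 4 : ℝ) := by
      simpa using Real.rpow_le_rpow_of_exponent_le hN1 (show (1 : ℝ) ≤ 5 / 4 by norm_num)
    obtain ⟨N', h1, h2, r', hr'⟩ := exists_goodScale hα (N := N ^ (5 / 4 : ℝ))
      (le_trans (by norm_num) (hN24.trans hN54))
    refine ⟨⟨⟨N', r'⟩, by simp only; linarith, hr'⟩, h1, h2.trans ?_⟩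
    rw [← Real.rpow_mul (by linarith)]
    have h2 : (2 : ℝ) ≤ N ^ (1 / 24 : ℝ) := by
      have : ((2 : ℝ) ^ 24) ^ (1 / 24 : ℝ) = 2 := by
        rw [← Real.rpow_natCast, ← Real.rpow_mul (by norm_num)]; norm_num
      exact this.symm.le.trans (Real.rpow_le_rpow (by norm_num) hN24 (by norm_num))
    have h3 : N ^ (3 / 2 : ℝ) = N ^ (1 / 24 : ℝ) * N ^ (5 / 4 * (7 / 6) : ℝ) := by
      rw [← Real.rpow_add (by linarith)]; norm_num
    rw [h3]
    gcongr
  obtain ⟨N0, h1, h2, r0, hr0⟩ := exists_goodScale hα (N := L) (le_trans (by norm_num) hL4)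
  choose f hf using hstep
  let s : ℕ → {p : ℝ × ℚ // L ≤ p.1 ∧ GoodScale α p.1 p.2} :=
    fun n => Nat.rec ⟨⟨N0, r0⟩, h1, hr0⟩ (fun _ p => f p) n
  exact ⟨fun n => (s n).1.1, fun n => (s n).1.2, h1, h2, fun i => (s i).2.2, fun i => (s i).2.1,
    fun i => (hf (s i)).1, fun i => (hf (s i)).2⟩

theorem scale_growth {N : ℕ → ℝ} (h0 : ∀ i, minScale ≤ N i)
    (h : ∀ i, N i ^ (5 / 4 : ℝ) ≤ N (i + 1)) (i : ℕ) : (4 : ℝ) ^ (30 * (i + 1)) ≤ N i := by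
  induction i with
  | zero => exact le_trans (by norm_num) (le_minScale.trans (h0 0))
  | succ i ih =>
    refine le_trans ?_ (h i)
    have hN := h0 i
    have h1 : (0 : ℝ) < N i := lt_of_lt_of_le (by norm_num) (le_minScale.trans hN)
    have e : N i ^ (5 / 4 : ℝ) = N i * N i ^ (1 / 4 : ℝ) := by
      nth_rw 2 [← Real.rpow_one (N i)]
      rw [← Real.rpow_add h1]; norm_num
    have h2 : (4 : ℝ) ^ 30 ≤ N i ^ (1 / 4 : ℝ) := by
      have : ((4 : ℝ) ^ 120) ^ (1 / 4 : ℝ) = 4 ^ 30 := by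
        rw [← Real.rpow_natCast, ← Real.rpow_natCast, ← Real.rpow_mul (by norm_num)]; norm_num
      exact this.symm.le.trans
        (Real.rpow_le_rpow (by norm_num) (le_trans (by norm_num) (le_minScale.trans hN)) (by norm_num))
    rw [e, show 30 * (i + 1 + 1) = 30 * (i + 1) + 30 by ring, pow_add]
    gcongr

theorem den_ge_of_ne {α N N' : ℝ} {r r' : ℚ} (hN : 2 ^ 12 ≤ N) (h : GoodScale α N r)
    (h' : GoodScale α N' r') (hNN : N ^ (5 / 4 : ℝ) ≤ N') (hne : r' ≠ r) : N ≤ r'.den := by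
  have hN1 : 1 ≤ N := le_trans (by norm_num) hN
  have h1 := rat_sub_ge hne
  have hq : (0 : ℝ) < r.den := by exact_mod_cast r.den_pos
  have hq' : (0 : ℝ) < r'.den := by exact_mod_cast r'.den_pos
  have h2 : |(r' : ℝ) - r| ≤ |α - r| + |α - r'| := by
    have : (r' : ℝ) - r = (α - r) - (α - r') := by ring
    rw [this]; exact abs_sub _ _
  have h3 := h.dist_le
  have h4 := h'.dist_le
  set P := N ^ (7 / 6 : ℝ) with hP
  set P' := N' ^ (7 / 6 : ℝ) with hP'
  have hP0 : 0 < P := Real.rpow_pos_of_pos (by linarith) _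
  have hN'1 : N ≤ N' := by
    have : N ≤ N ^ (5 / 4 : ℝ) := by
      simpa using Real.rpow_le_rpow_of_exponent_le hN1 (show (1 : ℝ) ≤ 5 / 4 by norm_num)
    linarith
  have hP'0 : 0 < P' := Real.rpow_pos_of_pos (by linarith) _
  have hNP : 2 * P ≤ P' := by
    have e : (N ^ (5 / 4 : ℝ)) ^ (7 / 6 : ℝ) ≤ P' := Real.rpow_le_rpow (by positivity) hNN (by norm_num)
    rw [← Real.rpow_mul (by linarith)] at e
    have e2 : N ^ (5 / 4 * (7 / 6) : ℝ) = N ^ (7 / 24 : ℝ) * P := by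
      rw [hP, ← Real.rpow_add (by linarith)]; norm_num
    have e3 : (2 : ℝ) ≤ N ^ (7 / 24 : ℝ) := by
      have : ((2 : ℝ) ^ 12) ^ (1 / 12 : ℝ) = 2 := by
        rw [← Real.rpow_natCast, ← Real.rpow_mul (by norm_num)]; norm_num
      refine this.symm.le.trans ((Real.rpow_le_rpow (by norm_num) hN (by norm_num)).trans ?_)
      exact Real.rpow_le_rpow_of_exponent_le hN1 (by norm_num)
    rw [e2] at e
    exact (mul_le_mul_of_nonneg_right e3 hP0.le).trans e
  have h2N : 2 * N ≤ P := by
    have e2 : P = N ^ (1 / 6 : ℝ) * N := by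
      nth_rw 2 [← Real.rpow_one N]
      rw [hP, ← Real.rpow_add (by linarith)]; norm_num
    have e3 : (2 : ℝ) ≤ N ^ (1 / 6 : ℝ) := by
      have : ((2 : ℝ) ^ 12) ^ (1 / 12 : ℝ) = 2 := by
        rw [← Real.rpow_natCast, ← Real.rpow_mul (by norm_num)]; norm_num
      refine this.symm.le.trans ((Real.rpow_le_rpow (by norm_num) hN (by norm_num)).trans ?_)
      exact Real.rpow_le_rpow_of_exponent_le hN1 (by norm_num)
    rw [e2]; nlinarith
  have hqP : (r.den : ℝ) ≤ P := h.den_le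
  have h5 : 1 / ((r'.den : ℝ) * r.den) ≤ 1 / (P * r.den) + 1 / (P' * r'.den) := by linarith
  have h6 : 1 ≤ (r'.den : ℝ) / P + r.den / P' := by
    have := mul_le_mul_of_nonneg_right h5 (mul_pos hq' hq).le
    have e1 : 1 / ((r'.den : ℝ) * r.den) * (r'.den * r.den) = 1 := by field_simp
    have e2 : (1 / (P * r.den) + 1 / (P' * r'.den)) * (r'.den * r.den)
      = (r'.den : ℝ) / P + r.den / P' := by field_simp
    rwa [e1, e2] at this
  have h7 : (r.den : ℝ) / P' ≤ 1 / 2 := by rw [div_le_iff₀ hP'0]; linarith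
  have h8 : 1 / 2 ≤ (r'.den : ℝ) / P := by linarith
  rw [le_div_iff₀ hP0] at h8
  linarith

/-- The frequencies in `(1,2)` which are nonresonant at every scale. -/
def goodFreq (r : ℕ → ℚ) : Set ℝ :=
  {x ∈ Set.Ioo (1 : ℝ) 2 | ∀ i, resThreshold (r i).den ≤ |Real.sin ((r i).den * x)|}

theorem volume_goodFreq_pos {α : ℝ} {N : ℕ → ℝ} {r : ℕ → ℚ} (h0 : ∀ i, minScale ≤ N i)
    (h : ∀ i, N i ^ (5 / 4 : ℝ) ≤ N (i + 1)) (hg : ∀ i, GoodScale α (N i) (r i)) :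
    0 < volume (goodFreq r) := by
  set bad : ℚ → Set ℝ := fun s =>
    {x ∈ Set.Ioo (1 : ℝ) 2 | |Real.sin (s.den * x)| < resThreshold s.den} with hbad
  set new : ℕ → Set ℝ := fun i => {x | r (i + 1) ≠ r i ∧ x ∈ bad (r (i + 1))} with hnew
  have hcover : ∀ i, bad (r i) ⊆ bad (r 0) ∪ ⋃ j, new j := by
    intro i
    induction i with
    | zero => exact Set.subset_union_left
    | succ i ih =>
      by_cases hr : r (i + 1) = r i
      · rw [hr]; exact ih
      · exact fun x hx => Or.inr (Set.mem_iUnion.mpr ⟨i, hr, hx⟩)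
  have hth : ∀ q : ℝ, 0 < q → 0 ≤ resThreshold q := fun q hq => by
    unfold resThreshold; positivity
  have hb : ∀ s : ℚ, volume (bad s) ≤ ENNReal.ofReal (2 * π * resThreshold s.den) := fun s =>
    volume_sin_lt_le s.den_pos (hth _ (by exact_mod_cast s.den_pos))
  have hb0 : volume (bad (r 0)) ≤ ENNReal.ofReal (2 / 5) := by
    refine (hb _).trans (ENNReal.ofReal_le_ofReal ?_)
    have h1 : resThreshold (r 0).den ≤ 1 / 20 := by
      have : ((r 0).den : ℝ) ^ (-(1 / 30) : ℝ) ≤ 1 :=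
        Real.rpow_le_one_of_one_le_of_nonpos (by exact_mod_cast (r 0).den_pos) (by norm_num)
      unfold resThreshold; linarith
    have := Real.pi_lt_four
    have := Real.pi_pos
    nlinarith
  have hbn : ∀ i, volume (new i) ≤ ENNReal.ofReal (2 / 5 * (1 / 4) ^ (i + 1)) := by
    intro i
    by_cases hr : r (i + 1) = r i
    · have : new i = ∅ := by
        ext x; simp [hnew, hr]
      rw [this]; simp
    · have hsub : new i ⊆ bad (r (i + 1)) := fun x hx => hx.2
      refine (measure_mono hsub).trans ((hb _).trans (ENNReal.ofReal_le_ofReal ?_))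
      have h1 := den_ge_of_ne (le_trans (by norm_num) (le_minScale.trans (h0 i))) (hg i) (hg (i + 1)) (h i) hr
      have h2 := scale_growth h0 h i
      have h3 : ((r (i + 1)).den : ℝ) ^ (-(1 / 30) : ℝ) ≤ (1 / 4) ^ (i + 1) := by
        have e : ((4 : ℝ) ^ (30 * (i + 1))) ^ (-(1 / 30) : ℝ) = (1 / 4) ^ (i + 1) := by
          rw [← Real.rpow_natCast, ← Real.rpow_mul (by norm_num), one_div_pow,
            ← Real.rpow_natCast, one_div (_ ^ _), ← Real.rpow_neg (by norm_num)]
          congr 1; push_cast; ring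
        rw [← e]
        exact Real.rpow_le_rpow_of_nonpos (by positivity) (h2.trans h1) (by norm_num)
      have := Real.pi_lt_four
      have := Real.pi_pos
      have h4 : (0 : ℝ) < (1 / 4) ^ (i + 1) := by positivity
      unfold resThreshold
      nlinarith
  have hsum : volume (bad (r 0) ∪ ⋃ j, new j) ≤ ENNReal.ofReal (8 / 15) := by
    have hs : HasSum (fun i : ℕ => 2 / 5 * (1 / 4 : ℝ) ^ (i + 1)) (2 / 15) := by
      have := (hasSum_geometric_of_lt_one (r := (1 / 4 : ℝ)) (by norm_num) (by norm_num)).mul_left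
        (2 / 5 * (1 / 4))
      have e : (2 / 5 * (1 / 4) * (1 - 1 / 4)⁻¹ : ℝ) = 2 / 15 := by norm_num
      rw [e] at this
      have e2 : (fun i : ℕ => 2 / 5 * (1 / 4 : ℝ) ^ (i + 1)) =
          fun i => 2 / 5 * (1 / 4) * (1 / 4) ^ i := by
        funext i; rw [pow_succ]; ring
      rw [e2]; exact this
    calc _ ≤ volume (bad (r 0)) + ∑' j, volume (new j) :=
          (measure_union_le _ _).trans (by gcongr; exact measure_iUnion_le _)
      _ ≤ ENNReal.ofReal (2 / 5) + ∑' j : ℕ, ENNReal.ofReal (2 / 5 * (1 / 4) ^ (j + 1)) := by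
          gcongr; exact hbn _
      _ = ENNReal.ofReal (8 / 15) := by
          rw [← ENNReal.ofReal_tsum_of_nonneg (fun i => by positivity) hs.summable, hs.tsum_eq,
            ← ENNReal.ofReal_add (by norm_num) (by norm_num)]
          norm_num
  have hIoo : Set.Ioo (1 : ℝ) 2 ⊆ goodFreq r ∪ (bad (r 0) ∪ ⋃ j, new j) := by
    intro x hx
    by_cases hxg : x ∈ goodFreq r
    · exact Or.inl hxg
    · right
      have : ∃ i, ¬ resThreshold (r i).den ≤ |Real.sin ((r i).den * x)| := by
        by_contra! hcon
        exact hxg ⟨hx, hcon⟩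
      obtain ⟨i, hi⟩ := this
      exact hcover i ⟨hx, not_le.mp hi⟩
  by_contra hzero
  have hz : volume (goodFreq r) = 0 := by simpa using hzero
  have h1 := (measure_mono hIoo).trans (measure_union_le (μ := volume) _ _)
  rw [hz, zero_add, Real.volume_Ioo] at h1
  have h2 := h1.trans hsum
  rw [ENNReal.ofReal_le_ofReal_iff (by norm_num)] at h2
  norm_num at h2

theorem one_div_rpow_le_resThreshold {q N : ℝ} (hq : 1 ≤ q) (hN : minScale ≤ N)
    (h : q ≤ N ^ (7 / 6 : ℝ)) : N ^ (-(1 / 24) : ℝ) ≤ resThreshold q := by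
  have hN1 : 1 ≤ N := le_trans (by norm_num) (le_minScale.trans hN)
  have hN0 : 0 < N := by linarith
  have h1 : (N ^ (7 / 6 : ℝ)) ^ (-(1 / 30) : ℝ) ≤ q ^ (-(1 / 30) : ℝ) :=
    Real.rpow_le_rpow_of_nonpos (by linarith) h (by norm_num)
  rw [← Real.rpow_mul hN0.le] at h1
  have h2 : N ^ (7 / 6 * -(1 / 30) : ℝ) = N ^ (1 / 360 : ℝ) * N ^ (-(1 / 24) : ℝ) := by
    rw [← Real.rpow_add hN0]; norm_num
  have h3 : (20 : ℝ) ≤ N ^ (1 / 360 : ℝ) := by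
    have : minScale ^ (1 / 360 : ℝ) = 20 := by
      rw [minScale, ← Real.rpow_natCast, ← Real.rpow_mul (by norm_num)]; norm_num
    exact this.symm.le.trans (Real.rpow_le_rpow (by unfold minScale; positivity) hN (by norm_num))
  have h4 : 0 < N ^ (-(1 / 24) : ℝ) := by positivity
  rw [h2] at h1
  unfold resThreshold
  nlinarith

/-- Fourier coefficients of a `1`-periodic function on the line. -/
noncomputable def fc (f : ℝ → ℂ) (m : ℤ) : ℂ := ∫ x in (0 : ℝ)..1, unitExp (-(m * x)) * f x

/-- The open horizontal strip of half-width `h`. -/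
def strip (h : ℝ) : Set ℂ := {z | |z.im| < h}

theorem mem_strip {h : ℝ} {z : ℂ} : z ∈ strip h ↔ |z.im| < h := Iff.rfl

theorem isOpen_strip (h : ℝ) : IsOpen (strip h) :=
  isOpen_lt (continuous_abs.comp Complex.continuous_im) continuous_const

theorem strip_mono {h h' : ℝ} (hh : h ≤ h') : strip h ⊆ strip h' :=
  fun _ hz => lt_of_lt_of_le (mem_strip.mp hz) hh

theorem ofReal_mem_strip {h : ℝ} (hh : 0 < h) (x : ℝ) : (x : ℂ) ∈ strip h := by
  simpa [mem_strip] using hh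

theorem add_ofReal_mem_strip {h : ℝ} {z : ℂ} (hz : z ∈ strip h) (t : ℝ) : z + t ∈ strip h := by
  simpa [mem_strip] using hz

theorem conj_mem_strip {h : ℝ} {z : ℂ} (hz : z ∈ strip h) : (starRingEnd ℂ) z ∈ strip h := by
  simpa [mem_strip] using hz

theorem differentiable_unitExp : Differentiable ℂ unitExp := by
  unfold unitExp; fun_prop

theorem continuous_unitExp : Continuous unitExp := differentiable_unitExp.continuous

theorem norm_unitExp (z : ℂ) : ‖unitExp z‖ = Real.exp (-(2 * π * z.im)) := by
  rw [unitExp, Complex.norm_exp]; congr 1; simp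

theorem unitExp_neg (z : ℂ) : unitExp (-z) = (unitExp z)⁻¹ := by
  rw [unitExp, unitExp, ← Complex.exp_neg]; ring_nf

theorem hasSum_fc {f : ℝ → ℂ} (hf : Continuous f) (hp : Function.Periodic f 1)
    (hs : Summable (fc f)) (x : ℝ) : HasSum (fun m : ℤ => fc f m * unitExp (m * x)) (f x) := by
  have : Fact ((0 : ℝ) < 1) := ⟨one_pos⟩
  let F : C(AddCircle (1 : ℝ), ℂ) := ⟨hp.lift, continuous_coinduced_dom.mpr hf⟩
  have hF : ∀ y : ℝ, F (y : AddCircle (1 : ℝ)) = f y := fun y => rfl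
  have hco : ∀ m : ℤ, fourierCoeff F m = fc f m := by
    intro m
    rw [fourierCoeff_eq_intervalIntegral F m 0, fc]
    simp only [zero_add, div_one, one_smul]
    refine intervalIntegral.integral_congr fun y _ => ?_
    simp only [hF, smul_eq_mul, fourier_coe_apply, unitExp]
    congr 2
    push_cast
    ring
  have h := has_pointwise_sum_fourier_series_of_summable (f := F) (by
    rw [show fourierCoeff F = fc f from funext hco]; exact hs) (x : AddCircle (1 : ℝ))
  rw [hF] at h
  have e : (fun m : ℤ => fc f m * unitExp (m * x)) =
      fun m : ℤ => fourierCoeff F m • fourier m (x : AddCircle (1 : ℝ)) := by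
    funext m
    rw [hco, smul_eq_mul, fourier_coe_apply, unitExp]
    congr 2
    push_cast
    ring
  rw [e]; exact h

theorem unitExp_periodic (m : ℤ) (z : ℂ) : unitExp (m * (z + 1)) = unitExp (m * z) := by
  rw [mul_add, unitExp_add, mul_one, unitExp_int, mul_one]

theorem unitExp_neg_periodic (m : ℤ) (z : ℂ) : unitExp (-(m * (z + 1))) = unitExp (-(m * z)) := by
  rw [unitExp_neg, unitExp_periodic, ← unitExp_neg]

theorem fc_deriv {f f' : ℝ → ℂ} (hf : ∀ x, HasDerivAt f (f' x) x) (hf' : Continuous f')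
    (hp : Function.Periodic f 1) (m : ℤ) : fc f' m = 2 * π * Complex.I * m * fc f m := by
  have hu : ∀ x : ℝ, HasDerivAt (fun x : ℝ => unitExp (-(m * x)))
      (-(2 * π * Complex.I * m) * unitExp (-(m * x))) x := by
    intro x
    have h1 : HasDerivAt (fun x : ℝ => -((m : ℂ) * x)) (-((m : ℂ) * 1)) x :=
      (Complex.ofRealCLM.hasDerivAt (x := x)).const_mul (m : ℂ) |>.neg
    have h2 := (h1.const_mul (2 * π * Complex.I)).cexp
    unfold unitExp
    convert h2 using 1
    ring
  have hcu : Continuous fun x : ℝ => unitExp (-(m * x)) := by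
    have := continuous_unitExp; fun_prop
  have hcf : Continuous f := continuous_iff_continuousAt.mpr fun x => (hf x).continuousAt
  have h := intervalIntegral.integral_mul_deriv_eq_deriv_mul (a := 0) (b := 1) (fun x _ => hu x)
    (fun x _ => hf x) (Continuous.intervalIntegrable (by fun_prop) _ _)
    (hf'.intervalIntegrable _ _)
  have h01 : f 1 = f 0 := by simpa using hp 0
  have hu01 : unitExp (-(m * (1 : ℝ))) = unitExp (-(m * (0 : ℝ))) := by
    simpa using unitExp_neg_periodic m 0
  rw [h01, hu01, sub_self, zero_sub] at h
  rw [fc, fc, h, ← intervalIntegral.integral_neg, ← intervalIntegral.integral_const_mul]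
  refine intervalIntegral.integral_congr fun x _ => ?_
  ring

theorem norm_fc_le {f : ℝ → ℂ} {b : ℝ} (hb : ∀ x, ‖f x‖ ≤ b) (m : ℤ) : ‖fc f m‖ ≤ b := by
  have := intervalIntegral.norm_integral_le_of_norm_le_const (a := 0) (b := 1)
    (f := fun x : ℝ => unitExp (-(m * x)) * f x) (C := b) (fun x _ => by
      have h : ‖unitExp (-(m * x))‖ = 1 := by rw [norm_unitExp]; simp
      rw [norm_mul, h, one_mul]; exact hb x)
  simpa [fc] using this

theorem norm_fc_le_of_iteratedDeriv {f : ℝ → ℂ} (hf : ContDiff ℝ (⊤ : ℕ∞) f)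
    (hp : Function.Periodic f 1) {b : ℝ} (k : ℕ) (hb : ∀ x, ‖iteratedDeriv k f x‖ ≤ b) {m : ℤ}
    (hm : m ≠ 0) : ‖fc f m‖ ≤ b / |(m : ℝ)| ^ k := by
  have hper : ∀ k, Function.Periodic (iteratedDeriv k f) 1 := by
    intro k x
    have := congrFun (iteratedDeriv_comp_add_const k f (1 : ℝ)) x
    rw [← this]
    congr 1
    exact funext hp
  have key : ∀ k, fc (iteratedDeriv k f) m = (2 * π * Complex.I * m) ^ k * fc f m := by
    intro k
    induction k with
    | zero => simp
    | succ k ih =>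
      have hd : ∀ x, HasDerivAt (iteratedDeriv k f) (iteratedDeriv (k + 1) f x) x := by
        intro x
        rw [iteratedDeriv_succ]
        exact ((hf.differentiable_iteratedDeriv k (by exact_mod_cast WithTop.coe_lt_top k)) x).hasDerivAt
      rw [fc_deriv hd (hf.continuous_iteratedDeriv (k + 1) (by exact_mod_cast le_top)) (hper k) m, ih,
        pow_succ]
      ring
  have h1 := norm_fc_le hb m
  have hm0 : 0 < |(m : ℝ)| := abs_pos.mpr (by exact_mod_cast hm)
  rw [key k, norm_mul, norm_pow] at h1
  have e : ‖2 * π * Complex.I * m‖ = 2 * π * |(m : ℝ)| := by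
    simp [abs_of_pos Real.pi_pos]
  rw [e] at h1
  rw [le_div_iff₀ (by positivity), mul_comm]
  refine le_trans ?_ h1
  gcongr
  have := Real.pi_gt_three
  nlinarith

theorem integral_shift {f : ℂ → ℂ} {h y : ℝ} (hf : DifferentiableOn ℂ f (strip h))
    (hp : ∀ z, f (z + 1) = f z) (hy : |y| < h) :
    ∫ x in (0 : ℝ)..1, f (x + y * Complex.I) = ∫ x in (0 : ℝ)..1, f x := by
  have h1 := Complex.integral_boundary_rect_eq_zero_of_differentiableOn f 0 (1 + y * Complex.I) (by
    refine hf.mono fun z hz => ?_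
    have hz2 : z.im ∈ Set.uIcc 0 y := by simpa using hz.2
    have : |z.im| ≤ |y| := by
      rcases Set.mem_uIcc.mp hz2 with ⟨h1, h2⟩ | ⟨h1, h2⟩
      · rw [abs_of_nonneg h1, abs_of_nonneg (h1.trans h2)]; exact h2
      · rw [abs_of_nonpos h2, abs_of_nonpos (h1.trans h2)]; linarith
    exact lt_of_le_of_lt this hy)
  simp only [Complex.zero_re, Complex.zero_im, Complex.add_re, Complex.one_re, Complex.mul_re,
    Complex.ofReal_re, Complex.I_re, mul_zero, Complex.ofReal_im, Complex.I_im, mul_one, sub_self,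
    add_zero, Complex.add_im, Complex.one_im, Complex.mul_im, zero_add, Complex.ofReal_zero,
    zero_mul, Complex.ofReal_one] at h1
  have h2 : ∫ t in (0 : ℝ)..y, f (1 + t * Complex.I) = ∫ t in (0 : ℝ)..y, f (t * Complex.I) :=
    intervalIntegral.integral_congr fun t _ => by
      rw [add_comm, hp]
  rw [h2, add_sub_cancel_right] at h1
  exact (sub_eq_zero.mp h1).symm

theorem fc_shift {f : ℂ → ℂ} {h y : ℝ} (hf : DifferentiableOn ℂ f (strip h))
    (hp : ∀ z, f (z + 1) = f z) (hy : |y| < h) (m : ℤ) :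
    fc (fun x : ℝ => f (x + y * Complex.I)) m =
      fc (fun x : ℝ => f x) m * Real.exp (-(2 * π * m * y)) := by
  have h1 := integral_shift (f := fun z => unitExp (-(m * z)) * f z) (h := h) (y := y)
    ((differentiable_unitExp.comp (by fun_prop)).differentiableOn.mul hf)
    (fun z => by rw [hp, unitExp_neg_periodic]) hy
  rw [fc, fc, ← h1, ← intervalIntegral.integral_mul_const]
  refine intervalIntegral.integral_congr fun x _ => ?_
  have : unitExp (-(m * (x + y * Complex.I))) * Real.exp (-(2 * π * m * y)) = unitExp (-(m * x)) := by
    rw [unitExp, unitExp, Complex.ofReal_exp, ← Complex.exp_add]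
    congr 1
    push_cast
    ring_nf
    rw [Complex.I_sq]; ring
  rw [← this]; ring

theorem norm_fc_le_exp {f : ℂ → ℂ} {h y b : ℝ} (hf : DifferentiableOn ℂ f (strip h))
    (hp : ∀ z, f (z + 1) = f z) (hy : 0 ≤ y) (hyh : y < h) (hb : ∀ z ∈ strip h, ‖f z‖ ≤ b) (m : ℤ) :
    ‖fc (fun x : ℝ => f x) m‖ ≤ b * Real.exp (-(2 * π * |(m : ℝ)| * y)) := by
  have key : ∀ s : ℝ, |s| = y → ‖fc (fun x : ℝ => f x) m‖ * Real.exp (-(2 * π * m * s)) ≤ b := by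
    intro s hs
    have h1 := fc_shift hf hp (y := s) (by rw [hs]; exact hyh) m
    have h2 := norm_fc_le (f := fun x : ℝ => f (x + s * Complex.I)) (b := b)
      (fun x => hb _ (by simp [mem_strip, hs, hyh])) m
    rw [h1, norm_mul, Complex.norm_real, Real.norm_of_nonneg (Real.exp_pos _).le] at h2
    exact h2
  have h3 : ‖fc (fun x : ℝ => f x) m‖ * Real.exp (2 * π * |(m : ℝ)| * y) ≤ b := by
    rcases le_total 0 (m : ℝ) with hm | hm
    · have := key (-y) (by rw [abs_neg, abs_of_nonneg hy])
      rw [abs_of_nonneg hm]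
      convert this using 3; ring
    · have := key y (abs_of_nonneg hy)
      rw [abs_of_nonpos hm]
      convert this using 3; ring
  rw [Real.exp_neg, ← div_eq_mul_inv, le_div_iff₀ (Real.exp_pos _)]
  exact h3

theorem hasSum_fc_strip {f : ℂ → ℂ} {h : ℝ} (hf : DifferentiableOn ℂ f (strip h))
    (hp : ∀ z, f (z + 1) = f z) {z : ℂ} (hz : z ∈ strip h)
    (hs : Summable fun m : ℤ => ‖fc (fun x : ℝ => f x) m‖ * Real.exp (2 * π * |(m : ℝ)| * |z.im|)) :
    HasSum (fun m : ℤ => fc (fun x : ℝ => f x) m * unitExp (m * z)) (f z) := by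
  have hc : Continuous fun x : ℝ => f (x + z.im * Complex.I) := by
    refine continuous_iff_continuousAt.mpr fun x => ?_
    have hx : (x + z.im * Complex.I : ℂ) ∈ strip h := by simpa [mem_strip] using hz
    exact ContinuousAt.comp (f := fun x : ℝ => (x + z.im * Complex.I : ℂ))
      ((hf.differentiableAt ((isOpen_strip h).mem_nhds hx)).continuousAt)
      (by fun_prop)
  have hfs : ∀ m, fc (fun x : ℝ => f (x + z.im * Complex.I)) m = _ :=
    fun m => fc_shift hf hp (mem_strip.mp hz) m
  have h1 := hasSum_fc hc (fun x => by
      simp only; rw [← hp (x + z.im * Complex.I)]; push_cast; ring_nf) (by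
      refine Summable.of_norm_bounded hs fun m => ?_
      rw [hfs, norm_mul, Complex.norm_real, Real.norm_of_nonneg (Real.exp_pos _).le]
      gcongr
      have : -((m : ℝ) * z.im) ≤ |(m : ℝ)| * |z.im| := by
        rw [← abs_mul]; exact neg_le_abs _
      have := Real.pi_pos
      nlinarith) z.re
  rw [Complex.re_add_im] at h1
  have e : (fun m : ℤ => fc (fun x : ℝ => f x) m * unitExp (m * z)) =
      fun m : ℤ => fc (fun x : ℝ => f (x + z.im * Complex.I)) m * unitExp (m * z.re) := by
    funext m
    rw [hfs, mul_assoc]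
    congr 1
    rw [unitExp, unitExp, Complex.ofReal_exp, ← Complex.exp_add]
    congr 1
    nth_rw 1 [← Complex.re_add_im z]
    push_cast
    ring_nf
    rw [Complex.I_sq]; ring
  rw [e]; exact h1

theorem hasSum_int_inv_sq : HasSum (fun m : ℤ => 1 / |(m : ℝ)| ^ 2) (π ^ 2 / 6 + π ^ 2 / 6) := by
  have h1 : HasSum (fun n : ℕ => 1 / |((n : ℤ) : ℝ)| ^ 2) (π ^ 2 / 6) := by
    simpa using hasSum_zeta_two
  have h2 : HasSum (fun n : ℕ => 1 / |((-(n : ℤ) : ℤ) : ℝ)| ^ 2) (π ^ 2 / 6) := by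
    simpa using hasSum_zeta_two
  simpa using HasSum.of_nat_of_neg (f := fun m : ℤ => 1 / |(m : ℝ)| ^ 2) h1 h2

theorem tsum_int_inv_sq_le : ∑' m : ℤ, 1 / |(m : ℝ)| ^ 2 ≤ 4 := by
  rw [hasSum_int_inv_sq.tsum_eq]
  have := Real.pi_lt_d2
  have := Real.pi_pos
  nlinarith

theorem norm_le_of_hasSum_inv_sq {c : ℤ → ℂ} {s : ℂ} {b : ℝ} (hb : 0 ≤ b) (hs : HasSum c s)
    (h : ∀ m, ‖c m‖ ≤ b * (1 / |(m : ℝ)| ^ 2)) : ‖s‖ ≤ 4 * b := by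
  rw [← hs.tsum_eq]
  refine (tsum_of_norm_bounded ((hasSum_int_inv_sq).mul_left b) h).trans ?_
  have := tsum_int_inv_sq_le
  rw [hasSum_int_inv_sq.tsum_eq] at this
  nlinarith

/-- Fourier coefficients decaying like `a m⁻⁴ e^{-2π|m|h}`. -/
def FourierDecay (f : ℂ → ℂ) (h a : ℝ) : Prop :=
  ∀ m : ℤ, m ≠ 0 → ‖fc (fun x : ℝ => f x) m‖ * Real.exp (2 * π * |(m : ℝ)| * h) ≤ a / |(m : ℝ)| ^ 4

theorem FourierDecay.mono {f : ℂ → ℂ} {h h' a a' : ℝ} (hf : FourierDecay f h a) (hh : h' ≤ h)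
    (ha : a ≤ a') : FourierDecay f h' a' := by
  intro m hm
  have h1 := hf m hm
  have hm0 : 0 < |(m : ℝ)| := abs_pos.mpr (by exact_mod_cast hm)
  calc _ ≤ ‖fc (fun x : ℝ => f x) m‖ * Real.exp (2 * π * |(m : ℝ)| * h) := by gcongr
    _ ≤ _ := h1
    _ ≤ _ := by gcongr

theorem FourierDecay.nonneg {f : ℂ → ℂ} {h a : ℝ} (hf : FourierDecay f h a) : 0 ≤ a := by
  have h1 := hf 1 one_ne_zero
  simp only [Int.cast_one, abs_one, one_pow, div_one] at h1
  exact le_trans (by positivity) h1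

theorem FourierDecay.hasSum {f : ℂ → ℂ} {h a : ℝ} (hf : FourierDecay f h a)
    (hd : DifferentiableOn ℂ f (strip h)) (hp : ∀ z, f (z + 1) = f z) {z : ℂ} (hz : z ∈ strip h) :
    HasSum (fun m : ℤ => fc (fun x : ℝ => f x) m * unitExp (m * z)) (f z) := by
  refine hasSum_fc_strip hd hp hz ?_
  have ha := hf.nonneg
  have h0 : Summable fun m : ℤ => if m = 0 then ‖fc (fun x : ℝ => f x) 0‖ else 0 :=
    summable_of_ne_finset_zero (s := {0}) (fun m hm => by simp at hm; simp [hm])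
  refine Summable.of_nonneg_of_le (fun m => by positivity) (fun m => ?_)
    (h0.add (hasSum_int_inv_sq.summable.mul_left a))
  by_cases hm : m = 0
  · subst hm; simp
  · have hm1 : 1 ≤ |(m : ℝ)| := by exact_mod_cast Int.one_le_abs hm
    simp only [hm, if_false, zero_add]
    calc _ ≤ ‖fc (fun x : ℝ => f x) m‖ * Real.exp (2 * π * |(m : ℝ)| * h) := by
          have := (mem_strip.mp hz).le
          gcongr
      _ ≤ a / |(m : ℝ)| ^ 4 := hf m hm
      _ ≤ a * (1 / |(m : ℝ)| ^ 2) := by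
          rw [div_eq_mul_one_div]
          gcongr
          norm_num

/-- The Weyl sums of the rotation by `r`. -/
noncomputable def weylSum (r : ℚ) (j : ℕ) (m : ℤ) : ℂ :=
  ∑ t ∈ range j, unitExp ((t : ℂ) * ((m * r : ℝ) : ℂ))

theorem weylSum_den_eq_zero (r : ℚ) {m : ℤ} (hm : ¬ (r.den : ℤ) ∣ m) : weylSum r r.den m = 0 := by
  set w := unitExp ((m * r : ℝ) : ℂ) with hw
  have h1 : weylSum r r.den m = ∑ t ∈ range r.den, w ^ t := by
    refine Finset.sum_congr rfl fun t _ => ?_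
    rw [unitExp_nat_mul]
  have hr : (r.den : ℝ) * r = r.num := by
    have := r.den_mul_eq_num
    exact_mod_cast this
  have hwq : w ^ r.den = 1 := by
    rw [hw, ← unitExp_nat_mul]
    have : ((r.den : ℂ) * ((m * r : ℝ) : ℂ)) = ((m * r.num : ℤ) : ℂ) := by
      have : ((r.den : ℝ) * (m * r)) = ((m * r.num : ℤ) : ℝ) := by
        push_cast; rw [← hr]; ring
      exact_mod_cast congrArg (Complex.ofReal) this
    rw [this, unitExp_int]
  have hw1 : w ≠ 1 := by
    intro h
    rw [hw, unitExp, Complex.exp_eq_one_iff] at h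
    obtain ⟨n, hn⟩ := h
    have hn2 : ((m * r : ℝ) : ℂ) = n := by
      have h2 : (2 * π * Complex.I : ℂ) ≠ 0 := Complex.two_pi_I_ne_zero
      apply mul_left_cancel₀ h2
      rw [hn]; ring
    have hn3 : (m : ℝ) * r = n := by exact_mod_cast hn2
    have hn4 : m * r.num = n * r.den := by
      have : (m : ℝ) * r.num = n * r.den := by rw [← hr, ← hn3]; ring
      exact_mod_cast this
    have hdvd : (r.den : ℤ) ∣ m * r.num := ⟨n, by rw [hn4]; ring⟩
    have hcop : IsCoprime (r.den : ℤ) r.num := by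
      rw [Int.isCoprime_iff_nat_coprime]
      simpa using r.reduced.symm
    exact hm (hcop.dvd_of_dvd_mul_right hdvd)
  have h2 := mul_neg_geom_sum w r.den
  rw [hwq, sub_self] at h2
  rw [h1]
  exact (mul_eq_zero.mp h2).resolve_left (sub_ne_zero.mpr hw1.symm)

theorem hasSum_birkhoff {f : ℂ → ℂ} {h a : ℝ} (hf : FourierDecay f h a)
    (hd : DifferentiableOn ℂ f (strip h)) (hp : ∀ z, f (z + 1) = f z) {z : ℂ} (hz : z ∈ strip h)
    (r : ℚ) (j : ℕ) :
    HasSum (fun m : ℤ => fc (fun x : ℝ => f x) m * unitExp (m * z) * weylSum r j m)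
      (∑ t ∈ range j, f (z + (t * r : ℝ))) := by
  have h1 := hasSum_sum (s := range j) (fun t _ =>
    hf.hasSum hd hp (add_ofReal_mem_strip hz (t * r : ℝ)))
  convert h1 using 2 with m
  rw [weylSum, Finset.mul_sum]
  refine Finset.sum_congr rfl fun t _ => ?_
  rw [mul_add, unitExp_add, mul_assoc]
  congr 3
  push_cast; ring

theorem norm_birkhoff_sub_real_le {f : ℂ → ℂ} {N a α : ℝ} {r : ℚ} (hN : 0 < N)
    (hg : GoodScale α N r) (hf : FourierDecay f (1 / N) a)
    (hd : DifferentiableOn ℂ f (strip (1 / N))) (hp : ∀ z, f (z + 1) = f z) {z : ℂ}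
    (hz : z ∈ strip (1 / N)) {j : ℕ} (hj : j ≤ r.den) :
    ‖∑ t ∈ range j, f (z + (t * r : ℝ)) - ∑ t ∈ range j, f (z.re + (t * r : ℝ))‖ ≤ 26 * a := by
  have h1 := hasSum_birkhoff hf hd hp hz r j
  have h2 := hasSum_birkhoff hf hd hp (ofReal_mem_strip (by positivity : 0 < 1 / N) z.re) r j
  have ha := hf.nonneg
  have h3 := norm_le_of_hasSum_inv_sq (b := 2 * π * a) (by positivity) (h1.sub h2) (fun m => by
    by_cases hm : m = 0
    · subst hm; simp
    have hm0 : 0 < |(m : ℝ)| := abs_pos.mpr (by exact_mod_cast hm)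
    have hW := hg.weyl m hm j hj
    have hD := hf m hm
    have hy := (mem_strip.mp hz).le
    have he : ‖unitExp (m * z) - unitExp (m * z.re)‖ ≤
        2 * π * |(m : ℝ)| * (1 / N) * Real.exp (2 * π * |(m : ℝ)| * (1 / N)) := by
      have e1 : unitExp (m * z) = unitExp (m * z.re) * unitExp (m * (z.im * Complex.I)) := by
        rw [← unitExp_add, ← mul_add, Complex.re_add_im]
      have e2 : unitExp (m * (z.im * Complex.I)) = ((Real.exp (-(2 * π * m * z.im)) : ℝ) : ℂ) := by
        rw [unitExp, Complex.ofReal_exp]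
        congr 1
        push_cast
        ring_nf
        rw [Complex.I_sq]; ring
      have e3 : ‖unitExp (m * z.re)‖ = 1 := by rw [norm_unitExp]; simp
      rw [e1, ← mul_sub_one, norm_mul, e3, one_mul, e2, ← Complex.ofReal_one, ← Complex.ofReal_sub,
        Complex.norm_real, Real.norm_eq_abs]
      set u := -(2 * π * m * z.im) with hu
      have hu2 : |u| ≤ 2 * π * |(m : ℝ)| * (1 / N) := by
        rw [hu, abs_neg, abs_mul, abs_mul, abs_of_pos Real.two_pi_pos]
        gcongr
      have e4 : |Real.exp u - 1| ≤ |u| * Real.exp |u| := by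
        have h1 := Real.add_one_le_exp u
        have h2 := Real.add_one_le_exp (-u)
        rcases le_total 0 u with h | h
        · rw [abs_of_nonneg h, abs_of_nonneg (by linarith)]
          rw [Real.exp_neg] at h2
          have h3 := Real.exp_pos u
          have h4 : (Real.exp u)⁻¹ * Real.exp u = 1 := inv_mul_cancel₀ h3.ne'
          nlinarith
        · rw [abs_of_nonpos h, abs_of_nonpos (by simpa using h)]
          have h3 : 1 ≤ Real.exp (-u) := Real.one_le_exp (by linarith)
          nlinarith
      refine e4.trans ?_
      gcongr
    rw [← sub_mul, ← mul_sub, norm_mul, norm_mul]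
    calc ‖fc (fun x : ℝ => f x) m‖ * ‖unitExp (m * z) - unitExp (m * z.re)‖ * ‖weylSum r j m‖
        ≤ ‖fc (fun x : ℝ => f x) m‖ * (2 * π * |(m : ℝ)| * (1 / N) *
            Real.exp (2 * π * |(m : ℝ)| * (1 / N))) * (N * |(m : ℝ)|) := by
          gcongr; exact hW
      _ = (‖fc (fun x : ℝ => f x) m‖ * Real.exp (2 * π * |(m : ℝ)| * (1 / N))) *
            (2 * π * |(m : ℝ)| ^ 2) := by field_simp
      _ ≤ a / |(m : ℝ)| ^ 4 * (2 * π * |(m : ℝ)| ^ 2) := by gcongr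
      _ = 2 * π * a * (1 / |(m : ℝ)| ^ 2) := by field_simp)
  have := Real.pi_lt_d2
  nlinarith

theorem norm_birkhoff_den_sub_le {f : ℂ → ℂ} {h a : ℝ} (r : ℚ)
    (hf : FourierDecay f h a) (hd : DifferentiableOn ℂ f (strip h)) (hp : ∀ z, f (z + 1) = f z)
    {z : ℂ} (hz : z ∈ strip h) :
    ‖∑ t ∈ range r.den, f (z + (t * r : ℝ)) - r.den * fc (fun x : ℝ => f x) 0‖ ≤ 4 * (a / r.den) := by
  have h1 := hasSum_birkhoff hf hd hp hz r r.den
  have ha := hf.nonneg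
  have hq : (0 : ℝ) < r.den := by exact_mod_cast r.den_pos
  have h0 : HasSum (fun m : ℤ => if m = 0 then r.den * fc (fun x : ℝ => f x) 0 else 0)
      (r.den * fc (fun x : ℝ => f x) 0) := hasSum_ite_eq 0 _
  refine norm_le_of_hasSum_inv_sq (b := a / r.den) (by positivity) (h1.sub h0) (fun m => ?_)
  by_cases hm : m = 0
  · subst hm
    simp [weylSum, unitExp, mul_comm]
  simp only [hm, if_false, sub_zero]
  by_cases hdvd : (r.den : ℤ) ∣ m
  swap
  · rw [weylSum_den_eq_zero r hdvd, mul_zero, norm_zero]; positivity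
  have hm0 : 0 < |(m : ℝ)| := abs_pos.mpr (by exact_mod_cast hm)
  have hqm : (r.den : ℝ) ≤ |(m : ℝ)| := by
    have := Int.le_of_dvd (abs_pos.mpr hm) ((dvd_abs _ _).mpr hdvd)
    exact_mod_cast this
  have hD := hf m hm
  have hW := norm_sum_unitExp_le_card (m * r) r.den
  have he : ‖unitExp (m * z)‖ ≤ Real.exp (2 * π * |(m : ℝ)| * h) := by
    rw [norm_unitExp]
    apply Real.exp_le_exp.mpr
    have h2 : (m * z : ℂ).im = m * z.im := by simp
    have h3 : -((m : ℝ) * z.im) ≤ |(m : ℝ)| * |z.im| := by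
      rw [← abs_mul]; exact neg_le_abs _
    have h4 : |(m : ℝ)| * |z.im| ≤ |(m : ℝ)| * h := by
      have := (mem_strip.mp hz).le
      gcongr
    rw [h2]
    have := Real.pi_pos
    nlinarith
  rw [norm_mul, norm_mul]
  calc ‖fc (fun x : ℝ => f x) m‖ * ‖unitExp (m * z)‖ * ‖weylSum r r.den m‖
      ≤ ‖fc (fun x : ℝ => f x) m‖ * Real.exp (2 * π * |(m : ℝ)| * h) * r.den := by
        gcongr; exact hW
    _ ≤ a / |(m : ℝ)| ^ 4 * r.den := by gcongr
    _ = a * (r.den / |(m : ℝ)| ^ 2) * (1 / |(m : ℝ)| ^ 2) := by field_simp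
    _ ≤ a * (1 / r.den) * (1 / |(m : ℝ)| ^ 2) := by
        have : (r.den : ℝ) / |(m : ℝ)| ^ 2 ≤ 1 / r.den := by
          rw [div_le_div_iff₀ (by positivity) hq]
          nlinarith
        gcongr
    _ = _ := by ring

theorem fourierDecay_of_norm_le {f : ℂ → ℂ} {h b : ℝ} (hh : 0 < h)
    (hd : DifferentiableOn ℂ f (strip h)) (hp : ∀ z, f (z + 1) = f z)
    (hb : ∀ z ∈ strip h, ‖f z‖ ≤ b) : FourierDecay f (h / 4) (5 * b / h ^ 4) := by
  intro m hm
  have hm0 : 0 < |(m : ℝ)| := abs_pos.mpr (by exact_mod_cast hm)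
  have h1 := norm_fc_le_exp hd hp (y := h / 2) (by linarith) (by linarith) hb m
  have hb0 : 0 ≤ b := (norm_nonneg _).trans (hb 0 (by simpa [mem_strip] using hh))
  set x := 2 * π * |(m : ℝ)| * (h / 4) with hx
  have hx0 : 0 < x := by positivity
  have e1 : -(2 * π * |(m : ℝ)| * (h / 2)) = -(x + x) := by rw [hx]; ring
  rw [e1] at h1
  have h2 : x ^ 4 / 24 ≤ Real.exp x := by
    have := Real.pow_div_factorial_le_exp x hx0.le 4
    norm_num [Nat.factorial] at this
    exact this
  have h3 : |(m : ℝ)| ^ 4 * h ^ 4 ≤ 5 * Real.exp x := by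
    have e2 : x ^ 4 = (π / 2) ^ 4 * (|(m : ℝ)| ^ 4 * h ^ 4) := by rw [hx]; ring
    have e3 : (24 / 5 : ℝ) ≤ (π / 2) ^ 4 := by
      have : (3 / 2 : ℝ) ≤ π / 2 := by linarith [Real.pi_gt_three]
      calc (24 / 5 : ℝ) ≤ (3 / 2) ^ 4 := by norm_num
        _ ≤ _ := by gcongr
    have e4 : 0 ≤ |(m : ℝ)| ^ 4 * h ^ 4 := by positivity
    nlinarith
  calc _ ≤ b * Real.exp (-(x + x)) * Real.exp x := by gcongr
    _ = b * Real.exp (-x) := by rw [mul_assoc, ← Real.exp_add]; ring_nf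
    _ ≤ 5 * b / h ^ 4 / |(m : ℝ)| ^ 4 := by
        rw [Real.exp_neg, ← div_eq_mul_inv, div_div, div_le_div_iff₀ (Real.exp_pos _) (by positivity)]
        nlinarith

theorem continuous_restrict_strip {f : ℂ → ℂ} {h : ℝ} (hh : 0 < h)
    (hd : DifferentiableOn ℂ f (strip h)) : Continuous fun x : ℝ => f x :=
  continuous_iff_continuousAt.mpr fun x => ContinuousAt.comp (f := fun x : ℝ => (x : ℂ))
    ((hd.differentiableAt ((isOpen_strip h).mem_nhds (ofReal_mem_strip hh x))).continuousAt)
    (by fun_prop)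

theorem fc_add {f g : ℝ → ℂ} (hf : Continuous f) (hg : Continuous g) (m : ℤ) :
    fc (fun x => f x + g x) m = fc f m + fc g m := by
  have hcu : Continuous fun x : ℝ => unitExp (-(m * x)) := by
    have := continuous_unitExp; fun_prop
  have h1 : Continuous fun x : ℝ => unitExp (-(m * x)) * f x := hcu.mul hf
  have h2 : Continuous fun x : ℝ => unitExp (-(m * x)) * g x := hcu.mul hg
  rw [fc, fc, fc, ← intervalIntegral.integral_add (h1.intervalIntegrable _ _)
    (h2.intervalIntegrable _ _)]
  simp only [mul_add]

theorem FourierDecay.add {f g : ℂ → ℂ} {h h' a b : ℝ} (hh : 0 < h')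
    (hf : FourierDecay f h a) (hg : FourierDecay g h b)
    (hfd : DifferentiableOn ℂ f (strip h')) (hgd : DifferentiableOn ℂ g (strip h')) :
    FourierDecay (fun z => f z + g z) h (a + b) := by
  intro m hm
  have h1 := hf m hm
  have h2 := hg m hm
  rw [fc_add (continuous_restrict_strip hh hfd) (continuous_restrict_strip hh hgd), add_div]
  have := norm_add_le (fc (fun x : ℝ => f x) m) (fc (fun x : ℝ => g x) m)
  have := Real.exp_pos (2 * π * |(m : ℝ)| * h)
  nlinarith

/-- Birkhoff sums along the rotation by `r`. -/
noncomputable def ssum (θ : ℂ → ℂ) (r : ℚ) (j : ℕ) (z : ℂ) : ℂ :=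
  ∑ t ∈ range j, θ (z + (t * r : ℝ))

/-- The multiplicative cocycle generated by `e^{-2iθ}` over the rotation by `r`. -/
noncomputable def phaseProd (θ : ℂ → ℂ) (r : ℚ) (j : ℕ) (z : ℂ) : ℂ :=
  Complex.exp (-2 * Complex.I * ssum θ r j z)

theorem periodic_int {f : ℂ → ℂ} (hp : ∀ z, f (z + 1) = f z) (n : ℤ) (z : ℂ) :
    f (z + n) = f z := by
  have h : Function.Periodic f 1 := hp
  have := h.int_mul n z
  simpa using this

theorem ssum_periodic {θ : ℂ → ℂ} (hp : ∀ z, θ (z + 1) = θ z) (r : ℚ) (j : ℕ) (z : ℂ) :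
    ssum θ r j (z + 1) = ssum θ r j z :=
  Finset.sum_congr rfl fun t _ => by rw [add_right_comm, hp]

theorem den_mul_cast (r : ℚ) : (((r.den : ℕ) : ℝ) * (r : ℝ)) = (r.num : ℝ) := by
  exact_mod_cast r.den_mul_eq_num

theorem ssum_succ_eq (θ : ℂ → ℂ) (r : ℚ) (j : ℕ) (z : ℂ) :
    ssum θ r (j + 1) z = θ z + ssum θ r j (z + (r : ℝ)) := by
  rw [ssum, Finset.sum_range_succ', ssum, add_comm]
  congr 1
  · simp
  · refine Finset.sum_congr rfl fun t _ => ?_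
    congr 1; push_cast; ring

theorem ssum_den_add {θ : ℂ → ℂ} (hp : ∀ z, θ (z + 1) = θ z) (r : ℚ) (z : ℂ) :
    ssum θ r r.den (z + (r : ℝ)) = ssum θ r r.den z := by
  have h1 := ssum_succ_eq θ r r.den z
  have h2 : ssum θ r (r.den + 1) z = ssum θ r r.den z + θ z := by
    rw [ssum, Finset.sum_range_succ, ssum, den_mul_cast]
    congr 1
    have := periodic_int hp r.num z
    rw [← this]; norm_num
  rw [h2, add_comm] at h1
  exact (add_left_cancel h1).symm

theorem exists_solution_rational {θ : ℂ → ℂ} {h d : ℝ} {r : ℚ} (hd0 : 0 < d)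
    (hp : ∀ z, θ (z + 1) = θ z) (hθ : DifferentiableOn ℂ θ (strip h))
    (him : ∀ z ∈ strip h, ∀ j ≤ r.den, |(ssum θ r j z).im| ≤ 1 / 2)
    (hres : ∀ z ∈ strip h, d ≤ ‖1 - phaseProd θ r r.den z‖) {h' G : ℝ} (hh : h' ≤ h) {g : ℂ → ℂ}
    (hg : DifferentiableOn ℂ g (strip h')) (hgp : ∀ z, g (z + 1) = g z)
    (hG : ∀ z ∈ strip h', ‖g z‖ ≤ G) :
    ∃ κ : ℂ → ℂ, DifferentiableOn ℂ κ (strip h') ∧ (∀ z, κ (z + 1) = κ z) ∧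
      (∀ z ∈ strip h', ‖κ z‖ ≤ 8 * r.den / d * G) ∧
      ∀ z ∈ strip h', κ (z + (r : ℝ)) = Complex.exp (-2 * Complex.I * θ z) * κ z + g z := by
  set q := r.den with hq
  set P := phaseProd θ r with hP
  set κ : ℂ → ℂ := fun z => (1 - P q z)⁻¹ * ∑ j ∈ range q, P q z * (P (j + 1) z)⁻¹ * g (z + (j * r : ℝ))
    with hκ
  have hPper : ∀ j z, P j (z + 1) = P j z := fun j z => by
    simp only [hP, phaseProd, ssum_periodic hp]
  have hPne : ∀ j z, P j z ≠ 0 := fun j z => Complex.exp_ne_zero _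
  have hne : ∀ z ∈ strip h, 1 - P q z ≠ 0 := fun z hz h0 => by
    have := hres z hz
    rw [h0, norm_zero] at this; linarith
  have hPd : ∀ j, DifferentiableOn ℂ (P j) (strip h) := by
    intro j
    have : DifferentiableOn ℂ (ssum θ r j) (strip h) := by
      unfold ssum
      refine DifferentiableOn.fun_sum fun t _ => ?_
      exact hθ.comp (by fun_prop) fun z hz => add_ofReal_mem_strip hz _
    simp only [hP]
    unfold phaseProd
    exact (this.const_mul _).cexp
  have hsub := strip_mono hh
  have hPs : ∀ j z, P (j + 1) z = Complex.exp (-2 * Complex.I * θ z) * P j (z + (r : ℝ)) := by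
    intro j z
    simp only [hP, phaseProd]
    rw [ssum_succ_eq, ← Complex.exp_add]; ring_nf
  have hPq : ∀ z, P q (z + (r : ℝ)) = P q z := fun z => by
    simp only [hP, phaseProd]; rw [ssum_den_add hp]
  refine ⟨κ, ?_, ?_, ?_, ?_⟩
  · refine DifferentiableOn.mul ?_ ?_
    · exact ((differentiableOn_const 1).sub ((hPd q).mono hsub)).inv fun z hz => hne z (hsub hz)
    · refine DifferentiableOn.fun_sum fun j _ => ?_
      refine (((hPd q).mono hsub).mul (((hPd (j + 1)).mono hsub).inv fun z _ => hPne _ _)).mul ?_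
      exact hg.comp (by fun_prop) fun z hz => add_ofReal_mem_strip hz _
  · intro z
    simp only [hκ, hPper]
    congr 1
    refine Finset.sum_congr rfl fun j _ => ?_
    rw [add_right_comm, hgp]
  · intro z hz
    have hzz := hsub hz
    have hG0 : 0 ≤ G := (norm_nonneg _).trans (hG z hz)
    have hb : ∀ j ∈ range q, ‖P q z * (P (j + 1) z)⁻¹ * g (z + (j * r : ℝ))‖ ≤ 8 * G := by
      intro j hj
      have hj1 : j + 1 ≤ q := by simpa using hj
      have e1 : ‖P q z * (P (j + 1) z)⁻¹‖ ≤ 8 := by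
        simp only [hP, phaseProd]
        rw [← Complex.exp_neg, ← Complex.exp_add, Complex.norm_exp]
        have h1 := abs_le.mp (him z hzz q le_rfl)
        have h2 := abs_le.mp (him z hzz (j + 1) hj1)
        have h3 : (-2 * Complex.I * ssum θ r q z + -(-2 * Complex.I * ssum θ r (j + 1) z)).re ≤ 2 := by
          simp
          linarith
        have h4 : Real.exp 2 ≤ 8 := by
          have h5 := Real.exp_one_lt_d9
          have h6 := Real.exp_pos 1
          have : Real.exp 2 = Real.exp 1 * Real.exp 1 := by rw [← Real.exp_add]; norm_num
          rw [this]; nlinarith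
        exact (Real.exp_le_exp.mpr h3).trans h4
      rw [norm_mul]
      exact mul_le_mul e1 (hG _ (add_ofReal_mem_strip hz _)) (norm_nonneg _) (by norm_num)
    have hs := norm_sum_le_of_le _ hb
    rw [Finset.sum_const, Finset.card_range, nsmul_eq_mul] at hs
    simp only [hκ]
    rw [norm_mul, norm_inv]
    have := hres z hzz
    calc _ ≤ d⁻¹ * (q * (8 * G)) := by gcongr
      _ = _ := by field_simp
  · intro z hz
    have hzz := hsub hz
    have h1 := hne z hzz
    set l := Complex.exp (-2 * Complex.I * θ z) with hl
    have hl0 : l ≠ 0 := Complex.exp_ne_zero _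
    set F : ℕ → ℂ := fun j => P q z * l * (P (j + 1) z)⁻¹ * g (z + (j * r : ℝ)) with hF
    have hsum1 : κ (z + (r : ℝ)) = (1 - P q z)⁻¹ * ∑ j ∈ range q, F (j + 1) := by
      simp only [hκ, hPq, hF]
      congr 1
      refine Finset.sum_congr rfl fun j _ => ?_
      rw [hPs (j + 1) z]
      have e : z + (r : ℝ) + (j * r : ℝ) = z + ((j + 1 : ℕ) * r : ℝ) := by push_cast; ring
      rw [← e, ← hl, mul_inv]
      push_cast
      field_simp
    have hsum2 : l * κ z = (1 - P q z)⁻¹ * ∑ j ∈ range q, F j := by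
      simp only [hκ, hF]
      rw [mul_left_comm, Finset.mul_sum]
      congr 1
      refine Finset.sum_congr rfl fun j _ => by ring
    have hF0 : F 0 = P q z * g z := by
      simp only [hF, hPs 0 z, ← hl]
      have : P 0 (z + (r : ℝ)) = 1 := by simp [hP, phaseProd, ssum]
      rw [this]; field_simp; simp
    have hFq : F q = g z := by
      simp only [hF, hPs q z, ← hl, hPq]
      have e1 : g (z + (q * r : ℝ)) = g z := by
        rw [hq, den_mul_cast]
        have := periodic_int hgp r.num z
        rw [← this]; norm_num
      rw [e1]
      have := hPne q z
      field_simp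
    have htel := Finset.sum_range_succ F q
    rw [Finset.sum_range_succ', hF0, hFq] at htel
    rw [hsum1, hsum2, eq_sub_of_add_eq htel]
    field_simp
    ring

theorem norm_sub_translate_le {f : ℂ → ℂ} {h l M s t : ℝ} (hl : 0 < l)
    (hd : DifferentiableOn ℂ f (strip (h + l))) (hM : ∀ z ∈ strip (h + l), ‖f z‖ ≤ M) {z : ℂ}
    (hz : z ∈ strip h) : ‖f (z + s) - f (z + t)‖ ≤ M / l * |s - t| := by
  have hball : ∀ w ∈ strip h, Metric.closedBall w l ⊆ strip (h + l) := by
    intro w hw u hu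
    rw [Metric.mem_closedBall, Complex.dist_eq] at hu
    have h1 := Complex.abs_im_le_norm (u - w)
    rw [Complex.sub_im] at h1
    have h2 := abs_sub_abs_le_abs_sub u.im w.im
    have h3 := mem_strip.mp hw
    rw [mem_strip]; linarith
  have hder : ∀ w ∈ strip h, ‖deriv f w‖ ≤ M / l := fun w hw =>
    Complex.norm_deriv_le_of_forall_mem_sphere_norm_le hl
      ((hd.mono (hball w hw)).diffContOnCl_ball subset_rfl)
      fun u hu => hM u (hball w hw (Metric.sphere_subset_closedBall hu))
  have hconv : Convex ℝ (strip h) := by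
    have : strip h = Complex.imLm ⁻¹' (Set.Ioo (-h) h) := by
      ext w; simp [mem_strip, abs_lt]
    rw [this]
    exact (convex_Ioo _ _).linear_preimage _
  have hsub : strip h ⊆ strip (h + l) := strip_mono (by linarith)
  have h1 := Convex.norm_image_sub_le_of_norm_deriv_le (𝕜 := ℂ) (f := f) (s := strip h)
    (fun w hw => hd.differentiableAt ((isOpen_strip _).mem_nhds (hsub hw))) hder hconv
    (add_ofReal_mem_strip hz t) (add_ofReal_mem_strip hz s)
  have e : z + s - (z + t) = ((s - t : ℝ) : ℂ) := by push_cast; ring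
  rwa [e, Complex.norm_real, Real.norm_eq_abs] at h1

theorem exists_solution_approx {θ : ℂ → ℂ} {h d α l : ℝ} {r : ℚ} (hd0 : 0 < d) (hl : 0 < l)
    (hp : ∀ z, θ (z + 1) = θ z) (hθ : DifferentiableOn ℂ θ (strip h))
    (him : ∀ z ∈ strip h, ∀ j ≤ r.den, |(ssum θ r j z).im| ≤ 1 / 2)
    (hres : ∀ z ∈ strip h, d ≤ ‖1 - phaseProd θ r r.den z‖)
    (hgain : 8 * r.den / d / l * |α - r| ≤ 1 / 2) (h' : ℝ) (T : ℕ) :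
    ∀ (G : ℝ) (g : ℂ → ℂ), h' + T * l ≤ h → DifferentiableOn ℂ g (strip (h' + T * l)) →
    (∀ z, g (z + 1) = g z) → (∀ z ∈ strip (h' + T * l), ‖g z‖ ≤ G) →
    ∃ κ : ℂ → ℂ, DifferentiableOn ℂ κ (strip h') ∧ (∀ z, κ (z + 1) = κ z) ∧
      (∀ z ∈ strip h', ‖κ z‖ ≤ 2 * (8 * r.den / d) * G) ∧
      ∀ z ∈ strip h', ‖κ (z + α) - Complex.exp (-2 * Complex.I * θ z) * κ z - g z‖ ≤
        (1 / 2) ^ T * G := by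
  induction T with
  | zero =>
    intro G g _ _ _ hG
    refine ⟨fun _ => 0, differentiableOn_const 0, fun _ => rfl, fun z hz => ?_, fun z hz => ?_⟩
    · have hG0 : 0 ≤ G := (norm_nonneg _).trans (hG z (by simpa using hz))
      rw [norm_zero]; positivity
    · simpa using hG z (by simpa using hz)
  | succ T ih =>
    intro G g hh hg hgp hG
    set K := 8 * r.den / d with hK
    have eh : h' + (T + 1 : ℕ) * l = h' + T * l + l := by push_cast; ring
    rw [eh] at hh hg hG
    obtain ⟨κ, h1, h2, h3, h4⟩ := exists_solution_rational hd0 hp hθ him hres hh hg hgp hG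
    have hsub : strip (h' + T * l) ⊆ strip (h' + T * l + l) := strip_mono (by linarith)
    set R : ℂ → ℂ := fun z => κ (z + α) - κ (z + (r : ℝ)) with hR
    have hRd : DifferentiableOn ℂ R (strip (h' + T * l)) :=
      ((h1.comp (by fun_prop) fun z hz => add_ofReal_mem_strip (hsub hz) _).sub
        (h1.comp (by fun_prop) fun z hz => add_ofReal_mem_strip (hsub hz) _))
    have hRp : ∀ z, R (z + 1) = R z := fun z => by
      simp only [hR]; rw [add_right_comm, h2, add_right_comm, h2]
    by_cases hne : (strip h').Nonempty
    swap
    · rw [Set.not_nonempty_iff_eq_empty] at hne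
      refine ⟨fun _ => 0, differentiableOn_const 0, fun _ => rfl, fun z hz => ?_, fun z hz => ?_⟩ <;>
      · rw [hne] at hz; exact hz.elim
    obtain ⟨z0, hz0⟩ := hne
    have hTl : 0 ≤ (T : ℝ) * l := by positivity
    have hG0 : 0 ≤ G := (norm_nonneg _).trans (hG z0 (strip_mono (by linarith) hz0))
    have hRb : ∀ z ∈ strip (h' + T * l), ‖R z‖ ≤ G / 2 := by
      intro z hz
      have := norm_sub_translate_le (s := α) (t := r) hl h1 h3 hz
      calc _ ≤ K * G / l * |α - r| := this
        _ = (K / l * |α - r|) * G := by ring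
        _ ≤ 1 / 2 * G := by gcongr
        _ = _ := by ring
    obtain ⟨κ', i1, i2, i3, i4⟩ := ih (G / 2) (fun z => -R z) (by linarith) hRd.neg
      (fun z => by rw [hRp]) (fun z hz => by rw [norm_neg]; exact hRb z hz)
    have hsub' : strip h' ⊆ strip (h' + T * l + l) := strip_mono (by linarith)
    refine ⟨fun z => κ z + κ' z, (h1.mono hsub').add i1, fun z => by simp only [h2, i2], ?_, ?_⟩
    · intro z hz
      have a1 := h3 z (hsub' hz)
      have a2 := i3 z hz
      refine (norm_add_le _ _).trans ?_
      linarith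
    · intro z hz
      have a1 := i4 z hz
      have a2 := h4 z (hsub' hz)
      have e : κ (z + α) + κ' (z + α) - Complex.exp (-2 * Complex.I * θ z) * (κ z + κ' z) - g z =
          κ' (z + α) - Complex.exp (-2 * Complex.I * θ z) * κ' z - -R z := by
        simp only [hR, a2]; ring
      rw [e]
      refine a1.trans_eq ?_
      rw [pow_succ]; ring

/-- The closed disc of radius `1/10` around `e^{iρ}`. -/
def nearDisc (ρ : ℝ) : Set ℂ := Metric.closedBall (Complex.exp (Complex.I * ρ)) (1 / 10)

theorem norm_exp_I_mul (ρ : ℝ) : ‖Complex.exp (Complex.I * ρ)‖ = 1 := by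
  rw [mul_comm]; exact Complex.norm_exp_ofReal_mul_I ρ

theorem center_mem_nearDisc (ρ : ℝ) : Complex.exp (Complex.I * ρ) ∈ nearDisc ρ :=
  Metric.mem_closedBall_self (by norm_num)

theorem nearDisc_norm {ρ : ℝ} {z : ℂ} (hz : z ∈ nearDisc ρ) : 9 / 10 ≤ ‖z‖ ∧ ‖z‖ ≤ 11 / 10 := by
  rw [nearDisc, Metric.mem_closedBall, Complex.dist_eq] at hz
  have h1 := norm_sub_norm_le z (Complex.exp (Complex.I * ρ))
  have h2 := norm_sub_norm_le (Complex.exp (Complex.I * ρ)) z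
  rw [norm_sub_rev] at h2
  rw [norm_exp_I_mul] at h1 h2
  constructor <;> linarith

theorem nearDisc_im {ρ : ℝ} (hρ : ρ ∈ Set.Ioo (1 : ℝ) 2) {z : ℂ} (hz : z ∈ nearDisc ρ) :
    7 / 10 ≤ z.im := by
  rw [nearDisc, Metric.mem_closedBall, Complex.dist_eq] at hz
  have h1 := Complex.abs_im_le_norm (z - Complex.exp (Complex.I * ρ))
  have h2 : (Complex.exp (Complex.I * ρ)).im = Real.sin ρ := by
    rw [mul_comm]; exact Complex.exp_ofReal_mul_I_im ρ
  rw [Complex.sub_im, h2] at h1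
  have h3 := Real.one_sub_sq_div_two_le_cos (x := ρ - π / 2)
  rw [Real.cos_sub_pi_div_two] at h3
  have h4 := Real.pi_gt_d2
  have h5 := Real.pi_lt_d2
  have h6 : (ρ - π / 2) ^ 2 ≤ (3 / 5) ^ 2 := by
    apply sq_le_sq'
    · linarith [hρ.1]
    · linarith [hρ.2]
  have h7 := (abs_le.mp h1).1
  linarith

theorem nearDisc_slit {ρ : ℝ} (hρ : ρ ∈ Set.Ioo (1 : ℝ) 2) {z : ℂ} (hz : z ∈ nearDisc ρ) :
    z ∈ Complex.slitPlane :=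
  Or.inr (by have := nearDisc_im hρ hz; linarith)

theorem nearDisc_ne_zero {ρ : ℝ} {z : ℂ} (hz : z ∈ nearDisc ρ) : z ≠ 0 := by
  have := (nearDisc_norm hz).1
  intro h; rw [h, norm_zero] at this; linarith

theorem norm_log_sub_le {ρ : ℝ} (hρ : ρ ∈ Set.Ioo (1 : ℝ) 2) {z w : ℂ} (hz : z ∈ nearDisc ρ)
    (hw : w ∈ nearDisc ρ) : ‖Complex.log w - Complex.log z‖ ≤ 2 * ‖w - z‖ := by
  refine Convex.norm_image_sub_le_of_norm_hasDerivWithin_le (𝕜 := ℂ) (s := nearDisc ρ)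
    (f' := fun u => u⁻¹)
    (fun u hu => (Complex.hasDerivAt_log (nearDisc_slit hρ hu)).hasDerivWithinAt) (fun u hu => ?_)
    (convex_closedBall _ _) hz hw
  rw [norm_inv]
  have := (nearDisc_norm hu).1
  exact inv_le_of_inv_le₀ (by norm_num) (by norm_num; linarith)

theorem norm_log_sub_sub_le {ρ : ℝ} (hρ : ρ ∈ Set.Ioo (1 : ℝ) 2) {z w : ℂ} (hz : z ∈ nearDisc ρ)
    (hw : w ∈ nearDisc ρ) :
    ‖Complex.log w - Complex.log z - (w - z) / z‖ ≤ 2 * ‖w - z‖ ^ 2 := by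
  have hsub : segment ℝ z w ⊆ nearDisc ρ := (convex_closedBall _ _).segment_subset hz hw
  have hz0 := nearDisc_ne_zero hz
  have h := Convex.norm_image_sub_le_of_norm_hasDerivWithin_le (𝕜 := ℂ) (s := segment ℝ z w)
    (f := fun u => Complex.log u - u / z) (f' := fun u => u⁻¹ - 1 / z) (C := 2 * ‖w - z‖)
    (fun u hu => ((Complex.hasDerivAt_log (nearDisc_slit hρ (hsub hu))).sub
      ((hasDerivAt_id u).div_const z)).hasDerivWithinAt) (fun u hu => ?_)
    (convex_segment _ _) (left_mem_segment ℝ z w) (right_mem_segment ℝ z w)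
  · have e : Complex.log w - w / z - (Complex.log z - z / z) =
      Complex.log w - Complex.log z - (w - z) / z := by ring
    rw [e] at h
    refine h.trans_eq ?_
    ring
  · have hu1 := (nearDisc_norm (hsub hu)).1
    have hz1 := (nearDisc_norm hz).1
    have hu0 := nearDisc_ne_zero (hsub hu)
    have e : u⁻¹ - 1 / z = (z - u) / (u * z) := by field_simp
    have h1 : ‖z - u‖ ≤ ‖w - z‖ := by
      obtain ⟨a, b, ha, hb, hab, rfl⟩ := hu
      have e2 : z - (a • z + b • w) = (b : ℝ) • (z - w) := by
        have : (a : ℂ) = 1 - b := by rw [eq_sub_iff_add_eq]; exact_mod_cast hab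
        simp only [Complex.real_smul, this]; ring
      rw [e2, norm_smul, Real.norm_of_nonneg hb, norm_sub_rev w z]
      have : b ≤ 1 := by linarith
      have := norm_nonneg (z - w)
      nlinarith
    rw [e, norm_div, norm_mul, div_le_iff₀ (by nlinarith)]
    have h2 : 1 / 2 ≤ ‖u‖ * ‖z‖ := by nlinarith
    have := norm_nonneg (w - z)
    nlinarith

theorem log_center {ρ : ℝ} (hρ : ρ ∈ Set.Ioo (1 : ℝ) 2) :
    Complex.log (Complex.exp (Complex.I * ρ)) = Complex.I * ρ := by
  have := Real.pi_gt_three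
  refine Complex.log_exp ?_ ?_ <;> simp <;> linarith [hρ.1, hρ.2]

/-- The holomorphic extension of the argument of `z` on the real line. -/
noncomputable def phase (z : ℂ → ℂ) (x : ℂ) : ℂ :=
  (Complex.log (z x) - (starRingEnd ℂ) (Complex.log (z ((starRingEnd ℂ) x)))) / (2 * Complex.I)

/-- The Schwarz reflection of `z`. -/
noncomputable def reflect (z : ℂ → ℂ) (x : ℂ) : ℂ := (starRingEnd ℂ) (z ((starRingEnd ℂ) x))

theorem reflect_differentiableOn {z : ℂ → ℂ} {h : ℝ} (hz : DifferentiableOn ℂ z (strip h)) :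
    DifferentiableOn ℂ (reflect z) (strip h) := by
  intro x hx
  have h1 := hz.differentiableAt ((isOpen_strip h).mem_nhds (conj_mem_strip hx))
  have h2 := h1.hasDerivAt.conj_conj
  rw [Complex.conj_conj] at h2
  exact h2.differentiableAt.differentiableWithinAt

theorem reflect_periodic {z : ℂ → ℂ} (hp : ∀ x, z (x + 1) = z x) (x : ℂ) :
    reflect z (x + 1) = reflect z x := by
  simp [reflect, hp]

theorem phase_periodic {z : ℂ → ℂ} (hp : ∀ x, z (x + 1) = z x) (x : ℂ) :
    phase z (x + 1) = phase z x := by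
  simp [phase, hp]

theorem phase_ofReal (z : ℂ → ℂ) (x : ℝ) : phase z x = ((Complex.log (z x)).im : ℝ) := by
  rw [phase, Complex.conj_ofReal, Complex.sub_conj]
  field_simp
  push_cast
  ring

theorem exp_phase {z : ℂ → ℂ} {x : ℂ} (h1 : z x ≠ 0) (h2 : z ((starRingEnd ℂ) x) ≠ 0) :
    Complex.exp (-2 * Complex.I * phase z x) = reflect z x / z x := by
  have e : -2 * Complex.I * phase z x =
      (starRingEnd ℂ) (Complex.log (z ((starRingEnd ℂ) x))) - Complex.log (z x) := by
    rw [phase]; field_simp; ring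
  rw [e, Complex.exp_sub, Complex.exp_log h1, Complex.exp_conj, Complex.exp_log h2]
  rfl

theorem phase_differentiableOn {z : ℂ → ℂ} {ρ h : ℝ} (hρ : ρ ∈ Set.Ioo (1 : ℝ) 2)
    (hz : DifferentiableOn ℂ z (strip h)) (hn : ∀ x ∈ strip h, z x ∈ nearDisc ρ) :
    DifferentiableOn ℂ (phase z) (strip h) := by
  have h1 : DifferentiableOn ℂ (fun x => Complex.log (z x)) (strip h) :=
    hz.clog fun x hx => nearDisc_slit hρ (hn x hx)
  exact (h1.sub (reflect_differentiableOn h1)).div_const _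

theorem phase_sub_le {z w : ℂ → ℂ} {ρ h b : ℝ} (hρ : ρ ∈ Set.Ioo (1 : ℝ) 2)
    (hz : ∀ x ∈ strip h, z x ∈ nearDisc ρ) (hw : ∀ x ∈ strip h, w x ∈ nearDisc ρ)
    (hb : ∀ x ∈ strip h, ‖w x - z x‖ ≤ b) {x : ℂ} (hx : x ∈ strip h) :
    ‖phase w x - phase z x‖ ≤ 2 * b := by
  have h1 := norm_log_sub_le hρ (hz x hx) (hw x hx)
  have hx' := conj_mem_strip hx
  have h2 := norm_log_sub_le hρ (hz _ hx') (hw _ hx')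
  have h3 := hb x hx
  have h4 := hb _ hx'
  have e : phase w x - phase z x = ((Complex.log (w x) - Complex.log (z x)) -
      (starRingEnd ℂ) (Complex.log (w ((starRingEnd ℂ) x)) - Complex.log (z ((starRingEnd ℂ) x)))) /
        (2 * Complex.I) := by
    simp only [phase, map_sub]; ring
  rw [e, norm_div]
  have e2 : ‖(2 * Complex.I : ℂ)‖ = 2 := by simp
  rw [e2, div_le_iff₀ (by norm_num)]
  refine (norm_sub_le _ _).trans ?_
  rw [Complex.norm_conj]
  linarith

/-- An approximate invariant section of the Schrödinger cocycle on a strip of width `1/N`. -/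
structure ApproxSection (α ρ N a e E : ℝ) (v z : ℂ → ℂ) : Prop where
  diff : DifferentiableOn ℂ z (strip (1 / N))
  per : ∀ x, z (x + 1) = z x
  near : ∀ x ∈ strip (1 / N), ‖z x - Complex.exp (Complex.I * ρ)‖ ≤ a
  err : ∀ x ∈ strip (1 / N), ‖z (x + α) + 1 / z x + v x - E‖ ≤ e
  drift : |(∫ x in (0 : ℝ)..1, (Complex.log (z x)).im) - ρ| ≤ e
  decay : FourierDecay (phase z) (1 / N) a

theorem ApproxSection.mem_nearDisc {α ρ N a e E : ℝ} {v z : ℂ → ℂ}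
    (h : ApproxSection α ρ N a e E v z) (ha : a ≤ 1 / 10) {x : ℂ} (hx : x ∈ strip (1 / N)) :
    z x ∈ nearDisc ρ := by
  rw [nearDisc, Metric.mem_closedBall, Complex.dist_eq]
  exact (h.near x hx).trans ha

theorem fc_phase_zero (z : ℂ → ℂ) :
    fc (fun x : ℝ => phase z x) 0 = ((∫ x in (0 : ℝ)..1, (Complex.log (z x)).im : ℝ) : ℂ) := by
  rw [fc, ← intervalIntegral.integral_ofReal]
  refine intervalIntegral.integral_congr fun x _ => ?_
  simp [phase_ofReal, unitExp]

theorem ApproxSection.abs_im_ssum_le {α ρ N a e E : ℝ} {v z : ℂ → ℂ} {r : ℚ}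
    (h : ApproxSection α ρ N a e E v z) (hρ : ρ ∈ Set.Ioo (1 : ℝ) 2) (hN : 0 < N)
    (ha : a ≤ 1 / 10000) (hg : GoodScale α N r) :
    ∀ x ∈ strip (1 / N), ∀ j ≤ r.den, |(ssum (phase z) r j x).im| ≤ 1 / 2 := by
  intro x hx j hj
  have h1 := norm_birkhoff_sub_real_le hN hg h.decay
    (phase_differentiableOn hρ h.diff fun x hx => h.mem_nearDisc (by linarith) hx)
    (phase_periodic h.per) hx hj
  have h2 := (Complex.abs_im_le_norm _).trans h1
  have h3 : (∑ t ∈ range j, phase z (x.re + (t * r : ℝ))).im = 0 := by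
    rw [Complex.im_sum]
    refine Finset.sum_eq_zero fun t _ => ?_
    rw [← Complex.ofReal_add, phase_ofReal, Complex.ofReal_im]
  rw [Complex.sub_im, h3, sub_zero] at h2
  exact h2.trans (by linarith)

theorem ApproxSection.le_norm_one_sub {α ρ N a e E d : ℝ} {v z : ℂ → ℂ} {r : ℚ}
    (h : ApproxSection α ρ N a e E v z) (hρ : ρ ∈ Set.Ioo (1 : ℝ) 2)
    (ha : a ≤ 1 / 10000) (hd : d ≤ |Real.sin (r.den * ρ)|) (hdq : 1 / (20 * r.den) ≤ d)
    (hed : r.den * e ≤ d / 8) :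
    ∀ x ∈ strip (1 / N), d ≤ ‖1 - phaseProd (phase z) r r.den x‖ := by
  intro x hx
  have hq : (0 : ℝ) < r.den := by exact_mod_cast r.den_pos
  have h1 := norm_birkhoff_den_sub_le r h.decay
    (phase_differentiableOn hρ h.diff fun x hx => h.mem_nearDisc (by linarith) hx)
    (phase_periodic h.per) hx
  rw [fc_phase_zero] at h1
  set M := ∫ x in (0 : ℝ)..1, (Complex.log (z x)).im with hM
  set S := ssum (phase z) r r.den x with hS
  set ε : ℂ := S - (r.den * ρ : ℝ) with hε
  have hε1 : ‖ε‖ ≤ d / 4 := by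
    have e1 : ε = (S - r.den * (M : ℂ)) + (r.den : ℂ) * ((M - ρ : ℝ) : ℂ) := by
      rw [hε]; push_cast; ring
    have e2 : ‖(r.den : ℂ) * ((M - ρ : ℝ) : ℂ)‖ ≤ r.den * e := by
      rw [norm_mul, Complex.norm_natCast, Complex.norm_real, Real.norm_eq_abs]
      have := h.drift
      gcongr
    have hd0 : 0 < d := lt_of_lt_of_le (by positivity) hdq
    have e3 : 4 * (a / r.den) ≤ d / 8 := by
      have : a / r.den ≤ 1 / 10000 / r.den := by gcongr
      have e4 : 1 / (20 * (r.den : ℝ)) = 1 / 20 / r.den := by field_simp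
      rw [e4] at hdq
      have e5 : 1 / 10000 / (r.den : ℝ) = 1 / 500 * (1 / 20 / r.den) := by ring
      linarith
    rw [e1]
    refine (norm_add_le _ _).trans ?_
    have : ‖S - r.den * (M : ℂ)‖ ≤ 4 * (a / r.den) := h1
    linarith
  have hd1 : d ≤ 1 := hd.trans (Real.abs_sin_le_one _)
  have h2 : phaseProd (phase z) r r.den x =
      Complex.exp (Complex.I * ((-(2 * (r.den * ρ)) : ℝ) : ℂ)) * Complex.exp (-2 * Complex.I * ε) := by
    rw [phaseProd, ← Complex.exp_add]
    congr 1
    rw [hε]; push_cast; ring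
  set w := Complex.exp (Complex.I * ((-(2 * (r.den * ρ)) : ℝ) : ℂ)) with hw
  have hw1 : ‖w‖ = 1 := norm_exp_I_mul _
  have h3 : ‖w - 1‖ = 2 * |Real.sin (r.den * ρ)| := by
    rw [hw, Complex.norm_exp_I_mul_ofReal_sub_one, Real.norm_eq_abs, abs_mul]
    have : -(2 * (r.den * ρ)) / 2 = -(r.den * ρ) := by ring
    rw [this, Real.sin_neg, abs_neg]; norm_num
  have h4 : ‖Complex.exp (-2 * Complex.I * ε) - 1‖ ≤ d := by
    have e1 : ‖-2 * Complex.I * ε‖ = 2 * ‖ε‖ := by simp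
    refine (Complex.norm_exp_sub_one_le (by rw [e1]; linarith)).trans ?_
    rw [e1]; linarith
  have h5 : 1 - w * Complex.exp (-2 * Complex.I * ε) =
      -((w - 1) + w * (Complex.exp (-2 * Complex.I * ε) - 1)) := by ring
  rw [h2, h5, norm_neg]
  have h6 := norm_sub_le_norm_add (w - 1) (w * (Complex.exp (-2 * Complex.I * ε) - 1))
  rw [norm_mul, hw1, one_mul, h3] at h6
  linarith

theorem integral_im_eq {f : ℝ → ℂ} (hf : Continuous f) :
    ∫ x in (0 : ℝ)..1, (f x).im = (∫ x in (0 : ℝ)..1, f x).im :=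
  Complex.imCLM.intervalIntegral_comp_comm (hf.intervalIntegrable 0 1)

theorem norm_integral_unit_le {f : ℝ → ℂ} {b : ℝ} (hb : ∀ x, ‖f x‖ ≤ b) :
    ‖∫ x in (0 : ℝ)..1, f x‖ ≤ b := by
  simpa using intervalIntegral.norm_integral_le_of_norm_le_const (a := 0) (b := 1) fun x _ => hb x

theorem exists_energy_shift {D ε : ℝ → ℂ} {e τ : ℝ} (hDc : Continuous D) (hεc : Continuous ε)
    (hD : ∀ x, 7 / 5 ≤ (D x).im) (hD' : ∀ x, ‖D x‖ ≤ 11 / 5) (hε : ∀ x, ‖ε x‖ ≤ e)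
    (hτ : |τ| ≤ e) :
    ∃ s : ℝ, |s| ≤ 7 * e ∧ (∫ x in (0 : ℝ)..1, (s - ε x) / D x).im = -τ := by
  have hn : ∀ x, 7 / 5 ≤ ‖D x‖ := fun x =>
    (hD x).trans ((le_abs_self _).trans (Complex.abs_im_le_norm _))
  have h0 : ∀ x, D x ≠ 0 := fun x h => by
    have := hn x; rw [h, norm_zero] at this; linarith
  have hc1 : Continuous fun x => 1 / D x := continuous_const.div hDc h0
  have hc2 : Continuous fun x => ε x / D x := hεc.div hDc h0
  set J := (∫ x in (0 : ℝ)..1, 1 / D x).im with hJ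
  set K := (∫ x in (0 : ℝ)..1, ε x / D x).im with hK
  have hJ1 : J ≤ -(1 / 4) := by
    rw [hJ, ← integral_im_eq hc1]
    have : ∫ x in (0 : ℝ)..1, (1 / D x).im ≤ ∫ x in (0 : ℝ)..1, -(1 / 4 : ℝ) := by
      refine intervalIntegral.integral_mono_on zero_le_one
        ((Complex.continuous_im.comp hc1).intervalIntegrable _ _) (by simp) fun x _ => ?_
      have e1 : (1 / D x).im = -((D x).im / Complex.normSq (D x)) := by
        rw [one_div, Complex.inv_im]; ring
      rw [e1, neg_le_neg_iff, le_div_iff₀ (Complex.normSq_pos.mpr (h0 x)), Complex.normSq_eq_norm_sq]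
      have := hD x
      have := hD' x
      have := hn x
      nlinarith
    simpa using this
  have hK1 : |K| ≤ 5 / 7 * e := by
    refine (Complex.abs_im_le_norm _).trans (norm_integral_unit_le fun x => ?_)
    rw [norm_div, div_le_iff₀ (by linarith [hn x])]
    have := hε x
    have := hn x
    have := norm_nonneg (ε x)
    nlinarith
  have hJ0 : J ≠ 0 := by intro h; linarith
  refine ⟨(K - τ) / J, ?_, ?_⟩
  · have h1 : |K - τ| ≤ 12 / 7 * e := (abs_sub _ _).trans (by linarith)
    rw [abs_div, div_le_iff₀ (abs_pos.mpr hJ0), abs_of_neg (by linarith : J < 0)]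
    have := (abs_nonneg _).trans hτ
    nlinarith
  · have e1 : ∀ x, (((K - τ) / J : ℝ) - ε x) / D x =
        (((K - τ) / J : ℝ) : ℂ) * (1 / D x) - ε x / D x := fun x => by ring
    simp only [e1]
    have hc3 : Continuous fun x => (((K - τ) / J : ℝ) : ℂ) * (1 / D x) := continuous_const.mul hc1
    rw [intervalIntegral.integral_sub (hc3.intervalIntegrable _ _)
      (hc2.intervalIntegrable _ _), intervalIntegral.integral_const_mul, Complex.sub_im,
      Complex.im_ofReal_mul, ← hJ, ← hK]
    field_simp
    ring


theorem integral_add_eq_of_periodic {κ : ℂ → ℂ} (hp : ∀ z, κ (z + 1) = κ z) (α : ℝ) :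
    ∫ x in (0 : ℝ)..1, κ (x + α) = ∫ x in (0 : ℝ)..1, κ x := by
  have h1 : Function.Periodic (fun x : ℝ => κ x) 1 := fun x => by
    simpa using hp x
  have h2 := intervalIntegral.integral_comp_add_right (a := 0) (b := 1) (fun x : ℝ => κ x) α
  have h3 := h1.intervalIntegral_add_eq α 0
  simp only [Complex.ofReal_add, zero_add] at h2 h3
  rw [h2, add_comm 1 α, h3]

/-- The algebraic identity behind one Newton step. -/
theorem newton_identity {z zr zp zrp D Dp ε εr κ κp g s res v E δ δp z' : ℂ} (hz : z ≠ 0)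
    (hzr : zr ≠ 0) (hz' : z' ≠ 0) (hDp0 : Dp ≠ 0) (hε : ε = zp + 1 / z + v - E)
    (hεr : εr = zrp + 1 / zr + v - E) (hD : D = z - zr) (hDp : Dp = zp - zrp)
    (hg : g = (s - ε) / Dp) (hres : res = κp - zr / z * κ - g) (hδ : δ = D * κ)
    (hδp : δp = Dp * κp) (hz'e : z' = z + δ) :
    (zp + δp) + 1 / z' + v - (E + s) =
      (ε - εr) * (zr / z) * κ + Dp * res + δ ^ 2 / (z ^ 2 * z') := by
  have h1 : Dp = D / (z * zr) + (ε - εr) := by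
    rw [hDp, hε, hεr, hD]; field_simp; ring
  have h2 : κp = res + zr / z * κ + g := by rw [hres]; ring
  have h3 : Dp * g = s - ε := by rw [hg]; field_simp
  have h4 : δp = Dp * res + D / z ^ 2 * κ + (ε - εr) * (zr / z) * κ + (s - ε) := by
    rw [hδp, h2, mul_add, mul_add, h3]
    nth_rewrite 2 [h1]
    field_simp
    ring
  have h5 : 1 / z' = 1 / z - δ / z ^ 2 + δ ^ 2 / (z ^ 2 * z') := by
    have : δ = z' - z := by rw [hz'e]; ring
    rw [this]; field_simp; ring
  rw [h4, h5]
  have h6 : zp = ε - 1 / z - v + E := by rw [hε]; ring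
  rw [h6, hδ]
  field_simp
  ring

theorem ApproxSection.newton_core {α ρ N a e E C η h' : ℝ} {v z : ℂ → ℂ}
    (H : ApproxSection α ρ N a e E v z) (hρ : ρ ∈ Set.Ioo (1 : ℝ) 2) (hN : 0 < N)
    (hv : Differentiable ℂ v) (hvp : ∀ x, v (x + 1) = v x) (hvr : ∀ x, reflect v x = v x)
    (h0' : 0 < h') (hh' : h' ≤ 1 / N) (ha : a + 18 * C * e ≤ 1 / 10) (hC : 0 ≤ C) (he : 0 ≤ e)
    (hsol : ∀ (G : ℝ) (g : ℂ → ℂ), DifferentiableOn ℂ g (strip (1 / N)) →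
      (∀ x, g (x + 1) = g x) → (∀ x ∈ strip (1 / N), ‖g x‖ ≤ G) →
      ∃ κ : ℂ → ℂ, DifferentiableOn ℂ κ (strip h') ∧ (∀ x, κ (x + 1) = κ x) ∧
        (∀ x ∈ strip h', ‖κ x‖ ≤ C * G) ∧
        ∀ x ∈ strip h', ‖κ (x + α) - Complex.exp (-2 * Complex.I * phase z x) * κ x - g x‖ ≤
          η * G) :
    ∃ (z' : ℂ → ℂ) (E' : ℝ), DifferentiableOn ℂ z' (strip h') ∧ (∀ x, z' (x + 1) = z' x) ∧
      (∀ x ∈ strip h', ‖z' x - z x‖ ≤ 18 * C * e) ∧ |E' - E| ≤ 7 * e ∧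
      (∀ x ∈ strip h', ‖z' (x + α) + 1 / z' x + v x - E'‖ ≤
        20 * C * e ^ 2 + 18 * η * e + 2 * (18 * C * e) ^ 2) ∧
      |(∫ x in (0 : ℝ)..1, (Complex.log (z' x)).im) - ρ| ≤
        20 * C * e ^ 2 + 18 * η * e + 2 * (18 * C * e) ^ 2 := by
  have hN' : 0 < 1 / N := by positivity
  have hb0 : 0 ≤ 18 * C * e := by positivity
  have hsub : strip h' ⊆ strip (1 / N) := strip_mono hh'
  have hnear : ∀ x ∈ strip (1 / N), z x ∈ nearDisc ρ := fun x hx =>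
    H.mem_nearDisc (by linarith) hx
  have hz0 : ∀ x ∈ strip (1 / N), z x ≠ 0 := fun x hx => nearDisc_ne_zero (hnear x hx)
  have hnr : ∀ x ∈ strip (1 / N), ‖reflect z x‖ ≤ 11 / 10 ∧ 9 / 10 ≤ ‖reflect z x‖ ∧
      (reflect z x).im ≤ -(7 / 10) := by
    intro x hx
    have h1 := nearDisc_norm (hnear _ (conj_mem_strip hx))
    have h2 := nearDisc_im hρ (hnear _ (conj_mem_strip hx))
    rw [reflect, Complex.norm_conj, Complex.conj_im]
    exact ⟨h1.2, h1.1, by linarith⟩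
  have hzr0 : ∀ x ∈ strip (1 / N), reflect z x ≠ 0 := fun x hx h => by
    have := (hnr x hx).2.1; rw [h, norm_zero] at this; linarith
  set D : ℂ → ℂ := fun x => z x - reflect z x with hD
  have hDd : DifferentiableOn ℂ D (strip (1 / N)) := H.diff.sub (reflect_differentiableOn H.diff)
  have hDper : ∀ x, D (x + 1) = D x := fun x => by
    simp only [hD, H.per, reflect_periodic H.per]
  have hDim : ∀ x ∈ strip (1 / N), 7 / 5 ≤ (D x).im := fun x hx => by
    have := nearDisc_im hρ (hnear x hx)
    have := (hnr x hx).2.2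
    simp only [hD, Complex.sub_im]; linarith
  have hDn : ∀ x ∈ strip (1 / N), ‖D x‖ ≤ 11 / 5 := fun x hx => by
    have := (nearDisc_norm (hnear x hx)).2
    have := (hnr x hx).1
    exact (norm_sub_le _ _).trans (by linarith)
  have hD1 : ∀ x ∈ strip (1 / N), 7 / 5 ≤ ‖D x‖ := fun x hx =>
    (hDim x hx).trans ((le_abs_self _).trans (Complex.abs_im_le_norm _))
  have hD0 : ∀ x ∈ strip (1 / N), D x ≠ 0 := fun x hx h => by
    have := hD1 x hx; rw [h, norm_zero] at this; linarith
  have hshift : ∀ x ∈ strip (1 / N), x + (α : ℂ) ∈ strip (1 / N) := fun x hx =>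
    add_ofReal_mem_strip hx α
  have hcomp : ∀ {f : ℂ → ℂ} {w : ℝ}, DifferentiableOn ℂ f (strip w) →
      DifferentiableOn ℂ (fun x => f (x + α)) (strip w) := fun hf =>
    hf.comp (by fun_prop) fun x hx => add_ofReal_mem_strip hx α
  have hcper : ∀ {f : ℂ → ℂ}, (∀ x, f (x + 1) = f x) → ∀ x, f (x + 1 + α) = f (x + α) :=
    fun hf x => by rw [add_right_comm, hf]
  set ε : ℂ → ℂ := fun x => z (x + α) + 1 / z x + v x - E with hε
  have hεd : DifferentiableOn ℂ ε (strip (1 / N)) :=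
    (((hcomp H.diff).add ((differentiableOn_const 1).div H.diff hz0)).add
      hv.differentiableOn).sub_const _
  have hεper : ∀ x, ε (x + 1) = ε x := fun x => by
    simp only [hε, hcper H.per, H.per, hvp]
  have hεb : ∀ x ∈ strip (1 / N), ‖ε x‖ ≤ e := H.err
  have hεr : ∀ x, reflect ε x = reflect z (x + α) + 1 / reflect z x + v x - E := fun x => by
    have := hvr x
    simp only [reflect, hε, map_sub, map_add, map_div₀, map_one, Complex.conj_ofReal] at this ⊢
    rw [this]
  set τ := (∫ x in (0 : ℝ)..1, (Complex.log (z x)).im) - ρ with hτ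
  have hreal : ∀ x : ℝ, (x : ℂ) ∈ strip (1 / N) := ofReal_mem_strip hN'
  have hreal' : ∀ x : ℝ, (x : ℂ) ∈ strip h' := ofReal_mem_strip h0'
  obtain ⟨s, hs, hsint⟩ := exists_energy_shift (D := fun x : ℝ => D (x + α))
    (ε := fun x : ℝ => ε x) (e := e) (τ := τ) (continuous_restrict_strip hN' (hcomp hDd))
    (continuous_restrict_strip hN' hεd) (fun x => hDim _ (hshift _ (hreal x)))
    (fun x => hDn _ (hshift _ (hreal x))) (fun x => hεb _ (hreal x)) H.drift
  set g : ℂ → ℂ := fun x => (s - ε x) / D (x + α) with hg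
  have hgd : DifferentiableOn ℂ g (strip (1 / N)) :=
    ((differentiableOn_const _).sub hεd).div (hcomp hDd) fun x hx => hD0 _ (hshift x hx)
  have hgper : ∀ x, g (x + 1) = g x := fun x => by
    simp only [hg, hεper, hcper hDper]
  have hgb : ∀ x ∈ strip (1 / N), ‖g x‖ ≤ 8 * e := by
    intro x hx
    have h1 := hD1 _ (hshift x hx)
    rw [hg, norm_div, div_le_iff₀ (by linarith)]
    have h2 := hεb x hx
    have h3 : ‖(s : ℂ) - ε x‖ ≤ 8 * e := by
      refine (norm_sub_le _ _).trans ?_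
      rw [Complex.norm_real, Real.norm_eq_abs]; linarith
    nlinarith
  obtain ⟨κ, hκd, hκper, hκb, hκr⟩ := hsol (8 * e) g hgd hgper hgb
  set δ : ℂ → ℂ := fun x => D x * κ x with hδ
  set z' : ℂ → ℂ := fun x => z x + δ x with hz'
  have hδd : DifferentiableOn ℂ δ (strip h') := (hDd.mono hsub).mul hκd
  have hz'd : DifferentiableOn ℂ z' (strip h') := (H.diff.mono hsub).add hδd
  have hδb : ∀ x ∈ strip h', ‖δ x‖ ≤ 18 * C * e := by
    intro x hx
    rw [hδ, norm_mul]
    calc ‖D x‖ * ‖κ x‖ ≤ 11 / 5 * (C * (8 * e)) := by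
          gcongr
          · exact hDn x (hsub hx)
          · exact hκb x hx
      _ ≤ 18 * C * e := by nlinarith
  have hnear' : ∀ x ∈ strip h', z' x ∈ nearDisc ρ := by
    intro x hx
    rw [nearDisc, Metric.mem_closedBall, Complex.dist_eq]
    have h1 := H.near x (hsub hx)
    have h2 := hδb x hx
    have e1 : z' x - Complex.exp (Complex.I * ρ) = (z x - Complex.exp (Complex.I * ρ)) + δ x := by
      simp only [hz']; ring
    rw [e1]
    exact (norm_add_le _ _).trans (by linarith)
  have hphase : ∀ x ∈ strip (1 / N),
      Complex.exp (-2 * Complex.I * phase z x) = reflect z x / z x := fun x hx =>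
    exp_phase (hz0 x hx) (hz0 _ (conj_mem_strip hx))
  have hlam : ∀ x ∈ strip (1 / N), ‖reflect z x / z x‖ ≤ 5 / 4 := by
    intro x hx
    have h1 := (nearDisc_norm (hnear x hx)).1
    have h2 := (hnr x hx).1
    rw [norm_div, div_le_iff₀ (by linarith)]
    linarith
  set res : ℂ → ℂ := fun x => κ (x + α) - reflect z x / z x * κ x - g x with hres
  have hresb : ∀ x ∈ strip h', ‖res x‖ ≤ 8 * η * e := by
    intro x hx
    have := hκr x hx
    rw [hphase x (hsub hx)] at this
    exact this.trans_eq (by ring)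
  refine ⟨z', E + s, hz'd, fun x => by simp only [hz', hδ, H.per, hDper, hκper], fun x hx => ?_,
    by simpa using hs, fun x hx => ?_, ?_⟩
  · simpa [hz'] using hδb x hx
  · have hx1 := hsub hx
    have key := newton_identity (z := z x) (zr := reflect z x) (zp := z (x + α))
      (zrp := reflect z (x + α)) (D := D x) (Dp := D (x + α)) (ε := ε x) (εr := reflect ε x)
      (κ := κ x) (κp := κ (x + α)) (g := g x) (s := s) (res := res x) (v := v x) (E := E)
      (δ := δ x) (δp := δ (x + α)) (z' := z' x) (hz0 x hx1) (hzr0 x hx1)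
      (nearDisc_ne_zero (hnear' x hx)) (hD0 _ (hshift x hx1)) rfl (hεr x) rfl rfl rfl rfl rfl rfl rfl
    have e1 : z' (x + α) + 1 / z' x + v x - ((E + s : ℝ) : ℂ) =
        (z (x + α) + δ (x + α)) + 1 / z' x + v x - (E + s) := by
      rw [Complex.ofReal_add]
    rw [e1, key]
    have b1 : ‖(ε x - reflect ε x) * (reflect z x / z x) * κ x‖ ≤ 20 * C * e ^ 2 := by
      have h1 := hεb x hx1
      have h2 : ‖reflect ε x‖ ≤ e := by
        rw [reflect, Complex.norm_conj]; exact hεb _ (conj_mem_strip hx1)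
      have h3 : ‖ε x - reflect ε x‖ ≤ 2 * e := (norm_sub_le _ _).trans (by linarith)
      rw [norm_mul, norm_mul]
      calc _ ≤ 2 * e * (5 / 4) * (C * (8 * e)) := by
            gcongr
            · exact hlam x hx1
            · exact hκb x hx
        _ = _ := by ring
    have b2 : ‖D (x + α) * res x‖ ≤ 18 * η * e := by
      have h1 := hresb x hx
      have h2 := (norm_nonneg _).trans h1
      rw [norm_mul]
      calc _ ≤ 11 / 5 * (8 * η * e) := by
            gcongr
            exact hDn _ (hshift x hx1)
        _ ≤ _ := by linarith
    have b3 : ‖δ x ^ 2 / (z x ^ 2 * z' x)‖ ≤ 2 * (18 * C * e) ^ 2 := by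
      have h1 := (nearDisc_norm (hnear x hx1)).1
      have h2 := (nearDisc_norm (hnear' x hx)).1
      have h3 : 1 / 2 ≤ ‖z x‖ ^ 2 * ‖z' x‖ := by
        have : (81 / 100 : ℝ) ≤ ‖z x‖ ^ 2 := by nlinarith
        nlinarith
      rw [norm_div, norm_mul, norm_pow, norm_pow, div_le_iff₀ (by linarith)]
      have h4 : ‖δ x‖ ^ 2 ≤ (18 * C * e) ^ 2 := by
        have := hδb x hx
        gcongr
      have := sq_nonneg (18 * C * e)
      nlinarith
    refine (norm_add₃_le).trans ?_
    linarith
  · set F : ℂ → ℂ := fun x => Complex.log (z' x) - Complex.log (z x) - g x - κ x + κ (x + α) with hF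
    have hFb : ∀ x : ℝ, ‖F x‖ ≤ 8 * η * e + 2 * (18 * C * e) ^ 2 := by
      intro x
      have h1 := norm_log_sub_sub_le hρ (hnear _ (hreal x)) (hnear' _ (hreal' x))
      have e0 : z' x - z x = δ x := by simp only [hz']; ring
      rw [e0] at h1
      have h2 : ‖δ x‖ ^ 2 ≤ (18 * C * e) ^ 2 := by
        have := hδb x (hreal' x)
        gcongr
      have h3 := hresb x (hreal' x)
      have e1 : F x = (Complex.log (z' x) - Complex.log (z x) - δ x / z x) + res x := by
        have hzx := hz0 _ (hreal x)
        simp only [hF, hres, hδ, hD]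
        field_simp
        ring
      rw [e1]
      exact (norm_add_le _ _).trans (by linarith)
    have c1 : Continuous fun x : ℝ => Complex.log (z' x) :=
      continuous_restrict_strip h0' (hz'd.clog fun x hx => nearDisc_slit hρ (hnear' x hx))
    have c2 : Continuous fun x : ℝ => Complex.log (z x) :=
      continuous_restrict_strip hN' (H.diff.clog fun x hx => nearDisc_slit hρ (hnear x hx))
    have c3 : Continuous fun x : ℝ => g x := continuous_restrict_strip hN' hgd
    have c4 : Continuous fun x : ℝ => κ x := continuous_restrict_strip h0' hκd
    have c5 : Continuous fun x : ℝ => κ (x + α) := continuous_restrict_strip h0' (hcomp hκd)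
    have hintegral : ∫ x in (0 : ℝ)..1, F x = (∫ x in (0 : ℝ)..1, Complex.log (z' x)) -
        (∫ x in (0 : ℝ)..1, Complex.log (z x)) - ∫ x in (0 : ℝ)..1, g x := by
      have d1 : Continuous fun x : ℝ => Complex.log (z' x) - Complex.log (z x) := c1.sub c2
      have d2 : Continuous fun x : ℝ => Complex.log (z' x) - Complex.log (z x) - g x := d1.sub c3
      have d3 : Continuous fun x : ℝ => Complex.log (z' x) - Complex.log (z x) - g x - κ x :=
        d2.sub c4
      simp only [hF]
      rw [intervalIntegral.integral_add (d3.intervalIntegrable _ _) (c5.intervalIntegrable _ _),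
        intervalIntegral.integral_sub (d2.intervalIntegrable _ _) (c4.intervalIntegrable _ _),
        intervalIntegral.integral_sub (d1.intervalIntegrable _ _) (c3.intervalIntegrable _ _),
        intervalIntegral.integral_sub (c1.intervalIntegrable _ _) (c2.intervalIntegrable _ _),
        integral_add_eq_of_periodic hκper]
      ring
    have hfin : (∫ x in (0 : ℝ)..1, (Complex.log (z' x)).im) - ρ =
        (∫ x in (0 : ℝ)..1, F x).im := by
      rw [hintegral, Complex.sub_im, Complex.sub_im, ← integral_im_eq c1, ← integral_im_eq c2, hsint, hτ]
      ring
    rw [hfin]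
    refine (Complex.abs_im_le_norm _).trans ((norm_integral_unit_le hFb).trans ?_)
    have h1 := hresb 0 (by simpa using hreal' 0)
    have h2 := (norm_nonneg _).trans h1
    have : 0 ≤ C * e ^ 2 := by positivity
    linarith

/-- The number of halvings of the error in the approximate solution of the linearized equation
at scale `N`. -/
noncomputable def halvings (N : ℝ) : ℕ := ⌊N ^ (1 / 8 : ℝ) / 64⌋₊

theorem one_le_halvings {N : ℝ} (hN : minScale ≤ N) : 1 ≤ halvings N := by
  have h4 := le_minScale.trans hN
  rw [halvings, Nat.one_le_floor_iff, le_div_iff₀ (by norm_num)]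
  have h2 : ((4 : ℝ) ^ 240) ^ (1 / 8 : ℝ) ≤ N ^ (1 / 8 : ℝ) :=
    Real.rpow_le_rpow (by positivity) h4 (by norm_num)
  have h3 : ((4 : ℝ) ^ 240) ^ (1 / 8 : ℝ) = 4 ^ 30 := by
    rw [← Real.rpow_natCast 4 240, ← Real.rpow_mul (by norm_num)]; norm_num
  rw [h3] at h2
  exact le_trans (by norm_num) h2

theorem halvings_add_one_le {N : ℝ} (hN : minScale ≤ N) :
    32 * ((halvings N : ℝ) + 1) ≤ N ^ (1 / 8 : ℝ) := by
  have h1 : (1 : ℝ) ≤ halvings N := by exact_mod_cast one_le_halvings hN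
  have h0 : 0 < N := lt_of_lt_of_le (by positivity) (le_minScale.trans hN)
  have h2 : (halvings N : ℝ) ≤ N ^ (1 / 8 : ℝ) / 64 := Nat.floor_le (by positivity)
  linarith

theorem GoodScale.resonance_bounds {α N : ℝ} {r : ℚ} (hN : minScale ≤ N) (hg : GoodScale α N r) :
    0 < resThreshold r.den ∧ 1 / (20 * r.den) ≤ resThreshold r.den ∧
    r.den / resThreshold r.den * 1000000 ≤ N ^ 2 ∧
    8 * r.den / resThreshold r.den / (1 / (2 * N * (halvings N + 1))) * |α - r| ≤ 1 / 2 := by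
  have h4 := le_minScale.trans hN
  have h0 : 0 < N := lt_of_lt_of_le (by positivity) h4
  have hN1 : 1 ≤ N := le_trans (by norm_num) h4
  have hq : (1 : ℝ) ≤ r.den := by exact_mod_cast r.den_pos
  have hd := one_div_rpow_le_resThreshold hq hN hg.den_le
  set d := resThreshold r.den with hdd
  have hd0 : 0 < d := lt_of_lt_of_le (by positivity) hd
  have hdinv : 1 / d ≤ N ^ (1 / 24 : ℝ) := by
    rw [div_le_iff₀ hd0]
    calc (1 : ℝ) = N ^ (1 / 24 : ℝ) * N ^ (-(1 / 24) : ℝ) := by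
          rw [← Real.rpow_add h0]; norm_num
      _ ≤ _ := by gcongr
  refine ⟨hd0, ?_, ?_, ?_⟩
  · rw [hdd, resThreshold, ← one_div_mul_one_div]
    gcongr
    rw [one_div, ← Real.rpow_neg_one]
    exact Real.rpow_le_rpow_of_exponent_le hq (by norm_num)
  · have h2 : ((4 : ℝ) ^ 240) ^ (1 / 24 : ℝ) ≤ N ^ (1 / 24 : ℝ) :=
      Real.rpow_le_rpow (by positivity) h4 (by norm_num)
    have h3 : ((4 : ℝ) ^ 240) ^ (1 / 24 : ℝ) = 4 ^ 10 := by
      rw [← Real.rpow_natCast 4 240, ← Real.rpow_mul (by norm_num)]; norm_num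
    rw [h3] at h2
    have e : (r.den : ℝ) / d = r.den * (1 / d) := by ring
    calc (r.den : ℝ) / d * 1000000 ≤ N ^ (7 / 6 : ℝ) * N ^ (1 / 24 : ℝ) * N ^ (1 / 24 : ℝ) := by
          rw [e]
          gcongr
          · exact hg.den_le
          · exact le_trans (by norm_num) h2
      _ = N ^ (5 / 4 : ℝ) := by rw [← Real.rpow_add h0, ← Real.rpow_add h0]; norm_num
      _ ≤ N ^ (2 : ℝ) := Real.rpow_le_rpow_of_exponent_le hN1 (by norm_num)
      _ = N ^ 2 := by norm_cast
  · have hT := halvings_add_one_le hN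
    set T := (halvings N : ℝ) + 1
    have hT0 : 0 < T := by positivity
    have hq0 : (0 : ℝ) < r.den := by linarith
    calc 8 * r.den / d / (1 / (2 * N * T)) * |α - r|
        = 16 * r.den * N * T * (1 / d) * |α - r| := by field_simp; ring
      _ ≤ 16 * r.den * N * T * N ^ (1 / 24 : ℝ) * (1 / (N ^ (7 / 6 : ℝ) * r.den)) := by
          gcongr; exact hg.dist_le
      _ = 16 * T * (N * N ^ (1 / 24 : ℝ) / N ^ (7 / 6 : ℝ)) := by field_simp
      _ = 16 * T * N ^ (-(1 / 8) : ℝ) := by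
          nth_rewrite 1 [← Real.rpow_one N]
          rw [← Real.rpow_add h0, ← Real.rpow_sub h0]; norm_num
      _ ≤ 1 / 2 * (N ^ (1 / 8 : ℝ) * N ^ (-(1 / 8) : ℝ)) := by
          rw [← mul_assoc]
          exact mul_le_mul_of_nonneg_right (by linarith) (by positivity)
      _ = 1 / 2 := by rw [← Real.rpow_add h0]; norm_num

theorem ApproxSection.nonneg {α ρ N a e E : ℝ} {v z : ℂ → ℂ}
    (H : ApproxSection α ρ N a e E v z) : 0 ≤ e := (abs_nonneg _).trans H.drift

theorem ApproxSection.newton {α ρ N a e E N' V : ℝ} {r : ℚ} {v v' z : ℂ → ℂ}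
    (H : ApproxSection α ρ N a e E v z) (hρ : ρ ∈ Set.Ioo (1 : ℝ) 2) (hN : minScale ≤ N)
    (hg : GoodScale α N r) (hres : resThreshold r.den ≤ |Real.sin (r.den * ρ)|)
    (hv : Differentiable ℂ v) (hvp : ∀ x, v (x + 1) = v x) (hvr : ∀ x, reflect v x = v x)
    (ha : a ≤ 1 / 10000) (he : e ≤ 1 / N ^ 30) (hN' : 8 * N ≤ N')
    (hV : ∀ x ∈ strip (1 / N'), ‖v' x - v x‖ ≤ V) :
    ∃ (z' : ℂ → ℂ) (E' : ℝ),
      ApproxSection α ρ N' (a + N ^ 8 * e) (N ^ 5 * (e ^ 2 + e * (1 / 2) ^ halvings N) + V) E' v' z' ∧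
      (∀ x ∈ strip (1 / (2 * N)), ‖z' x - z x‖ ≤ N ^ 2 * e) ∧ |E' - E| ≤ 7 * e := by
  obtain ⟨hd0, hdq, hC, hgain⟩ := hg.resonance_bounds hN
  set d := resThreshold r.den with hd
  set T := halvings N
  have h4 := le_minScale.trans hN
  have hNbig : (1000 : ℝ) ≤ N := le_trans (by norm_num) h4
  have h0 : 0 < N := by linarith
  have hN1 : 1 ≤ N := by linarith
  have he0 := H.nonneg
  set C := 2 * (8 * r.den / d) with hCd
  have hC0 : 0 ≤ C := by positivity
  have hC1 : 18 * C * 1000 ≤ N ^ 2 := by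
    have : C = 16 * (r.den / d) := by rw [hCd]; ring
    have : (0 : ℝ) ≤ r.den / d := by positivity
    linarith
  have hsmall : N ^ 2 * e ≤ 1 / 100 := by
    calc N ^ 2 * e ≤ N ^ 2 * (1 / N ^ 30) := by gcongr
      _ = 1 / N ^ 28 := by field_simp
      _ ≤ 1 / 100 := by
        gcongr
        calc (100 : ℝ) ≤ N := by linarith
          _ = N ^ 1 := (pow_one N).symm
          _ ≤ N ^ 28 := pow_le_pow_right₀ hN1 (by norm_num)
  have hCe : 18 * C * e * 1000 ≤ N ^ 2 * e := by nlinarith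
  have hed : r.den * e ≤ d / 8 := by
    have h1 : (r.den : ℝ) * 1000000 ≤ N ^ 2 * d := by
      rw [div_mul_eq_mul_div, div_le_iff₀ hd0] at hC
      exact hC
    have h2 : r.den * e * 1000000 ≤ N ^ 2 * e * d := by nlinarith
    have h3 : N ^ 2 * e * d ≤ 1 / 100 * d := by gcongr
    linarith
  have hθd : DifferentiableOn ℂ (phase z) (strip (1 / N)) :=
    phase_differentiableOn hρ H.diff fun x hx => H.mem_nearDisc (by linarith) hx
  have hl : 0 < 1 / (2 * N * ((T : ℝ) + 1)) := by positivity
  have hlT : 1 / (2 * N) + T * (1 / (2 * N * ((T : ℝ) + 1))) ≤ 1 / N := by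
    have e1 : T * (1 / (2 * N * ((T : ℝ) + 1))) = T / (T + 1) * (1 / (2 * N)) := by field_simp
    have e2 : (T : ℝ) / (T + 1) ≤ 1 := (div_le_one (by positivity)).mpr (by linarith)
    have e3 : 1 / N = 1 / (2 * N) + 1 * (1 / (2 * N)) := by field_simp; norm_num
    rw [e1, e3]
    gcongr
  have hhalf : 1 / (2 * N) ≤ 1 / N := by gcongr; linarith
  have h0' : 0 < 1 / (2 * N) := by positivity
  obtain ⟨z', E', z1, z2, z3, z4, z5, z6⟩ := H.newton_core (C := C) (η := (1 / 2) ^ T)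
    (h' := 1 / (2 * N)) hρ h0 hv hvp hvr h0' hhalf
    (by linarith) hC0 he0 (fun G g gd gp gb => by
      have hsub := strip_mono hlT
      exact exists_solution_approx hd0 hl (phase_periodic H.per) hθd
        (H.abs_im_ssum_le hρ h0 ha hg) (H.le_norm_one_sub hρ ha hres hdq hed) hgain
        (1 / (2 * N)) T G g hlT (gd.mono hsub) gp fun x hx => gb x (hsub hx))
  have hstrip : strip (1 / N') ⊆ strip (1 / (2 * N)) := by
    refine strip_mono ?_
    gcongr
    linarith
  set η : ℝ := (1 / 2) ^ T with hη
  have hη0 : 0 ≤ η := by positivity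
  have hV0 : 0 ≤ V := (norm_nonneg _).trans (hV 0 (by
    have : 0 < 1 / N' := by
      have : 0 < N' := by linarith
      positivity
    simpa using ofReal_mem_strip this 0))
  have herr : 20 * C * e ^ 2 + 18 * η * e + 2 * (18 * C * e) ^ 2 ≤ N ^ 5 * (e ^ 2 + e * η) := by
    have p1 : N ^ 2 ≤ N ^ 4 := pow_le_pow_right₀ hN1 (by norm_num)
    have p2 : N ^ 4 * 1000 ≤ N ^ 5 := by
      have : N ^ 5 = N ^ 4 * N := by ring
      rw [this]; gcongr
    have p3 : (1 : ℝ) ≤ N ^ 4 := one_le_pow₀ hN1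
    have q1 : 20 * C * e ^ 2 ≤ N ^ 4 * e ^ 2 := by
      gcongr
      linarith
    have q2 : (18 * C * e) ^ 2 ≤ N ^ 4 * e ^ 2 := by
      have : N ^ 4 * e ^ 2 = (N ^ 2 * e) ^ 2 := by ring
      rw [this]
      gcongr
      linarith
    have q3 : 18 * (η * e) ≤ N ^ 5 * (η * e) := by
      gcongr
      linarith
    have q4 : 3 * (N ^ 4 * e ^ 2) ≤ N ^ 5 * e ^ 2 := by
      have : 0 ≤ N ^ 4 * e ^ 2 := by positivity
      have := mul_le_mul_of_nonneg_right p2 (sq_nonneg e)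
      nlinarith
    nlinarith
  have hpow : N ^ 2 * e ≤ N ^ 8 * e := by
    exact mul_le_mul_of_nonneg_right (pow_le_pow_right₀ hN1 (by norm_num)) he0
  have hbC : 0 ≤ 18 * C * e := by positivity
  refine ⟨z', E', ⟨z1.mono hstrip, z2, fun x hx => ?_, fun x hx => ?_, by linarith, ?_⟩,
    fun x hx => (z3 x hx).trans (by linarith), z4⟩
  · have h1 := H.near x (strip_mono hhalf (hstrip hx))
    have h2 := z3 x (hstrip hx)
    have e1 : z' x - Complex.exp (Complex.I * ρ) =
        (z x - Complex.exp (Complex.I * ρ)) + (z' x - z x) := by ring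
    rw [e1]
    exact (norm_add_le _ _).trans (by linarith)
  · have h1 := z5 x (hstrip hx)
    have h2 := hV x hx
    have e1 : z' (x + α) + 1 / z' x + v' x - E' =
        (z' (x + α) + 1 / z' x + v x - E') + (v' x - v x) := by ring
    rw [e1]
    exact (norm_add_le _ _).trans (by linarith)
  · have hn1 : ∀ x ∈ strip (1 / (2 * N)), z x ∈ nearDisc ρ := fun x hx =>
      H.mem_nearDisc (by linarith) (strip_mono hhalf hx)
    have hn2 : ∀ x ∈ strip (1 / (2 * N)), z' x ∈ nearDisc ρ := fun x hx => by
      rw [nearDisc, Metric.mem_closedBall, Complex.dist_eq]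
      have h1 := H.near x (strip_mono hhalf hx)
      have h2 := z3 x hx
      have e1 : z' x - Complex.exp (Complex.I * ρ) =
          (z x - Complex.exp (Complex.I * ρ)) + (z' x - z x) := by ring
      rw [e1]
      exact (norm_add_le _ _).trans (by linarith)
    have hd1 := phase_differentiableOn hρ (H.diff.mono (strip_mono hhalf)) hn1
    have hd2 := phase_differentiableOn hρ z1 hn2
    have hdec := fourierDecay_of_norm_le h0' (hd2.sub hd1)
      (fun x => by simp only [Pi.sub_apply, phase_periodic H.per, phase_periodic z2])
      (fun x hx => phase_sub_le hρ hn1 hn2 z3 hx)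
    have h8 : 1 / N' ≤ 1 / (2 * N) / 4 := by
      rw [div_div]
      gcongr
      linarith
    have hb : 5 * (2 * (18 * C * e)) / (1 / (2 * N)) ^ 4 ≤ N ^ 8 * e := by
      have e1 : 5 * (2 * (18 * C * e)) / (1 / (2 * N)) ^ 4 = 160 * N ^ 4 * (18 * C * e) := by
        field_simp; ring
      have e2 : N ^ 8 * e = N ^ 4 * N ^ 2 * (N ^ 2 * e) := by ring
      have p3 : (1 : ℝ) ≤ N ^ 2 := one_le_pow₀ hN1
      rw [e1, e2]
      calc 160 * N ^ 4 * (18 * C * e) = N ^ 4 * (160 * (18 * C * e)) := by ring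
        _ ≤ N ^ 4 * (N ^ 2 * e) := mul_le_mul_of_nonneg_left (by linarith) (by positivity)
        _ = N ^ 4 * 1 * (N ^ 2 * e) := by ring
        _ ≤ _ := by gcongr
    have hsum := (H.decay.mono (h8.trans (by
      rw [div_div]
      gcongr
      linarith)) le_rfl).add (h' := 1 / (2 * N)) h0' (hdec.mono h8 hb) hd1 (hd2.sub hd1)
    have e1 : (fun x => phase z x + (phase z' - phase z) x) = phase z' := by
      funext x; simp
    rw [← e1]
    exact hsum

/-- The Fourier truncation to frequencies of size at most `N`. -/
noncomputable def trunc (b : ℤ → ℂ) (N : ℝ) (z : ℂ) : ℂ :=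
  ∑ m ∈ Icc (-⌊N⌋) ⌊N⌋, b m * unitExp (m * z)

/-- A bound for the difference of two consecutive truncations. -/
noncomputable def truncGap (b : ℤ → ℂ) (N N' : ℝ) : ℝ :=
  1000 * ∑ m ∈ Icc (-⌊N'⌋) ⌊N'⌋ \ Icc (-⌊N⌋) ⌊N⌋, ‖b m‖

theorem trunc_differentiable (b : ℤ → ℂ) (N : ℝ) : Differentiable ℂ (trunc b N) := by
  unfold trunc
  refine Differentiable.fun_sum fun m _ => ?_
  exact (differentiable_const _).mul (differentiable_unitExp.comp (by fun_prop))

theorem trunc_periodic (b : ℤ → ℂ) (N : ℝ) (z : ℂ) : trunc b N (z + 1) = trunc b N z := by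
  unfold trunc
  refine sum_congr rfl fun m _ => ?_
  rw [mul_add, mul_one, unitExp_add, unitExp_int, mul_one]

theorem conj_unitExp (z : ℂ) : (starRingEnd ℂ) (unitExp z) = unitExp (-(starRingEnd ℂ) z) := by
  unfold unitExp
  rw [← Complex.exp_conj]
  simp [map_ofNat]

theorem trunc_reflect {b : ℤ → ℂ} (hb : ∀ m, b (-m) = (starRingEnd ℂ) (b m)) (N : ℝ) (z : ℂ) :
    reflect (trunc b N) z = trunc b N z := by
  unfold reflect trunc
  rw [map_sum]
  refine sum_nbij' (fun m => -m) (fun m => -m) ?_ ?_ (by simp) (by simp) fun m _ => ?_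
  · intro m hm; simp only [mem_Icc] at hm ⊢; omega
  · intro m hm; simp only [mem_Icc] at hm ⊢; omega
  · rw [map_mul, conj_unitExp, hb]
    simp

theorem norm_unitExp_int_mul_le {N : ℝ} (hN : 0 < N) {z : ℂ} (hz : z ∈ strip (1 / N)) {m : ℤ}
    (hm : m ∈ Icc (-⌊N⌋) ⌊N⌋) : ‖unitExp (m * z)‖ ≤ 1000 := by
  have h1 : |(m : ℝ)| ≤ N := by
    rw [mem_Icc] at hm
    have h2 : |m| ≤ ⌊N⌋ := abs_le.mpr hm
    have h3 : ((|m| : ℤ) : ℝ) ≤ ⌊N⌋ := by exact_mod_cast h2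
    rw [Int.cast_abs] at h3
    exact h3.trans (Int.floor_le N)
  have h4 : |(m : ℝ) * z.im| ≤ 1 := by
    rw [abs_mul]
    calc _ ≤ N * (1 / N) := by
          gcongr
          exact (mem_strip.mp hz).le
      _ = 1 := by field_simp
  rw [norm_unitExp]
  have h5 : ((m : ℂ) * z).im = m * z.im := by simp
  rw [h5]
  calc Real.exp (-(2 * π * (m * z.im))) ≤ Real.exp (6.3) := by
        rw [Real.exp_le_exp]
        have := (abs_le.mp h4).1
        have := Real.pi_lt_d2
        have := Real.pi_pos
        nlinarith
    _ = Real.exp 1 ^ (6 : ℕ) * Real.exp (0.3) := by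
        rw [← Real.exp_nat_mul, ← Real.exp_add]; norm_num
    _ ≤ 2.7183 ^ 6 * (1 / (1 - 0.3)) := by
        gcongr
        · exact (Real.exp_one_lt_d9.trans (by norm_num)).le
        · exact Real.exp_bound_div_one_sub_of_interval (by norm_num) (by norm_num)
    _ ≤ 1000 := by norm_num

theorem norm_trunc_sub_le (b : ℤ → ℂ) {N N' : ℝ} (hN' : 0 < N') (h : N ≤ N') {z : ℂ}
    (hz : z ∈ strip (1 / N')) : ‖trunc b N' z - trunc b N z‖ ≤ truncGap b N N' := by
  have hf : ⌊N⌋ ≤ ⌊N'⌋ := Int.floor_le_floor h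
  have hs : Icc (-⌊N⌋) ⌊N⌋ ⊆ Icc (-⌊N'⌋) ⌊N'⌋ := Icc_subset_Icc (by omega) hf
  rw [trunc, trunc, ← sum_sdiff hs, add_sub_cancel_right, truncGap, mul_sum]
  refine (norm_sum_le _ _).trans (sum_le_sum fun m hm => ?_)
  rw [norm_mul, mul_comm]
  gcongr
  exact norm_unitExp_int_mul_le hN' hz (mem_sdiff.mp hm).1

theorem truncGap_nonneg (b : ℤ → ℂ) (N N' : ℝ) : 0 ≤ truncGap b N N' := by
  unfold truncGap; positivity

theorem truncGap_le {b : ℤ → ℂ} {N B : ℝ} (N' : ℝ) (hN : 0 < N) (hB : 0 ≤ B) (k : ℕ)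
    (hb : ∀ m : ℤ, m ≠ 0 → ‖b m‖ ≤ B / |(m : ℝ)| ^ (k + 2)) :
    truncGap b N N' ≤ 4000 * B / N ^ k := by
  have h1 : ∑ m ∈ Icc (-⌊N'⌋) ⌊N'⌋ \ Icc (-⌊N⌋) ⌊N⌋, ‖b m‖ ≤ B / N ^ k * 4 := by
    calc _ ≤ ∑ m ∈ Icc (-⌊N'⌋) ⌊N'⌋ \ Icc (-⌊N⌋) ⌊N⌋, B / N ^ k * (1 / |(m : ℝ)| ^ 2) := by
          refine sum_le_sum fun m hm => ?_
          have hm2 := (mem_sdiff.mp hm).2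
          have h2 : ⌊N⌋ < |m| := by
            by_contra hc
            exact hm2 (mem_Icc.mpr (abs_le.mp (not_lt.mp hc)))
          have h3 : N ≤ |(m : ℝ)| := by
            have := Int.floor_lt.mp h2
            rw [Int.cast_abs] at this
            exact this.le
          have hm0 : m ≠ 0 := by
            rintro rfl
            simp at h3; linarith
          refine (hb m hm0).trans ?_
          rw [pow_add, div_mul_div_comm, mul_one]
          have : 0 < |(m : ℝ)| := by positivity
          gcongr
      _ = B / N ^ k * ∑ m ∈ Icc (-⌊N'⌋) ⌊N'⌋ \ Icc (-⌊N⌋) ⌊N⌋, (1 / |(m : ℝ)| ^ 2) := by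
          rw [mul_sum]
      _ ≤ _ := by
          gcongr
          exact ((hasSum_int_inv_sq.summable).sum_le_tsum _ (fun _ _ => by positivity)).trans
            tsum_int_inv_sq_le
  unfold truncGap
  calc _ ≤ 1000 * (B / N ^ k * 4) := by gcongr
    _ = _ := by ring

theorem norm_trunc_le {b : ℤ → ℂ} {N B : ℝ} (hN : 0 < N) (hb0 : ‖b 0‖ ≤ B)
    (hb : ∀ m : ℤ, m ≠ 0 → ‖b m‖ ≤ B / |(m : ℝ)| ^ 2) {z : ℂ} (hz : z ∈ strip (1 / N)) :
    ‖trunc b N z‖ ≤ 5000 * B := by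
  have hB : 0 ≤ B := (norm_nonneg _).trans hb0
  have h1 : ∑ m ∈ Icc (-⌊N⌋) ⌊N⌋, ‖b m‖ ≤ 5 * B := by
    have h0 : (0 : ℤ) ∈ Icc (-⌊N⌋) ⌊N⌋ := by
      have : 0 ≤ ⌊N⌋ := Int.floor_nonneg.mpr hN.le
      simp [this]
    rw [← add_sum_erase _ _ h0]
    have h2 : ∑ m ∈ (Icc (-⌊N⌋) ⌊N⌋).erase 0, ‖b m‖ ≤ B * 4 := by
      calc _ ≤ ∑ m ∈ (Icc (-⌊N⌋) ⌊N⌋).erase 0, B * (1 / |(m : ℝ)| ^ 2) := by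
            refine sum_le_sum fun m hm => ?_
            exact (hb m (ne_of_mem_erase hm)).trans_eq (by ring)
        _ = B * ∑ m ∈ (Icc (-⌊N⌋) ⌊N⌋).erase 0, (1 / |(m : ℝ)| ^ 2) := by rw [mul_sum]
        _ ≤ _ := by
            gcongr
            exact ((hasSum_int_inv_sq.summable).sum_le_tsum _ (fun _ _ => by positivity)).trans
              tsum_int_inv_sq_le
    linarith
  calc _ ≤ ∑ m ∈ Icc (-⌊N⌋) ⌊N⌋, ‖b m‖ * 1000 := by
        refine (norm_sum_le _ _).trans (sum_le_sum fun m hm => ?_)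
        rw [norm_mul]
        gcongr
        exact norm_unitExp_int_mul_le hN hz hm
    _ = (∑ m ∈ Icc (-⌊N⌋) ⌊N⌋, ‖b m‖) * 1000 := by rw [sum_mul]
    _ ≤ _ := by linarith

theorem iteratedDeriv_ofReal_comp {w : ℝ → ℝ} (hw : ContDiff ℝ (⊤ : ℕ∞) w) (k : ℕ) :
    iteratedDeriv k (fun x => (w x : ℂ)) = fun x => ((iteratedDeriv k w x : ℝ) : ℂ) := by
  induction k with
  | zero => simp
  | succ k ih =>
    rw [iteratedDeriv_succ, ih]
    funext x
    have h1 : DifferentiableAt ℝ (iteratedDeriv k w) x :=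
      (hw.differentiable_iteratedDeriv k (by exact_mod_cast WithTop.coe_lt_top _)) x
    rw [(h1.hasDerivAt.ofReal_comp).deriv, iteratedDeriv_succ]

theorem iteratedDeriv_periodic {w : ℝ → ℝ} (hp : Function.Periodic w 1) (k : ℕ) :
    Function.Periodic (iteratedDeriv k w) 1 := by
  intro x
  rw [← congrFun (iteratedDeriv_comp_add_const k w (1 : ℝ)) x, funext hp]

theorem exists_iteratedDeriv_bound {w : ℝ → ℝ} (hw : ContDiff ℝ (⊤ : ℕ∞) w)
    (hp : Function.Periodic w 1) (k : ℕ) : ∃ B, ∀ x, ‖iteratedDeriv k w x‖ ≤ B := by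
  have hc : Continuous (iteratedDeriv k w) := hw.continuous_iteratedDeriv k (by exact_mod_cast le_top)
  obtain ⟨B, hB⟩ := (isCompact_Icc (a := (0 : ℝ)) (b := 1)).exists_bound_of_continuousOn hc.continuousOn
  refine ⟨B, fun x => ?_⟩
  obtain ⟨y, hy, hxy⟩ := (iteratedDeriv_periodic hp k).exists_mem_Ico₀ one_pos x
  rw [hxy]
  exact hB y ⟨hy.1, hy.2.le⟩

theorem norm_iteratedDeriv_le_Cnorm {w : ℝ → ℝ} (hw : ContDiff ℝ (⊤ : ℕ∞) w)
    (hp : Function.Periodic w 1) {k n : ℕ} (hk : k ≤ n) (x : ℝ) :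
    ‖iteratedDeriv k w x‖ ≤ Cnorm n w := by
  obtain ⟨B, hB⟩ := exists_iteratedDeriv_bound hw hp k
  have h1 : ‖iteratedDeriv k w x‖ ≤ ⨆ x, ‖iteratedDeriv k w x‖ :=
    le_ciSup (f := fun x => ‖iteratedDeriv k w x‖) ⟨B, by rintro _ ⟨y, rfl⟩; exact hB y⟩ x
  refine h1.trans ?_
  exact single_le_sum (f := fun h => ⨆ x, ‖iteratedDeriv h w x‖)
    (fun h _ => Real.iSup_nonneg fun _ => norm_nonneg _) (mem_range.mpr (by omega))

/-- The Fourier coefficients of a real function. -/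
noncomputable def realFc (w : ℝ → ℝ) (m : ℤ) : ℂ := fc (fun x => (w x : ℂ)) m

theorem realFc_neg {w : ℝ → ℝ} (hw : Continuous w) (m : ℤ) :
    realFc w (-m) = (starRingEnd ℂ) (realFc w m) := by
  have hcu : Continuous fun x : ℝ => unitExp (-(m * x)) * (w x : ℂ) := by
    have := continuous_unitExp; fun_prop
  unfold realFc fc
  have h1 : (starRingEnd ℂ) (∫ x in (0 : ℝ)..1, unitExp (-(m * x)) * (w x : ℂ)) =
      ∫ x in (0 : ℝ)..1, (starRingEnd ℂ) (unitExp (-(m * x)) * (w x : ℂ)) :=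
    (Complex.conjCLE.toContinuousLinearMap.intervalIntegral_comp_comm
      (hcu.intervalIntegrable 0 1)).symm
  rw [h1]
  refine intervalIntegral.integral_congr fun x _ => ?_
  simp [conj_unitExp]

theorem norm_realFc_le {w : ℝ → ℝ} (hw : ContDiff ℝ (⊤ : ℕ∞) w) (hp : Function.Periodic w 1) {B : ℝ}
    (k : ℕ) (hB : ∀ x, ‖iteratedDeriv k w x‖ ≤ B) {m : ℤ} (hm : m ≠ 0) :
    ‖realFc w m‖ ≤ B / |(m : ℝ)| ^ k := by
  refine norm_fc_le_of_iteratedDeriv (f := fun x => (w x : ℂ)) (Complex.ofRealCLM.contDiff.comp hw)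
    (fun x => by simp [hp x]) k (fun x => ?_) hm
  have := congrFun (iteratedDeriv_ofReal_comp hw k) x
  rw [this, Complex.norm_real]
  exact hB x

theorem norm_realFc_zero_le {w : ℝ → ℝ} {B : ℝ} (hB : ∀ x, ‖w x‖ ≤ B) : ‖realFc w 0‖ ≤ B := by
  unfold realFc fc
  refine norm_integral_unit_le fun x => ?_
  simpa [unitExp] using hB x

theorem tendsto_trunc {w : ℝ → ℝ} (hw : ContDiff ℝ (⊤ : ℕ∞) w) (hp : Function.Periodic w 1)
    {N : ℕ → ℝ} (hN : Tendsto N atTop atTop) (x : ℝ) :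
    Tendsto (fun i => trunc (realFc w) (N i) x) atTop (nhds (w x)) := by
  obtain ⟨B, hB⟩ := exists_iteratedDeriv_bound hw hp 2
  have hs : Summable (fc fun x => (w x : ℂ)) := by
    have h1 := hasSum_int_inv_sq.summable.mul_left B
    refine Summable.of_norm_bounded_eventually h1 ?_
    filter_upwards [eventually_cofinite_ne 0] with m hm
    exact (norm_realFc_le hw hp 2 hB hm).trans_eq (by ring)
  have h2 := hasSum_fc (f := fun x => (w x : ℂ)) (by have := hw.continuous; fun_prop)
    (fun x => by simp [hp x]) hs x
  have h3 : Tendsto (fun i => Icc (-⌊N i⌋) ⌊N i⌋) atTop atTop := by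
    refine tendsto_atTop.mpr fun s => ?_
    filter_upwards [hN.eventually_ge_atTop ((s.sup Int.natAbs : ℕ) : ℝ)] with i hi m hm
    have h4 : m.natAbs ≤ s.sup Int.natAbs := le_sup (f := Int.natAbs) hm
    have h5 : ((s.sup Int.natAbs : ℕ) : ℤ) ≤ ⌊N i⌋ := Int.le_floor.mpr (by exact_mod_cast hi)
    rw [mem_Icc]
    omega
  exact h2.comp h3

theorem exists_halvings_bound (K : ℕ) :
    ∃ C : ℝ, 0 ≤ C ∧ ∀ N : ℝ, 0 < N → (1 / 2) ^ halvings N * N ^ K ≤ C := by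
  have h1 := tendsto_pow_const_div_const_pow_of_one_lt (8 * K) (r := (2 : ℝ)) one_lt_two
  obtain ⟨C, hC⟩ := h1.bddAbove_range
  have hC' : ∀ n : ℕ, (n : ℝ) ^ (8 * K) / 2 ^ n ≤ C := fun n => hC ⟨n, rfl⟩
  have hC0 : 0 ≤ C := le_trans (by positivity) (hC' 0)
  refine ⟨2 * 64 ^ (8 * K) * C, by positivity, fun N hN => ?_⟩
  have h2 : N ^ (1 / 8 : ℝ) ≤ 64 * ((halvings N + 1 : ℕ) : ℝ) := by
    have := Nat.lt_floor_add_one (N ^ (1 / 8 : ℝ) / 64)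
    rw [div_lt_iff₀ (by norm_num)] at this
    push_cast
    unfold halvings
    linarith
  have h3 : N ^ K = (N ^ (1 / 8 : ℝ)) ^ (8 * K) := by
    rw [← Real.rpow_natCast, ← Real.rpow_natCast, ← Real.rpow_mul hN.le]
    congr 1
    push_cast; ring
  have h4 := hC' (halvings N + 1)
  rw [div_le_iff₀ (by positivity)] at h4
  calc (1 / 2) ^ halvings N * N ^ K
      ≤ (1 / 2) ^ halvings N * (64 * ((halvings N + 1 : ℕ) : ℝ)) ^ (8 * K) := by
        rw [h3]; gcongr
    _ = (1 / 2) ^ halvings N * 64 ^ (8 * K) * (((halvings N + 1 : ℕ) : ℝ)) ^ (8 * K) := by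
        rw [mul_pow]; ring
    _ ≤ (1 / 2) ^ halvings N * 64 ^ (8 * K) * (C * 2 ^ (halvings N + 1)) := by gcongr
    _ = ((1 / 2) ^ halvings N * 2 ^ halvings N) * (2 * 64 ^ (8 * K) * C) := by ring
    _ = _ := by rw [← mul_pow]; norm_num

/-- The bounds for the errors along the Newton iteration. -/
noncomputable def errSeq (N V : ℕ → ℝ) (e : ℝ) : ℕ → ℝ
  | 0 => e
  | i + 1 => N i ^ 5 * (errSeq N V e i ^ 2 + errSeq N V e i * (1 / 2) ^ halvings (N i)) + V i

/-- The bounds for the total displacement along the Newton iteration. -/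
noncomputable def sizeSeq (N V : ℕ → ℝ) (e : ℝ) : ℕ → ℝ
  | 0 => 0
  | i + 1 => sizeSeq N V e i + N i ^ 8 * errSeq N V e i

/-- A sequence of scales adapted to the Newton iteration. -/
structure ScaleSeq (N : ℕ → ℝ) : Prop where
  large : ∀ i, minScale ≤ N i
  lower : ∀ i, N i ^ (5 / 4 : ℝ) ≤ N (i + 1)
  upper : ∀ i, N (i + 1) ≤ N i ^ (3 / 2 : ℝ)
  halving : ∀ i, (1 / 2) ^ halvings (N i) ≤ 1 / N i ^ 30

section
variable {N V : ℕ → ℝ} {e : ℝ}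

theorem ScaleSeq.one_le (h : ScaleSeq N) (i : ℕ) : 1 ≤ N i :=
  le_trans (by norm_num) (le_minScale.trans (h.large i))

theorem ScaleSeq.pos (h : ScaleSeq N) (i : ℕ) : 0 < N i := lt_of_lt_of_le one_pos (h.one_le i)

theorem ScaleSeq.upper_pow (h : ScaleSeq N) (i M : ℕ) : N (i + 1) ^ (2 * M) ≤ N i ^ (3 * M) := by
  have h1 : N (i + 1) ^ (2 * M) ≤ (N i ^ (3 / 2 : ℝ)) ^ (2 * M) :=
    pow_le_pow_left₀ (h.pos _).le (h.upper i) _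
  refine h1.trans_eq ?_
  rw [← Real.rpow_natCast, ← Real.rpow_natCast, ← Real.rpow_mul (h.pos i).le]
  congr 1
  push_cast; ring

theorem ScaleSeq.eight_le (h : ScaleSeq N) (i : ℕ) : 8 * N i ≤ N (i + 1) := by
  refine le_trans ?_ (h.lower i)
  have h1 : N i ^ (5 / 4 : ℝ) = N i ^ (1 / 4 : ℝ) * N i := by
    nth_rewrite 3 [← Real.rpow_one (N i)]
    rw [← Real.rpow_add (h.pos i)]; norm_num
  rw [h1]
  have h2 : ((4 : ℝ) ^ 240) ^ (1 / 4 : ℝ) ≤ N i ^ (1 / 4 : ℝ) :=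
    Real.rpow_le_rpow (by positivity) (le_minScale.trans (h.large i)) (by norm_num)
  have h3 : ((4 : ℝ) ^ 240) ^ (1 / 4 : ℝ) = 4 ^ 60 := by
    rw [← Real.rpow_natCast 4 240, ← Real.rpow_mul (by norm_num)]; norm_num
  rw [h3] at h2
  have := h.pos i
  gcongr
  exact le_trans (by norm_num) h2

theorem ScaleSeq.growth (h : ScaleSeq N) (i : ℕ) : (4 : ℝ) ^ (30 * (i + 1)) ≤ N i :=
  scale_growth h.large h.lower i

theorem ScaleSeq.summable (h : ScaleSeq N) : Summable fun i => 1 / N i := by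
  have h1 : Summable fun i : ℕ => ((1 : ℝ) / 4) ^ i :=
    summable_geometric_of_lt_one (by norm_num) (by norm_num)
  refine Summable.of_nonneg_of_le (fun i => by have := h.pos i; positivity) (fun i => ?_) h1
  rw [one_div_pow]
  gcongr
  refine le_trans ?_ (h.growth i)
  exact pow_le_pow_right₀ (by norm_num) (by omega)

theorem ScaleSeq.tendsto (h : ScaleSeq N) : Tendsto N atTop atTop := by
  refine tendsto_atTop_mono (fun i => ?_)
    (tendsto_pow_atTop_atTop_of_one_lt (r := (4 : ℝ)) (by norm_num))
  refine le_trans ?_ (h.growth i)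
  exact pow_le_pow_right₀ (by norm_num) (by omega)

theorem errSeq_nonneg (h : ScaleSeq N) (hV : ∀ i, 0 ≤ V i) (he : 0 ≤ e) (i : ℕ) :
    0 ≤ errSeq N V e i := by
  induction i with
  | zero => exact he
  | succ i ih =>
    have := h.pos i
    have := hV i
    rw [errSeq]; positivity

theorem errSeq_le (h : ScaleSeq N) (hV : ∀ i, 0 ≤ V i) (he : 0 ≤ e) (he1 : e ≤ 1 / N 0 ^ 30)
    (hV1 : ∀ i, V i ≤ 1 / N i ^ 50) (i : ℕ) : errSeq N V e i ≤ 1 / N i ^ 30 := by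
  induction i with
  | zero => exact he1
  | succ i ih =>
    have h0 := h.pos i
    have hn := errSeq_nonneg h hV he i
    have h1000 : (1000 : ℝ) ≤ N i := le_trans (by norm_num) (le_minScale.trans (h.large i))
    calc errSeq N V e (i + 1)
        = N i ^ 5 * (errSeq N V e i ^ 2 + errSeq N V e i * (1 / 2) ^ halvings (N i)) + V i := rfl
      _ ≤ N i ^ 5 * ((1 / N i ^ 30) ^ 2 + 1 / N i ^ 30 * (1 / N i ^ 30)) + 1 / N i ^ 50 := by
          have := h.halving i
          have := hV1 i
          gcongr
      _ = (2 / N i ^ 10 + 1 / N i ^ 5) * (1 / N i ^ 45) := by field_simp; ring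
      _ ≤ 1 * (1 / N i ^ 45) := by
          gcongr
          have h5 : (1000 : ℝ) ≤ N i ^ 5 := h1000.trans (le_self_pow₀ (h.one_le i) (by norm_num))
          have h10 : (1000 : ℝ) ≤ N i ^ 10 := h1000.trans (le_self_pow₀ (h.one_le i) (by norm_num))
          have e5 : 1 / N i ^ 5 ≤ 1 / 1000 := by gcongr
          have e10 : 2 / N i ^ 10 ≤ 2 / 1000 := by gcongr
          linarith
      _ ≤ 1 / N (i + 1) ^ 30 := by
          rw [one_mul]
          have := h.pos (i + 1)
          gcongr
          exact h.upper_pow i 15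

theorem sizeSeq_le (h : ScaleSeq N) (hV : ∀ i, 0 ≤ V i) (he : 0 ≤ e) (he1 : e ≤ 1 / N 0 ^ 30)
    (hV1 : ∀ i, V i ≤ 1 / N i ^ 50) (i : ℕ) : sizeSeq N V e i ≤ 1 / 10000 := by
  suffices sizeSeq N V e i ≤ 1 / 10000 * (1 - 1 / 4 ^ i) by
    have : (0 : ℝ) ≤ 1 / 4 ^ i := by positivity
    linarith
  induction i with
  | zero => simp [sizeSeq]
  | succ i ih =>
    have h0 := h.pos i
    have h1 : N i ^ 8 * errSeq N V e i ≤ 1 / 4 ^ i * (1 / 4 ^ 30) := by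
      calc N i ^ 8 * errSeq N V e i ≤ N i ^ 8 * (1 / N i ^ 30) := by
            gcongr
            exact errSeq_le h hV he he1 hV1 i
        _ = 1 / N i ^ 22 := by field_simp
        _ ≤ 1 / N i := by
            gcongr
            exact le_self_pow₀ (h.one_le i) (by norm_num)
        _ ≤ 1 / 4 ^ (i + 30) := by
            gcongr
            refine le_trans ?_ (h.growth i)
            exact pow_le_pow_right₀ (by norm_num) (by omega)
        _ = _ := by rw [pow_add]; field_simp
    rw [sizeSeq]
    have h2 : (1 : ℝ) / 4 ^ (i + 1) = 1 / 4 ^ i * (1 / 4) := by rw [pow_succ]; field_simp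
    have h3 : (0 : ℝ) ≤ 1 / 4 ^ i := by positivity
    rw [h2]
    have h4 : (1 : ℝ) / 4 ^ i * (1 / 4 ^ 30) ≤ 1 / 4 ^ i * (1 / 20000) := by
      gcongr; norm_num
    linarith

theorem errSeq_rapid_even (h : ScaleSeq N) (hV : ∀ i, 0 ≤ V i) (he : 0 ≤ e)
    (he1 : e ≤ 1 / N 0 ^ 30) (hV1 : ∀ i, V i ≤ 1 / N i ^ 50)
    (hVr : ∀ K : ℕ, ∃ C, ∀ i, V i * N i ^ K ≤ C) (M : ℕ) (hM : 15 ≤ M) :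
    ∃ C : ℝ, ∀ i, errSeq N V e i * N i ^ (2 * M) ≤ C := by
  induction M, hM using Nat.le_induction with
  | base =>
    refine ⟨1, fun i => ?_⟩
    have h0 := h.pos i
    have := errSeq_le h hV he he1 hV1 i
    rwa [le_div_iff₀ (by positivity)] at this
  | succ M hM ih =>
    obtain ⟨C, hC⟩ := ih
    obtain ⟨D, hD0, hD⟩ := exists_halvings_bound (M + 8)
    obtain ⟨F, hF⟩ := hVr (3 * (M + 1))
    have hC0 : 0 ≤ C := le_trans (by
      have := errSeq_nonneg h hV he 0
      have := h.pos 0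
      positivity) (hC 0)
    have hF0 : 0 ≤ F := le_trans (by
      have := hV 0
      have := h.pos 0
      positivity) (hF 0)
    have hb0 : 0 ≤ e * N 0 ^ (2 * (M + 1)) := by
      have := h.pos 0
      positivity
    refine ⟨e * N 0 ^ (2 * (M + 1)) + (C ^ 2 + C * D + F), fun i => ?_⟩
    rcases i with _ | i
    · rw [errSeq]
      have : 0 ≤ C ^ 2 + C * D + F := by positivity
      linarith
    · have h0 := h.pos i
      have hn := errSeq_nonneg h hV he i
      have hn' := errSeq_nonneg h hV he (i + 1)
      refine le_trans ?_ (le_add_of_nonneg_left hb0)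
      calc errSeq N V e (i + 1) * N (i + 1) ^ (2 * (M + 1))
          ≤ errSeq N V e (i + 1) * N i ^ (3 * (M + 1)) := by
            gcongr
            exact h.upper_pow i (M + 1)
        _ = errSeq N V e i ^ 2 * N i ^ (3 * M + 8) +
            errSeq N V e i * N i ^ (2 * M) * ((1 / 2) ^ halvings (N i) * N i ^ (M + 8)) +
            V i * N i ^ (3 * (M + 1)) := by
            rw [errSeq]; ring
        _ ≤ errSeq N V e i ^ 2 * N i ^ (2 * M * 2) + C * D + F := by
            have := hC i
            have := hF i
            have := hD (N i) h0
            gcongr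
            · exact h.one_le i
            · omega
        _ = (errSeq N V e i * N i ^ (2 * M)) ^ 2 + C * D + F := by
            rw [mul_pow, ← pow_mul]
        _ ≤ _ := by
            have := hC i
            gcongr

theorem errSeq_rapid (h : ScaleSeq N) (hV : ∀ i, 0 ≤ V i) (he : 0 ≤ e)
    (he1 : e ≤ 1 / N 0 ^ 30) (hV1 : ∀ i, V i ≤ 1 / N i ^ 50)
    (hVr : ∀ K : ℕ, ∃ C, ∀ i, V i * N i ^ K ≤ C) (K : ℕ) :
    ∃ C : ℝ, ∀ i, N i ^ K * errSeq N V e i ≤ C * (1 / N i) := by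
  obtain ⟨C, hC⟩ := errSeq_rapid_even h hV he he1 hV1 hVr (K + 15) (by omega)
  refine ⟨C, fun i => ?_⟩
  have h0 := h.pos i
  have hn := errSeq_nonneg h hV he i
  rw [mul_one_div, le_div_iff₀ h0]
  refine le_trans ?_ (hC i)
  calc N i ^ K * errSeq N V e i * N i = errSeq N V e i * N i ^ (K + 1) := by ring
    _ ≤ _ := by
      gcongr
      · exact h.one_le i
      · omega

end

theorem iteratedDeriv_ofReal {f : ℂ → ℂ} {h : ℝ} (hh : 0 < h) (hf : DifferentiableOn ℂ f (strip h))
    (k : ℕ) : (iteratedDeriv k fun y : ℝ => f y) = fun x : ℝ => iteratedDeriv k f x := by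
  induction k with
  | zero => rfl
  | succ k ih =>
    rw [iteratedDeriv_succ, ih]
    funext x
    have h1 : AnalyticAt ℂ f x :=
      hf.analyticAt ((isOpen_strip h).mem_nhds (ofReal_mem_strip hh x))
    have h2 := (h1.iterated_deriv k).differentiableAt
    rw [← iteratedDeriv_eq_iterate] at h2
    rw [iteratedDeriv_succ]
    exact h2.hasDerivAt.comp_ofReal.deriv

theorem contDiff_ofReal_of_strip {f : ℂ → ℂ} {h : ℝ} (hh : 0 < h)
    (hf : DifferentiableOn ℂ f (strip h)) : ContDiff ℝ (⊤ : ℕ∞) fun x : ℝ => f x := by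
  rw [contDiff_iff_contDiffAt]
  intro x
  have h1 : AnalyticAt ℂ f x :=
    hf.analyticAt ((isOpen_strip h).mem_nhds (ofReal_mem_strip hh x))
  have h2 : ContDiffAt ℝ (⊤ : ℕ∞) f x := (h1.contDiffAt (n := (⊤ : ℕ∞))).restrict_scalars ℝ
  exact h2.comp x Complex.ofRealCLM.contDiff.contDiffAt

theorem norm_iteratedFDeriv_ofReal_le {f : ℂ → ℂ} {h b : ℝ} (hh : 0 < h)
    (hf : DifferentiableOn ℂ f (strip h)) (hb : ∀ x ∈ strip h, ‖f x‖ ≤ b) (k : ℕ) (x : ℝ) :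
    ‖iteratedFDeriv ℝ k (fun y : ℝ => f y) x‖ ≤ k.factorial * b / (h / 2) ^ k := by
  rw [norm_iteratedFDeriv_eq_norm_iteratedDeriv, iteratedDeriv_ofReal hh hf]
  have h1 : Metric.closedBall (x : ℂ) (h / 2) ⊆ strip h := by
    intro z hz
    rw [Metric.mem_closedBall, Complex.dist_eq] at hz
    have := (Complex.abs_im_le_norm (z - x)).trans hz
    rw [Complex.sub_im, Complex.ofReal_im, sub_zero] at this
    rw [mem_strip]
    linarith
  refine Complex.norm_iteratedDeriv_le_of_forall_mem_sphere_norm_le k (by positivity) ?_ ?_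
  · exact (hf.mono h1).diffContOnCl_ball subset_rfl
  · exact fun z hz => hb z (h1 (Metric.sphere_subset_closedBall hz))

/-- The constant `exp (iρ)` is an approximate section with energy `2 cos ρ`. -/
theorem ApproxSection.const (α : ℝ) {ρ N e : ℝ} {v : ℂ → ℂ} (hρ : ρ ∈ Set.Ioo (1 : ℝ) 2)
    (he : 0 ≤ e) (hv : ∀ x ∈ strip (1 / N), ‖v x‖ ≤ e) :
    ApproxSection α ρ N 0 e (2 * Real.cos ρ) v fun _ => Complex.exp (Complex.I * ρ) where
  diff := differentiableOn_const _
  per := fun _ => rfl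
  near := fun x _ => by simp
  err := fun x hx => by
    have h1 : Complex.exp (Complex.I * ρ) + 1 / Complex.exp (Complex.I * ρ) = 2 * Complex.cos ρ := by
      rw [one_div, ← Complex.exp_neg, Complex.two_cos]
      congr 2 <;> ring
    have h2 : Complex.exp (Complex.I * ρ) + 1 / Complex.exp (Complex.I * ρ) + v x
        - ((2 * Real.cos ρ : ℝ) : ℂ) = v x := by
      rw [h1]; push_cast; ring
    rw [h2]
    exact hv x hx
  drift := by
    simp only [log_center hρ]
    simpa using he
  decay := by
    intro m hm
    have h1 := fc_deriv (f := fun x : ℝ => phase (fun _ => Complex.exp (Complex.I * ρ)) x)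
      (f' := fun _ => 0) (fun x => hasDerivAt_const _ _) continuous_const (fun x => rfl) m
    have h2 : fc (fun _ : ℝ => (0 : ℂ)) m = 0 := by simp [fc]
    rw [h2] at h1
    have h3 : fc (fun x : ℝ => phase (fun _ => Complex.exp (Complex.I * ρ)) x) m = 0 := by
      have hm' : (m : ℂ) ≠ 0 := by exact_mod_cast hm
      simpa [hm'] using h1
    rw [h3]
    simp

/-- A sequence of approximate sections produced by the Newton iteration. -/
structure SectionSeq (α ρ : ℝ) (N V : ℕ → ℝ) (e : ℝ) (v : ℕ → ℂ → ℂ) (z : ℕ → ℂ → ℂ)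
    (E : ℕ → ℝ) : Prop where
  approx : ∀ i, ApproxSection α ρ (N i) (sizeSeq N V e i) (errSeq N V e i) (E i) (v i) (z i)
  step : ∀ i, ∀ x ∈ strip (1 / (2 * N i)), ‖z (i + 1) x - z i x‖ ≤ N i ^ 2 * errSeq N V e i
  energy : ∀ i, |E (i + 1) - E i| ≤ 7 * errSeq N V e i

theorem exists_sectionSeq {α ρ e : ℝ} {N V : ℕ → ℝ} {r : ℕ → ℚ} {v : ℕ → ℂ → ℂ}
    (h : ScaleSeq N) (hg : ∀ i, GoodScale α (N i) (r i)) (hρ : ρ ∈ goodFreq r)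
    (hv : ∀ i, Differentiable ℂ (v i)) (hvp : ∀ i x, v i (x + 1) = v i x)
    (hvr : ∀ i x, reflect (v i) x = v i x) (hV : ∀ i, 0 ≤ V i) (hV1 : ∀ i, V i ≤ 1 / N i ^ 50)
    (hvV : ∀ i, ∀ x ∈ strip (1 / N (i + 1)), ‖v (i + 1) x - v i x‖ ≤ V i)
    (he : 0 ≤ e) (he1 : e ≤ 1 / N 0 ^ 30) (hv0 : ∀ x ∈ strip (1 / N 0), ‖v 0 x‖ ≤ e) :
    ∃ z E, SectionSeq α ρ N V e v z E := by
  let P : ℕ → (ℂ → ℂ) × ℝ → Prop := fun i p =>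
    ApproxSection α ρ (N i) (sizeSeq N V e i) (errSeq N V e i) p.2 (v i) p.1
  have hstep : ∀ i, ∀ p : {p // P i p}, ∃ q : {q // P (i + 1) q},
      (∀ x ∈ strip (1 / (2 * N i)), ‖q.1.1 x - p.1.1 x‖ ≤ N i ^ 2 * errSeq N V e i) ∧
        |q.1.2 - p.1.2| ≤ 7 * errSeq N V e i := by
    rintro i ⟨p, hp⟩
    obtain ⟨z', E', h1, h2, h3⟩ := ApproxSection.newton hp hρ.1 (h.large i) (hg i) (hρ.2 i) (hv i)
      (hvp i) (hvr i) (sizeSeq_le h hV he he1 hV1 i) (errSeq_le h hV he he1 hV1 i) (h.eight_le i)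
      (hvV i)
    exact ⟨⟨(z', E'), h1⟩, h2, h3⟩
  choose next hnext1 hnext2 using hstep
  let s : ∀ i, {p // P i p} := fun i => Nat.rec
    ⟨(fun _ => Complex.exp (Complex.I * ρ), 2 * Real.cos ρ), ApproxSection.const α hρ.1 he hv0⟩
    (fun i p => next i p) i
  exact ⟨fun i => (s i).1.1, fun i => (s i).1.2, fun i => (s i).2, fun i => hnext1 i (s i),
    fun i => hnext2 i (s i)⟩

/-- A smooth exact invariant section with rotation number `ρ`, close to a constant. -/
structure SmoothSection (α ρ E : ℝ) (w : ℝ → ℝ) (z : ℝ → ℂ) : Prop where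
  smooth : ContDiff ℝ (⊤ : ℕ∞) z
  per : Function.Periodic z 1
  near : ∀ x, z x ∈ nearDisc ρ
  eq : ∀ x, z (x + α) + 1 / z x = E - w x
  rot : ∫ x in (0 : ℝ)..1, (Complex.log (z x)).im = ρ

theorem SectionSeq.exists_limit {α ρ e : ℝ} {N V : ℕ → ℝ} {v : ℕ → ℂ → ℂ} {w : ℝ → ℝ}
    {z : ℕ → ℂ → ℂ} {E : ℕ → ℝ} (H : SectionSeq α ρ N V e v z E) (hρ : ρ ∈ Set.Ioo (1 : ℝ) 2)
    (h : ScaleSeq N) (hV : ∀ i, 0 ≤ V i) (he : 0 ≤ e)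
    (he1 : e ≤ 1 / N 0 ^ 30) (hV1 : ∀ i, V i ≤ 1 / N i ^ 50)
    (hVr : ∀ K : ℕ, ∃ C, ∀ i, V i * N i ^ K ≤ C)
    (hvw : ∀ x : ℝ, Tendsto (fun i => v i x) atTop (nhds (w x : ℂ))) :
    ∃ (F : ℝ) (Z : ℝ → ℂ), SmoothSection α ρ F w Z := by
  have hs : Summable fun i => 1 / N i := h.summable
  have hrapid := errSeq_rapid h hV he he1 hV1 hVr
  have hn := errSeq_nonneg h hV he
  have hpow : ∀ i K, N (i + 1) ^ K ≤ N i ^ (2 * K) := by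
    intro i K
    have h1 := h.upper i
    have h2 : N i ^ (3 / 2 : ℝ) ≤ N i ^ 2 := by
      rw [← Real.rpow_natCast]
      exact Real.rpow_le_rpow_of_exponent_le (h.one_le i) (by norm_num)
    rw [pow_mul]
    exact pow_le_pow_left₀ (h.pos _).le (h1.trans h2) K
  have hzd : ∀ i, ContDiff ℝ (⊤ : ℕ∞) fun x : ℝ => z i x := fun i =>
    contDiff_ofReal_of_strip (one_div_pos.2 (h.pos i)) (H.approx i).diff
  have hbound : ∀ (k i : ℕ) (x : ℝ),
      ‖iteratedFDeriv ℝ k (fun y : ℝ => z (i + 1) y - z i y) x‖ ≤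
        k.factorial * 2 ^ k * (N i ^ (2 * k + 2) * errSeq N V e i) := by
    intro k i x
    have h0 := h.pos i
    have h1 := h.pos (i + 1)
    have h8 := h.eight_le i
    have m1 : 1 / N (i + 1) ≤ 1 / N i := by gcongr; linarith
    have m2 : 1 / N (i + 1) ≤ 1 / (2 * N i) := by gcongr; linarith
    refine (norm_iteratedFDeriv_ofReal_le (f := fun y => z (i + 1) y - z i y)
      (one_div_pos.2 (h.pos (i + 1)))
      ((H.approx (i + 1)).diff.sub ((H.approx i).diff.mono (strip_mono m1)))
      (fun y hy => H.step i y (strip_mono m2 hy)) k x).trans ?_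
    have e1 : (1 / N (i + 1) / 2) ^ k = 1 / (2 ^ k * N (i + 1) ^ k) := by
      rw [div_div, div_pow, one_pow, mul_comm, mul_pow]
    rw [e1, div_div_eq_mul_div, div_one]
    have h2 := hpow i k
    have h3 := hn i
    calc (k.factorial : ℝ) * (N i ^ 2 * errSeq N V e i) * (2 ^ k * N (i + 1) ^ k)
        ≤ k.factorial * (N i ^ 2 * errSeq N V e i) * (2 ^ k * N i ^ (2 * k)) := by gcongr
      _ = _ := by ring
  have hsum : ∀ k : ℕ, Summable fun i =>
      (k.factorial * 2 ^ k : ℝ) * (N i ^ (2 * k + 2) * errSeq N V e i) := by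
    intro k
    obtain ⟨C, hC⟩ := hrapid (2 * k + 2)
    refine Summable.mul_left _ (Summable.of_nonneg_of_le (fun i => ?_) hC (hs.mul_left C))
    have := hn i
    have := h.pos i
    positivity
  have herr : Tendsto (fun i => errSeq N V e i) atTop (nhds 0) := by
    obtain ⟨C, hC⟩ := hrapid 0
    refine squeeze_zero hn (fun i => ?_) (by simpa using hs.tendsto_atTop_zero.const_mul C)
    simpa using hC i
  have hEs : Summable fun i => 7 * errSeq N V e i := by
    obtain ⟨C, hC⟩ := hrapid 0
    refine Summable.mul_left _ (Summable.of_nonneg_of_le hn (fun i => ?_) (hs.mul_left C))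
    simpa using hC i
  obtain ⟨F, hF⟩ : ∃ F, Tendsto E atTop (nhds F) := by
    refine cauchySeq_tendsto_of_complete (cauchySeq_of_dist_le_of_summable _ (fun i => ?_) hEs)
    rw [dist_comm, Real.dist_eq]
    exact H.energy i
  let Z : ℝ → ℂ := fun x => z 0 x + ∑' i, (z (i + 1) x - z i x)
  have hZs : ContDiff ℝ (⊤ : ℕ∞) Z :=
    (hzd 0).add (contDiff_tsum (fun i => (hzd (i + 1)).sub (hzd i)) (fun k _ => hsum k)
      fun k i x _ => hbound k i x)
  have hZ : ∀ x : ℝ, Tendsto (fun i => z i x) atTop (nhds (Z x)) := by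
    intro x
    have h1 : Summable fun i => z (i + 1) (x : ℂ) - z i x := by
      refine Summable.of_norm_bounded (hsum 0) fun i => ?_
      simpa using hbound 0 i x
    have h2 := (h1.hasSum.tendsto_sum_nat).const_add (z 0 x)
    refine h2.congr fun n => ?_
    rw [Finset.sum_range_sub (fun i => z i (x : ℂ))]
    ring
  have hmem : ∀ i (x : ℝ), z i x ∈ nearDisc ρ := fun i x =>
    (H.approx i).mem_nearDisc ((sizeSeq_le h hV he he1 hV1 i).trans (by norm_num))
      (ofReal_mem_strip (one_div_pos.2 (h.pos i)) x)
  have hnear : ∀ x, Z x ∈ nearDisc ρ := fun x =>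
    Metric.isClosed_closedBall.mem_of_tendsto (hZ x) (Eventually.of_forall fun i => hmem i x)
  refine ⟨F, Z, hZs, fun x => ?_, hnear, fun x => ?_, ?_⟩
  · refine tendsto_nhds_unique (hZ (x + 1)) ((hZ x).congr fun i => ?_)
    push_cast
    exact ((H.approx i).per x).symm
  · have h1 : Tendsto (fun i => z i (x + α) + 1 / z i x + v i x - E i) atTop
        (nhds (Z (x + α) + 1 / Z x + w x - F)) := by
      have h2 := hZ (x + α)
      push_cast at h2
      have h3 : Tendsto (fun i => 1 / z i x) atTop (nhds (1 / Z x)) :=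
        tendsto_const_nhds.div (hZ x) (nearDisc_ne_zero (hnear x))
      have h4 : Tendsto (fun i => (E i : ℂ)) atTop (nhds F) :=
        (Complex.continuous_ofReal.tendsto F).comp hF
      exact ((h2.add h3).add (hvw x)).sub h4
    have h2 : Tendsto (fun i => z i (x + α) + 1 / z i x + v i x - E i) atTop (nhds 0) :=
      squeeze_zero_norm (fun i =>
        (H.approx i).err x (ofReal_mem_strip (one_div_pos.2 (h.pos i)) x)) herr
    have h3 := tendsto_nhds_unique h1 h2
    linear_combination h3
  · have hlog : ∀ x : ℝ, Tendsto (fun i => (Complex.log (z i x)).im) atTop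
        (nhds (Complex.log (Z x)).im) := fun x =>
      (Complex.continuous_im.tendsto _).comp
        (((continuousAt_clog (nearDisc_slit hρ (hnear x))).tendsto).comp (hZ x))
    have h1 : Tendsto (fun i => ∫ x in (0 : ℝ)..1, (Complex.log (z i x)).im) atTop
        (nhds (∫ x in (0 : ℝ)..1, (Complex.log (Z x)).im)) := by
      refine intervalIntegral.tendsto_integral_filter_of_dominated_convergence (fun _ => π)
        (Eventually.of_forall fun i => ?_) (Eventually.of_forall fun i => ?_) (by simp)
        (Eventually.of_forall fun x _ => hlog x)
      · exact (Complex.measurable_im.comp (Complex.measurable_log.comp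
          (hzd i).continuous.measurable)).aestronglyMeasurable
      · refine Eventually.of_forall fun x _ => ?_
        rw [Complex.log_im, Real.norm_eq_abs]
        exact Complex.abs_arg_le_pi _
    have h2 : Tendsto (fun i => (∫ x in (0 : ℝ)..1, (Complex.log (z i x)).im) - ρ) atTop
        (nhds 0) := squeeze_zero_norm (fun i => (H.approx i).drift) herr
    have h3 := tendsto_nhds_unique (h1.sub_const ρ) h2
    linarith

theorem exists_smoothSections {n : ℕ} (hn : 52 ≤ n) :
    ∃ ε : ℝ, 0 < ε ∧ ∀ α : ℝ, Irrational α → ∀ w : ℝ → ℝ, ContDiff ℝ (⊤ : ℕ∞) w →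
      Function.Periodic w 1 → Cnorm n w < ε →
      ∃ r : ℕ → ℚ, 0 < volume (goodFreq r) ∧
        ∀ ρ ∈ goodFreq r, ∃ (F : ℝ) (Z : ℝ → ℂ), SmoothSection α ρ F w Z := by
  obtain ⟨C, hC0, hC⟩ := exists_halvings_bound 31
  set L := max minScale C with hL
  have hL1 : 1 ≤ L := le_trans (le_trans (by norm_num) le_minScale) (le_max_left _ _)
  set U := 2 * L ^ (7 / 6 : ℝ) with hU
  have hU1 : 1 ≤ U := by
    have := Real.one_le_rpow hL1 (z := 7 / 6) (by norm_num)
    linarith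
  have hU0 : 0 < U := by linarith
  refine ⟨1 / (5000 * U ^ 30), by positivity, fun α hα w hw hp hwn => ?_⟩
  set ε := 1 / (5000 * U ^ 30) with hε
  have hε0 : 0 < ε := by positivity
  have hεe : 5000 * ε = 1 / U ^ 30 := by rw [hε]; field_simp
  have hε1 : 5000 * ε ≤ 1 := by
    rw [hεe, div_le_one (by positivity)]
    exact one_le_pow₀ hU1
  obtain ⟨N, r, -, hN0, hg, hLN, hlow, hup⟩ := exists_scale_seq hα (le_max_left _ _ : minScale ≤ L)
  have hmin : ∀ i, minScale ≤ N i := fun i => (le_max_left _ _).trans (hLN i)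
  have hscale : ScaleSeq N := by
    refine ⟨hmin, hlow, hup, fun i => ?_⟩
    have h0 : 0 < N i := by linarith [hLN i]
    have h1 := hC (N i) h0
    have h2 : C ≤ N i := (le_max_right _ _).trans (hLN i)
    rw [le_div_iff₀ (by positivity)]
    have h3 : (1 / 2) ^ halvings (N i) * N i ^ 30 * N i ≤ 1 * N i := by
      calc (1 / 2) ^ halvings (N i) * N i ^ 30 * N i = (1 / 2) ^ halvings (N i) * N i ^ 31 := by ring
        _ ≤ 1 * N i := by linarith
    exact le_of_mul_le_mul_right h3 h0
  refine ⟨r, volume_goodFreq_pos hmin hlow hg, fun ρ hρ => ?_⟩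
  have hder : ∀ k ≤ n, ∀ x, ‖iteratedDeriv k w x‖ ≤ ε := fun k hk x =>
    (norm_iteratedDeriv_le_Cnorm hw hp hk x).trans hwn.le
  have hb : ∀ k ≤ n, ∀ m : ℤ, m ≠ 0 → ‖realFc w m‖ ≤ ε / |(m : ℝ)| ^ k := fun k hk m hm =>
    norm_realFc_le hw hp k (hder k hk) hm
  have hb0 : ‖realFc w 0‖ ≤ ε := norm_realFc_zero_le (by simpa using hder 0 (by omega))
  have hNmono : ∀ i, N i ≤ N (i + 1) := fun i => by
    have := hscale.eight_le i
    have := hscale.pos i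
    linarith
  let V : ℕ → ℝ := fun i => truncGap (realFc w) (N i) (N (i + 1))
  have hV : ∀ i, 0 ≤ V i := fun i => truncGap_nonneg _ _ _
  have hV1 : ∀ i, V i ≤ 1 / N i ^ 50 := fun i => by
    have h0 := hscale.pos i
    refine (truncGap_le (N (i + 1)) h0 hε0.le 50 (hb 52 hn)).trans ?_
    gcongr
    linarith
  have hVr : ∀ K : ℕ, ∃ D, ∀ i, V i * N i ^ K ≤ D := fun K => by
    obtain ⟨B, hB⟩ := exists_iteratedDeriv_bound hw hp (K + 2)
    have hB0 : 0 ≤ B := (norm_nonneg _).trans (hB 0)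
    refine ⟨4000 * B, fun i => ?_⟩
    have h0 := hscale.pos i
    have h1 := truncGap_le (N (i + 1)) h0 hB0 K (fun m hm => norm_realFc_le hw hp (K + 2) hB hm)
    rwa [le_div_iff₀ (by positivity)] at h1
  have he1 : 5000 * ε ≤ 1 / N 0 ^ 30 := by
    have h0 := hscale.pos 0
    rw [hεe]
    gcongr
  obtain ⟨z, E, H⟩ := exists_sectionSeq (v := fun i => trunc (realFc w) (N i)) hscale hg hρ
    (fun i => trunc_differentiable _ _) (fun i => trunc_periodic _ _)
    (fun i => trunc_reflect (realFc_neg hw.continuous) _) hV hV1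
    (fun i x hx => norm_trunc_sub_le _ (hscale.pos _) (hNmono i) hx) (by positivity) he1
    (fun x hx => norm_trunc_le (hscale.pos 0) hb0 (hb 2 (by omega)) hx)
  exact H.exists_limit hρ.1 hscale hV (by positivity) he1 hV1 hVr
    fun x => tendsto_trunc hw hp hscale.tendsto x

theorem schrodinger_conj {X s n : ℝ} (hs : 0 < s) (hn : 0 < n) (h : n ^ 2 = X ^ 2 + s ^ 4) (t : ℝ) :
    !![1 / (s / n), -(t - X / n ^ 2) / (s / n); 0, s / n] * !![t, -1; 1, 0] *
      !![s, X / s; 0, 1 / s] = !![X / n, -(s ^ 2 / n); s ^ 2 / n, X / n] := by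
  have h0 : -(1 / (s / n)) * (1 / s) = (X ^ 2 / n ^ 2 - 1) * (n / s ^ 2) - X ^ 2 / (n * s ^ 2) := by
    field_simp; ring
  have h1 : (X ^ 2 / n ^ 2 - 1) * (n / s ^ 2) = -(s ^ 2 / n) := by
    have : X ^ 2 / n ^ 2 - 1 = -s ^ 4 / n ^ 2 := by
      field_simp; linarith
    rw [this]; field_simp
  ext i j
  fin_cases i <;> fin_cases j
  · simp [Matrix.mul_apply, Fin.sum_univ_two]
    field_simp
    ring
  · rw [h1] at h0
    simp [Matrix.mul_apply, Fin.sum_univ_two]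
    field_simp at h0 ⊢
    linear_combination h0
  · simp [Matrix.mul_apply, Fin.sum_univ_two]
    field_simp
  · simp [Matrix.mul_apply, Fin.sum_univ_two]
    field_simp

theorem RotationsReducible.of_section {α E : ℝ} {v : ℝ → ℝ} {z : ℝ → ℂ}
    (hz : ContDiff ℝ (⊤ : ℕ∞) z) (hp : Function.Periodic z 1) (hpos : ∀ x, 0 < (z x).im)
    (heq : ∀ x, z (x + α) + 1 / z x = E - v x) : RotationsReducible α (schrodingerCocycle v E) := by
  have hX : ContDiff ℝ (⊤ : ℕ∞) fun x => (z x).re := Complex.reCLM.contDiff.comp hz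
  have hY : ContDiff ℝ (⊤ : ℕ∞) fun x => (z x).im := Complex.imCLM.contDiff.comp hz
  have hS : ContDiff ℝ (⊤ : ℕ∞) fun x => √(z x).im := hY.sqrt fun x => (hpos x).ne'
  have hS0 : ∀ x, 0 < √(z x).im := fun x => Real.sqrt_pos.2 (hpos x)
  refine ⟨fun x => !![1 / √(z x).im, -(z x).re / √(z x).im; 0, √(z x).im], ?_, ?_, ?_, ?_⟩
  · have h1 : (fun x => !![1 / √(z x).im, -(z x).re / √(z x).im; 0, √(z x).im]) =
        fun x => (1 / √(z x).im) • !![(1 : ℝ), 0; 0, 0] +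
          (-(z x).re / √(z x).im) • !![(0 : ℝ), 1; 0, 0] + √(z x).im • !![(0 : ℝ), 0; 0, 1] := by
      funext x
      ext i j
      fin_cases i <;> fin_cases j <;> simp
    rw [h1]
    have h2 := contDiff_const (𝕜 := ℝ) (E := ℝ) (n := ((⊤ : ℕ∞) : WithTop ℕ∞)) (c := (1 : ℝ))
    exact (((h2.div hS fun x => (hS0 x).ne').smul contDiff_const).add
      ((hX.neg.div hS fun x => (hS0 x).ne').smul contDiff_const)).add (hS.smul contDiff_const)
  · intro x
    have : z (x + 2) = z x := by
      rw [← hp x, ← hp (x + 1)]; ring_nf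
    simp only [this]
  · intro x
    have := (hS0 x).ne'
    rw [Matrix.det_fin_two_of]
    field_simp
    simp
  · intro x
    refine ⟨(z x).arg / (2 * π), ?_⟩
    have hz0 : z x ≠ 0 := fun h => by have := hpos x; simp [h] at this
    set X := (z x).re with hXd
    set Y := (z x).im with hYd
    have hYpos : 0 < Y := hpos x
    have hn2 : ‖z x‖ ^ 2 = X ^ 2 + Y ^ 2 := by
      rw [Complex.sq_norm, Complex.normSq_apply]; ring
    have hnp : 0 < ‖z x‖ := norm_pos_iff.2 hz0
    have hre : (z (x + α)).re = E - v x - X / ‖z x‖ ^ 2 := by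
      have := congrArg Complex.re (heq x)
      simp only [Complex.add_re, one_div, Complex.inv_re, Complex.normSq_eq_norm_sq, Complex.sub_re,
        Complex.ofReal_re] at this
      linarith
    have him : (z (x + α)).im = Y / ‖z x‖ ^ 2 := by
      have := congrArg Complex.im (heq x)
      simp only [Complex.add_im, one_div, Complex.inv_im, Complex.normSq_eq_norm_sq, Complex.sub_im,
        Complex.ofReal_im, neg_div] at this
      linarith
    have hsq : √(z (x + α)).im = √Y / ‖z x‖ := by
      rw [him, Real.sqrt_div hYpos.le, Real.sqrt_sq hnp.le]
    have hSY : √Y ^ 2 = Y := Real.sq_sqrt hYpos.le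
    have hS : 0 < √Y := Real.sqrt_pos.2 hYpos
    have hinv : (!![1 / √Y, -X / √Y; 0, √Y])⁻¹ = !![√Y, X / √Y; 0, 1 / √Y] := by
      refine Matrix.inv_eq_right_inv ?_
      ext i j
      fin_cases i <;> fin_cases j <;> simp [Matrix.mul_apply, Fin.sum_univ_two] <;>
        field_simp <;> simp
    have hang : 2 * π * ((z x).arg / (2 * π)) = (z x).arg := by
      have := Real.pi_pos
      field_simp
    have hS4 : ‖z x‖ ^ 2 = X ^ 2 + √Y ^ 4 := by
      rw [hn2]; nth_rewrite 1 [← hSY]; ring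
    rw [Rot, hang, Complex.cos_arg hz0, Complex.sin_arg, hinv]
    beta_reduce
    rw [hre, hsq, schrodingerCocycle, ← hXd, ← hYd]
    have h := schrodinger_conj hS hnp hS4 (E - v x)
    rwa [hSY] at h

theorem nearDisc_abs_arg_sub_le {ρ : ℝ} (hρ : ρ ∈ Set.Ioo (1 : ℝ) 2) {z : ℂ} (hz : z ∈ nearDisc ρ) :
    |z.arg - ρ| ≤ 1 / 5 := by
  have h1 := norm_log_sub_le hρ (center_mem_nearDisc ρ) hz
  rw [log_center hρ] at h1
  have h2 := (Complex.abs_im_le_norm _).trans h1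
  have h3 : ‖z - Complex.exp (Complex.I * ρ)‖ ≤ 1 / 10 := by
    rwa [nearDisc, Metric.mem_closedBall, Complex.dist_eq] at hz
  simp only [Complex.sub_im, Complex.log_im, Complex.mul_im, Complex.I_re, Complex.I_im,
    Complex.ofReal_im, Complex.ofReal_re] at h2
  norm_num at h2
  linarith

theorem exists_arg_shift {ρ ρ' Δ : ℝ} (hρ : ρ ∈ Set.Ioo (1 : ℝ) 2) (hρ' : ρ' ∈ Set.Ioo (1 : ℝ) 2)
    (hΔ : |Δ| ≤ 1 / 2) {z z' u : ℂ} (hz : z ∈ nearDisc ρ) (hz' : z' ∈ nearDisc ρ') (hu : 0 < u.im)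
    (huw : u = Δ + (z' - (starRingEnd ℂ) z) / (z' * (starRingEnd ℂ) z)) :
    |u.arg - (z' - (starRingEnd ℂ) z).arg + (z'.arg - z.arg)| ≤ 2 * |Δ| := by
  set W := z' - (starRingEnd ℂ) z with hW
  have hWim : 7 / 5 ≤ W.im := by
    have := nearDisc_im hρ hz
    have := nearDisc_im hρ' hz'
    simp only [hW, Complex.sub_im, Complex.conj_im]
    linarith
  have hW0 : W ≠ 0 := fun h => by rw [h] at hWim; norm_num at hWim
  have hWn : 7 / 5 ≤ ‖W‖ := hWim.trans ((le_abs_self _).trans (Complex.abs_im_le_norm W))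
  have hz0 := nearDisc_ne_zero hz
  have hz0' := nearDisc_ne_zero hz'
  have hzc : (starRingEnd ℂ) z ≠ 0 := by simpa using hz0
  have hu0 : u ≠ 0 := fun h => by simp [h] at hu
  set δ := Δ * (z' * (starRingEnd ℂ) z) / W with hδ
  have hδn : ‖δ‖ ≤ 9 / 10 * |Δ| := by
    rw [hδ, norm_div, norm_mul, norm_mul, Complex.norm_conj, Complex.norm_real, Real.norm_eq_abs,
      div_le_iff₀ (by linarith)]
    have h1 : ‖z'‖ * ‖z‖ ≤ 11 / 10 * (11 / 10) := by
      have := (nearDisc_norm hz).2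
      have := (nearDisc_norm hz').2
      gcongr
    have h2 := abs_nonneg Δ
    nlinarith
  have hδ2 : ‖δ‖ ≤ 1 / 2 := by linarith
  have hlog : ‖Complex.log (1 + δ)‖ ≤ 2 * |Δ| := by
    refine (Complex.norm_log_one_add_half_le_self hδ2).trans ?_
    have := abs_nonneg Δ
    linarith
  have hlog' := (Complex.abs_im_le_norm (Complex.log (1 + δ))).trans hlog
  have hδ0 : 1 + δ ≠ 0 := fun h => by
    have : δ = -1 := by linear_combination h
    rw [this] at hδ2
    norm_num at hδ2
  set T := Complex.log u - Complex.log W + (Complex.log z' + (starRingEnd ℂ) (Complex.log z))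
    - Complex.log (1 + δ) with hT
  have hexp : Complex.exp T = 1 := by
    rw [hT, Complex.exp_sub, Complex.exp_add, Complex.exp_sub, Complex.exp_add, Complex.exp_conj,
      Complex.exp_log hu0, Complex.exp_log hW0, Complex.exp_log hz0, Complex.exp_log hz0',
      Complex.exp_log hδ0, div_eq_one_iff_eq hδ0, huw, hδ]
    field_simp
    ring
  obtain ⟨n, hn⟩ := Complex.exp_eq_one_iff.1 hexp
  have hTim : T.im = u.arg - W.arg + (z'.arg - z.arg) - (Complex.log (1 + δ)).im := by
    simp only [hT, Complex.sub_im, Complex.add_im, Complex.conj_im, Complex.log_im]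
    ring
  have hTn : T.im = n * (2 * π) := by
    rw [hn]
    simp
  have hn0 : n = 0 := by
    have a1 := Complex.arg_nonneg_iff.2 hu.le
    have a2 := Complex.arg_le_pi u
    have a3 := Complex.arg_nonneg_iff.2 (show 0 ≤ W.im by linarith)
    have a4 := Complex.arg_le_pi W
    have a5 := abs_le.1 (nearDisc_abs_arg_sub_le hρ hz)
    have a6 := abs_le.1 (nearDisc_abs_arg_sub_le hρ' hz')
    have a7 := abs_le.1 hlog'
    have hπ := Real.pi_gt_three
    have h1 : |(n : ℝ)| < 1 := by
      rw [abs_lt]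
      constructor <;> nlinarith [hρ.1, hρ.2, hρ'.1, hρ'.2, a5.1, a5.2, a6.1, a6.2, a7.1, a7.2]
    have h2 : |n| < 1 := by exact_mod_cast h1
    rwa [Int.abs_lt_one_iff] at h2
  rw [hn0] at hTn
  have h3 : u.arg - W.arg + (z'.arg - z.arg) = (Complex.log (1 + δ)).im := by
    have : T.im = 0 := by simpa using hTn
    linarith
  rw [h3]
  exact hlog'

theorem SmoothSection.abs_rot_sub_le {α ρ ρ' E E' : ℝ} {w : ℝ → ℝ} {z z' : ℝ → ℂ}
    (h : SmoothSection α ρ E w z) (h' : SmoothSection α ρ' E' w z') (hρ : ρ ∈ Set.Ioo (1 : ℝ) 2)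
    (hρ' : ρ' ∈ Set.Ioo (1 : ℝ) 2) : |ρ' - ρ| ≤ 2 * |E' - E| := by
  rcases lt_or_ge (1 / 2) |E' - E| with hΔ | hΔ
  · have : |ρ' - ρ| ≤ 1 := by
      rw [abs_le]
      constructor <;> linarith [hρ.1, hρ.2, hρ'.1, hρ'.2]
    linarith
  set W : ℝ → ℂ := fun x => z' x - (starRingEnd ℂ) (z x) with hW
  have hWim : ∀ x, 0 < (W x).im := fun x => by
    have := nearDisc_im hρ (h.near x)
    have := nearDisc_im hρ' (h'.near x)
    simp only [hW, Complex.sub_im, Complex.conj_im]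
    linarith
  have hshift : ∀ x, W (x + α) = ((E' - E : ℝ) : ℂ) +
      (z' x - (starRingEnd ℂ) (z x)) / (z' x * (starRingEnd ℂ) (z x)) := by
    intro x
    have h1 := congrArg (starRingEnd ℂ) (h.eq x)
    have h2 := h'.eq x
    simp only [map_add, map_div₀, map_one, map_sub, Complex.conj_ofReal] at h1
    have hz0 : (starRingEnd ℂ) (z x) ≠ 0 := by simpa using nearDisc_ne_zero (h.near x)
    have hz0' := nearDisc_ne_zero (h'.near x)
    have h3 : (z' x - (starRingEnd ℂ) (z x)) / (z' x * (starRingEnd ℂ) (z x)) =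
        1 / (starRingEnd ℂ) (z x) - 1 / z' x := by field_simp
    rw [h3]
    push_cast
    simp only [hW]
    linear_combination h2 - h1
  have hpt : ∀ x, |(W (x + α)).arg - (W x).arg + ((z' x).arg - (z x).arg)| ≤ 2 * |E' - E| :=
    fun x => exists_arg_shift hρ hρ' hΔ (h.near x) (h'.near x) (hWim _) (hshift x)
  have hcont : ∀ {f : ℝ → ℂ}, Continuous f → (∀ x, 0 < (f x).im) →
      Continuous fun x => (f x).arg := fun {f} hf hf0 =>
    continuous_iff_continuousAt.2 fun x =>
      ((Complex.continuousAt_arg (Or.inr (hf0 x).ne')).comp hf.continuousAt)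
  have cz := h.smooth.continuous
  have cz' := h'.smooth.continuous
  have cW : Continuous W := cz'.sub (Complex.continuous_conj.comp cz)
  have i1 : Continuous fun x => (W (x + α)).arg :=
    hcont (f := fun x => W (x + α)) (cW.comp (continuous_add_const α)) fun x => hWim _
  have i2 : Continuous fun x => (W x).arg := hcont cW hWim
  have i3 : Continuous fun x => (z' x).arg :=
    hcont cz' fun x => by linarith [nearDisc_im hρ' (h'.near x)]
  have i4 : Continuous fun x => (z x).arg :=
    hcont cz fun x => by linarith [nearDisc_im hρ (h.near x)]
  have hper : Function.Periodic (fun x => (W x).arg) 1 := fun x => by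
    simp only [hW, h.per x, h'.per x]
  have hinv : ∫ x in (0 : ℝ)..1, (W (x + α)).arg = ∫ x in (0 : ℝ)..1, (W x).arg := by
    rw [intervalIntegral.integral_comp_add_right (fun x => (W x).arg) α]
    have := hper.intervalIntegral_add_eq α 0
    simpa [add_comm] using this
  have hintegral : ∫ x in (0 : ℝ)..1, ((W (x + α)).arg - (W x).arg + ((z' x).arg - (z x).arg)) =
      ρ' - ρ := by
    have r := h.rot
    have r' := h'.rot
    simp only [Complex.log_im] at r r'
    have i12 : Continuous fun x => (W (x + α)).arg - (W x).arg := i1.sub i2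
    have i34 : Continuous fun x => (z' x).arg - (z x).arg := i3.sub i4
    rw [intervalIntegral.integral_add (i12.intervalIntegrable _ _)
      (i34.intervalIntegrable _ _), intervalIntegral.integral_sub
      (i1.intervalIntegrable _ _) (i2.intervalIntegrable _ _), intervalIntegral.integral_sub
      (i3.intervalIntegrable _ _) (i4.intervalIntegrable _ _), hinv, r, r']
    ring
  have := intervalIntegral.norm_integral_le_of_norm_le_const (a := 0) (b := 1)
    (f := fun x => (W (x + α)).arg - (W x).arg + ((z' x).arg - (z x).arg)) fun x _ => hpt x
  rw [hintegral] at this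
  simpa using this

theorem volume_pos_of_lipschitz_inverse {S T : Set ℝ} (hS : 0 < volume S) {P : ℝ → ℝ → Prop}
    (hex : ∀ ρ ∈ S, ∃ E ∈ T, P ρ E)
    (hlip : ∀ ρ ∈ S, ∀ ρ' ∈ S, ∀ E E', P ρ E → P ρ' E' → |ρ' - ρ| ≤ 2 * |E' - E|) :
    0 < volume T := by
  choose! E hET hEP using hex
  have hinj : Set.InjOn E S := fun ρ hρ ρ' hρ' h => by
    have := hlip ρ hρ ρ' hρ' _ _ (hEP ρ hρ) (hEP ρ' hρ')
    rw [h, sub_self, abs_zero, mul_zero] at this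
    linarith [abs_nonpos_iff.1 this]
  have h1 : LipschitzOnWith 2 (Function.invFunOn E S) (E '' S) := by
    refine LipschitzOnWith.of_dist_le_mul ?_
    rintro _ ⟨ρ, hρ, rfl⟩ _ ⟨ρ', hρ', rfl⟩
    rw [hinj.leftInvOn_invFunOn hρ, hinj.leftInvOn_invFunOn hρ', Real.dist_eq, Real.dist_eq]
    exact hlip ρ' hρ' ρ hρ _ _ (hEP ρ' hρ') (hEP ρ hρ)
  have h2 := h1.hausdorffMeasure_image_le zero_le_one
  rw [MeasureTheory.hausdorffMeasure_real, hinj.leftInvOn_invFunOn.image_image] at h2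
  have h3 : volume (E '' S) ≤ volume T := measure_mono (Set.image_subset_iff.2 hET)
  refine pos_iff_ne_zero.2 fun h0 => hS.ne' ?_
  have h4 : volume (E '' S) = 0 := le_antisymm (h3.trans h0.le) zero_le
  rw [h4, mul_zero] at h2
  exact le_antisymm h2 zero_le

/-- Theorem 2: for `v` close to a constant, the set of energies at which the Schrödinger
cocycle is rotations-reducible has positive Lebesgue measure. -/
theorem statement3 (r₀ : ℕ) (hr₀ : 200 ≤ r₀) :
    ∃ ε₀ : ℝ, 0 < ε₀ ∧ ∀ α : ℝ, Irrational α →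
      ∀ v : ℝ → ℝ, ContDiff ℝ (⊤ : ℕ∞) v → Function.Periodic v 1 →
      (∃ c : ℝ, Cnorm (50 * r₀) (fun x => v x - c) < ε₀) →
      0 < volume {E : ℝ | RotationsReducible α (schrodingerCocycle v E)} := by
  obtain ⟨ε, hε, H⟩ := exists_smoothSections (n := 50 * r₀) (by omega)
  refine ⟨ε, hε, ?_⟩
  rintro α hα v hv hp ⟨c, hc⟩
  obtain ⟨r, hr, hsec⟩ := H α hα _ (hv.sub contDiff_const) (fun x => by rw [hp x]) hc
  have h1 : 0 < volume ((fun E => E + c) ⁻¹'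
      {E : ℝ | RotationsReducible α (schrodingerCocycle v E)}) := by
    refine volume_pos_of_lipschitz_inverse hr
      (P := fun ρ E => ∃ z, SmoothSection α ρ E (fun x => v x - c) z) (fun ρ hρ => ?_) ?_
    · obtain ⟨E, z, hz⟩ := hsec ρ hρ
      refine ⟨E, ?_, z, hz⟩
      refine RotationsReducible.of_section hz.smooth hz.per
        (fun x => by linarith [nearDisc_im hρ.1 (hz.near x)]) fun x => ?_
      rw [hz.eq x]
      push_cast
      ring
    · rintro ρ hρ ρ' hρ' E E' ⟨z, hz⟩ ⟨z', hz'⟩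
      exact hz.abs_rot_sub_le hz' hρ.1 hρ'.1
  rwa [measure_preimage_add_right] at h1
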